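/- Let n ∈ ℕ, let C_n be the class of separable unital C*-algebras D with decomposition rank dr(D) ≤ n, let P ⊆ A be an inclusion of separable unital C*-algebras, and let E : A → P be a faithful conditional expectation of index finite type with the Rokhlin property. If A is a unital local C_n-algebra, then dr(P) ≤ n. -/

import Mathlib

noncomputable section
set_option linter.unusedSectionVars false

open scoped ComplexOrder Matrix.Norms.L2Operator
open Filter Topology

/-- An element of a `*`-ring is *positive* (in the C*-algebraic sense) if it has the
form `star y * y`. -/
def IsPosElem {R : Type*} [Mul R] [Star R] (a : R) : Prop :=
  ∃ y : R, a = star y * y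

/-- A linear functional on a unital complex `*`-algebra is a *tracial state* if it is unital,
positive and tracial. -/
def IsTracialState {R : Type*} [Ring R] [StarRing R] [Module ℂ R] (τ : R →ₗ[ℂ] ℂ) : Prop :=
  τ 1 = 1 ∧ (∀ x : R, 0 ≤ τ (star x * x)) ∧ ∀ a b : R, τ (a * b) = τ (b * a)

/-- A linear map between complex `*`-algebras is *completely positive* if all of its matrix
amplifications map positive elements to positive elements. -/
def IsCompletelyPositive {A B : Type*} [Ring A] [StarRing A] [Module ℂ A]
    [Ring B] [StarRing B] [Module ℂ B] (φ : A →ₗ[ℂ] B) : Prop :=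
  ∀ (k : ℕ) (x : Matrix (Fin k) (Fin k) A), IsPosElem x → IsPosElem (x.map φ)

/-- A map has *order zero* on a subset if it preserves orthogonality there. -/
def OrderZeroOn {F D : Type*} [Mul F] [Zero F] [Mul D] [Zero D] (φ : F → D) (s : Set F) : Prop :=
  ∀ e ∈ s, ∀ f ∈ s, e * f = 0 → f * e = 0 → φ e * φ f = 0 ∧ φ f * φ e = 0

/-- The finite-dimensional C*-algebra `⊕_{i=1}^s M_{r i}(ℂ)`. -/
abbrev FDBlock (s : ℕ) (r : Fin s → ℕ) : Type :=
  ∀ i : Fin s, Matrix (Fin (r i)) (Fin (r i)) ℂ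

/-- The elements of `⊕_{i=1}^s M_{r i}(ℂ)` supported on the blocks with label `j`. -/
def blockSupp {s : ℕ} {r : Fin s → ℕ} {n : ℕ} (J : Fin s → Fin (n + 1)) (j : Fin (n + 1)) :
    Set (FDBlock s r) :=
  {x | ∀ i : Fin s, J i ≠ j → x i = 0}

/-- `DecompositionRankLE n D` : the C*-algebra `D` has decomposition rank at most `n`. -/
def DecompositionRankLE (n : ℕ) (D : Type*) [NormedRing D] [StarRing D]
    [NormedAlgebra ℂ D] : Prop :=
  ∀ (S : Finset D) (ε : ℝ), 0 < ε →
    ∃ (s : ℕ) (r : Fin s → ℕ) (J : Fin s → Fin (n + 1))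
      (ψ : D →ₗ[ℂ] FDBlock s r) (φ : FDBlock s r →ₗ[ℂ] D),
      IsCompletelyPositive ψ ∧ IsCompletelyPositive φ ∧
      (∀ a : D, ‖ψ a‖ ≤ ‖a‖) ∧ (∀ x : FDBlock s r, ‖φ x‖ ≤ ‖x‖) ∧
      (∀ j : Fin (n + 1), OrderZeroOn φ (blockSupp J j)) ∧
      ∀ a ∈ S, ‖φ (ψ a) - a‖ < ε

/-- `NuclearDimensionLE n D` : the C*-algebra `D` has nuclear dimension at most `n`. -/
def NuclearDimensionLE (n : ℕ) (D : Type*) [NormedRing D] [StarRing D]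
    [NormedAlgebra ℂ D] : Prop :=
  ∀ (S : Finset D) (ε : ℝ), 0 < ε →
    ∃ (s : ℕ) (r : Fin s → ℕ) (J : Fin s → Fin (n + 1))
      (ψ : D →ₗ[ℂ] FDBlock s r) (φ : FDBlock s r →ₗ[ℂ] D),
      IsCompletelyPositive ψ ∧ IsCompletelyPositive φ ∧
      (∀ a : D, ‖ψ a‖ ≤ ‖a‖) ∧
      (∀ j : Fin (n + 1), (∀ x ∈ blockSupp J j, ‖φ x‖ ≤ ‖x‖) ∧
        OrderZeroOn φ (blockSupp J j)) ∧
      ∀ a ∈ S, ‖φ (ψ a) - a‖ < ε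

/-- A bundled unital C*-algebra. -/
structure CStarAlg : Type 1 where
  carrier : Type
  [str : CStarAlgebra carrier]

attribute [instance] CStarAlg.str

/-- The *finite saturation* of a class `𝒞` of unital C*-algebras: the smallest class
containing `𝒞` which is closed under isomorphism, finite direct sums, matrix amplifications
and corners by nonzero projections. -/
inductive FinSat (𝒞 : CStarAlg → Prop) : CStarAlg → Prop
  | base {B : CStarAlg} : 𝒞 B → FinSat 𝒞 B
  | iso {B B' : CStarAlg} : FinSat 𝒞 B → Nonempty (B'.carrier ≃⋆ₐ[ℂ] B.carrier) →
      FinSat 𝒞 B'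
  | sum {B₁ B₂ B : CStarAlg} : FinSat 𝒞 B₁ → FinSat 𝒞 B₂ →
      Nonempty (B.carrier ≃⋆ₐ[ℂ] (B₁.carrier × B₂.carrier)) → FinSat 𝒞 B
  | matrix {B B' : CStarAlg} (k : ℕ) : FinSat 𝒞 B →
      Nonempty (B'.carrier ≃⋆ₐ[ℂ] Matrix (Fin (k + 1)) (Fin (k + 1)) B.carrier) →
      FinSat 𝒞 B'
  | corner {B B' : CStarAlg} (p : B.carrier) : FinSat 𝒞 B → p ≠ 0 → p * p = p →
      star p = p →
      (∃ ι : B'.carrier →⋆ₙₐ[ℂ] B.carrier, Function.Injective ι ∧ ι 1 = p ∧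
        Set.range ι = {x : B.carrier | p * x * p = x}) →
      FinSat 𝒞 B'

/-- `A` is a *unital local `𝒞`-algebra*. -/
def IsUnitalLocalAlg (𝒞 : CStarAlg → Prop) (A : Type*) [NormedRing A] [StarRing A]
    [NormedAlgebra ℂ A] : Prop :=
  ∀ (S : Finset A) (ε : ℝ), 0 < ε →
    ∃ B : CStarAlg, FinSat 𝒞 B ∧
      ∃ φ : B.carrier →⋆ₐ[ℂ] A, ∀ a ∈ S, ∃ b : B.carrier, ‖a - φ b‖ < ε

/-- The class of separable unital C*-algebras with decomposition rank at most `n`. -/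
def drClass (n : ℕ) : CStarAlg → Prop :=
  fun B => TopologicalSpace.SeparableSpace B.carrier ∧ DecompositionRankLE n B.carrier

/-- The class of separable unital C*-algebras with nuclear dimension at most `n`. -/
def nucClass (n : ℕ) : CStarAlg → Prop :=
  fun B => TopologicalSpace.SeparableSpace B.carrier ∧ NuclearDimensionLE n B.carrier

/-- The class of separable unital C*-algebras with finite nuclear dimension. -/
def lnucClass : CStarAlg → Prop :=
  fun B => TopologicalSpace.SeparableSpace B.carrier ∧ ∃ n : ℕ, NuclearDimensionLE n B.carrier

/-- A separable unital C*-algebra has *locally finite nuclear dimension* if it is a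
unital local `C_lnuc`-algebra. -/
def HasLocallyFiniteNuclearDimension (A : Type*) [NormedRing A] [StarRing A]
    [NormedAlgebra ℂ A] : Prop :=
  IsUnitalLocalAlg lnucClass A
/-! ### Group actions and the Rokhlin property -/

/-- `α : G → (A →⋆ₐ[ℂ] A)` is an action of the group `G` on `A` by *-automorphisms. -/
def IsGroupAction {G A : Type*} [Group G] [CStarAlgebra A] (α : G → (A →⋆ₐ[ℂ] A)) : Prop :=
  (∀ a : A, α 1 a = a) ∧ ∀ (g h : G) (a : A), α g (α h a) = α (g * h) a

/-- The fixed point algebra `A^α` of an action, as a star subalgebra of `A`. -/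
def fixedPointAlgebra {G A : Type*} [Group G] [CStarAlgebra A] (α : G → (A →⋆ₐ[ℂ] A)) :
    StarSubalgebra ℂ A where
  carrier := {a : A | ∀ g : G, α g a = a}
  mul_mem' := fun {a} {b} ha hb g => by rw [map_mul, ha g, hb g]
  add_mem' := fun {a} {b} ha hb g => by rw [map_add, ha g, hb g]
  algebraMap_mem' := fun c g => by rw [AlgHomClass.commutes]
  star_mem' := fun {a} ha g => by rw [map_star, ha g]

/-- The Rokhlin property for a finite group action, expressed in terms of representing
sequences for projections in `A_∞ = (ℓ^∞(ℕ,A)/c₀(ℕ,A)) ∩ A'`. -/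
def ActionHasRokhlin {G A : Type*} [Group G] [Fintype G] [CStarAlgebra A]
    (α : G → (A →⋆ₐ[ℂ] A)) : Prop :=
  ∃ e : G → ℕ → A,
    (∀ g, ∃ M : ℝ, ∀ k, ‖e g k‖ ≤ M) ∧
    (∀ g, Tendsto (fun k => ‖e g k * e g k - e g k‖) atTop (𝓝 0)) ∧
    (∀ g, Tendsto (fun k => ‖star (e g k) - e g k‖) atTop (𝓝 0)) ∧
    (∀ g (a : A), Tendsto (fun k => ‖e g k * a - a * e g k‖) atTop (𝓝 0)) ∧
    Tendsto (fun k => ‖(∑ g : G, e g k) - 1‖) atTop (𝓝 0) ∧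
    (∀ g h, Tendsto (fun k => ‖α g (e h k) - e (g * h) k‖) atTop (𝓝 0))

/-! ### Inclusions of unital C*-algebras, conditional expectations, Watatani index -/

variable {P A : Type*}

/-- `E : A →ₗ[ℂ] P` is a conditional expectation onto the subalgebra `P` (included in `A`
via the injective unital *-homomorphism `ι`). -/
structure IsCondExpect [CStarAlgebra P] [CStarAlgebra A] (ι : P →⋆ₐ[ℂ] A)
    (E : A →ₗ[ℂ] P) : Prop where
  restricts : ∀ p : P, E (ι p) = p
  pos : ∀ x : A, IsPosElem (E (star x * x))
  bimodule : ∀ (p q : P) (x : A), E (ι p * x * ι q) = p * E x * q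

/-- `{(u i, v i)}` is a quasi-basis for the conditional expectation `E`; the existence of a
quasi-basis says precisely that `E` is of index-finite type. -/
def IsQuasiBasis [CStarAlgebra P] [CStarAlgebra A] (ι : P →⋆ₐ[ℂ] A) (E : A →ₗ[ℂ] P)
    {m : ℕ} (u v : Fin m → A) : Prop :=
  ∀ a : A, (a = ∑ i, u i * ι (E (v i * a))) ∧ (a = ∑ i, ι (E (a * u i)) * v i)

/-- The Rokhlin property for a conditional expectation of index-finite type with index
`ind = ∑ u i * v i` : there is a projection `e` in `A_∞ = (ℓ^∞(ℕ,A)/c₀(ℕ,A)) ∩ A'`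
(given by a representing sequence) with `E^∞(e) = (Index E)⁻¹ · 1` such that `x ↦ x e`
is injective on `A`. -/
def CondExpectHasRokhlin [CStarAlgebra P] [CStarAlgebra A] (ι : P →⋆ₐ[ℂ] A)
    (E : A →ₗ[ℂ] P) (ind : A) : Prop :=
  ∃ e : ℕ → A,
    (∃ M : ℝ, ∀ k, ‖e k‖ ≤ M) ∧
    Tendsto (fun k => ‖e k * e k - e k‖) atTop (𝓝 0) ∧
    Tendsto (fun k => ‖star (e k) - e k‖) atTop (𝓝 0) ∧
    (∀ a : A, Tendsto (fun k => ‖e k * a - a * e k‖) atTop (𝓝 0)) ∧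
    (∃ w : A, w * ind = 1 ∧ ind * w = 1 ∧
      Tendsto (fun k => ‖ι (E (e k)) - w‖) atTop (𝓝 0)) ∧
    (∀ x : A, Tendsto (fun k => ‖x * e k‖) atTop (𝓝 0) → x = 0)

/-! ### Cuntz comparison, dimension functions, strict comparison, almost divisibility -/

/-- Cuntz subequivalence for positive matrices over a C*-algebra (the topology on matrices
over a C*-algebra is the norm topology, which agrees with the product topology). -/
def CuntzSub {R : Type*} [NonUnitalNonAssocSemiring R] [Star R] [TopologicalSpace R]
    {m k : Type*} [Fintype m] [Fintype k] (a : Matrix m m R) (b : Matrix k k R) : Prop :=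
  ∃ v : ℕ → Matrix m k R, Tendsto (fun j => v j * b * (v j).conjTranspose) atTop (𝓝 a)

/-- `matNthRoot a j` is the (unique, if it exists) positive `j`-th root `a^{1/j}` of a
positive matrix `a` over a C*-algebra. -/
def matNthRoot {R : Type*} [Ring R] [StarRing R] {m : Type*} [Fintype m] [DecidableEq m]
    (a : Matrix m m R) (j : ℕ) : Matrix m m R :=
  open scoped Classical in
  if h : ∃ b : Matrix m m R, IsPosElem b ∧ b ^ j = a then h.choose else 0

/-- The standard extension `τ ⊗ Tr` of a functional `τ` to matrices. -/
def traceExt {R : Type*} [Ring R] [Module ℂ R] {m : Type*} [Fintype m]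
    (τ : R →ₗ[ℂ] ℂ) (x : Matrix m m R) : ℂ :=
  ∑ i, τ (x i i)

/-- The dimension function `d_τ(a) = lim_{n → ∞} τ(a^{1/n})` associated to a tracial
state `τ` (the limit exists, so it agrees with the `limsup` used here). -/
def dimFun {R : Type*} [Ring R] [StarRing R] [Module ℂ R] {m : Type*} [Fintype m]
    [DecidableEq m] (τ : R →ₗ[ℂ] ℂ) (a : Matrix m m R) : ℝ :=
  Filter.limsup (fun j : ℕ => (traceExt τ (matNthRoot a (j + 1))).re) atTop

/-- A unital C*-algebra `R` has *strict comparison* (of positive elements, with respect to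
tracial states) if `d_τ(a) < d_τ(b)` for all tracial states `τ` implies `a ≾ b`. -/
def HasStrictComparison (R : Type*) [Ring R] [StarRing R] [Module ℂ R]
    [TopologicalSpace R] : Prop :=
  ∀ (m k : ℕ) (a : Matrix (Fin m) (Fin m) R) (b : Matrix (Fin k) (Fin k) R),
    IsPosElem a → IsPosElem b →
    (∀ τ : R →ₗ[ℂ] ℂ, IsTracialState τ → dimFun τ a < dimFun τ b) →
    CuntzSub a b

/-- The Cuntz semigroup `W(R)` is *almost divisible*: for every positive contraction `a`
over `R` and every `k ≠ 0` there is `x = ⟨c⟩ ∈ W(R)` with `k ⬝ x ≤ ⟨a⟩ ≤ (k+1) ⬝ x`. -/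
def AlmostDivisible (R : Type*) [Ring R] [StarRing R] [TopologicalSpace R] : Prop :=
  ∀ (m : ℕ) (a : Matrix (Fin m) (Fin m) R),
    IsPosElem a → IsPosElem ((1 : Matrix (Fin m) (Fin m) R) - a) →
    ∀ k : ℕ, k ≠ 0 →
      ∃ (l : ℕ) (c : Matrix (Fin l) (Fin l) R), IsPosElem c ∧
        CuntzSub (Matrix.blockDiagonal fun _ : Fin k => c) a ∧
        CuntzSub a (Matrix.blockDiagonal fun _ : Fin (k + 1) => c)

/-- A unital C*-algebra is *pure* if it has strict comparison and almost divisible Cuntz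
semigroup. -/
def IsPure (R : Type*) [Ring R] [StarRing R] [Module ℂ R] [TopologicalSpace R] : Prop :=
  HasStrictComparison R ∧ AlmostDivisible R

/-- The order on projections over `R` is determined by traces. -/
def ProjOrderDeterminedByTraces (R : Type*) [Ring R] [StarRing R] [Module ℂ R] : Prop :=
  ∀ (k l : ℕ) (p : Matrix (Fin k) (Fin k) R) (q : Matrix (Fin l) (Fin l) R),
    p * p = p → star p = p → q * q = q → star q = q →
    (∀ τ : R →ₗ[ℂ] ℂ, IsTracialState τ → (traceExt τ p).re < (traceExt τ q).re) →
    ∃ v : Matrix (Fin l) (Fin k) R,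
      v.conjTranspose * v = p ∧ IsPosElem (q - v * v.conjTranspose)

/-- A unital C*-algebra has stable rank one if its invertible elements are dense. -/
def HasStableRankOne (R : Type*) [Ring R] [TopologicalSpace R] : Prop :=
  Dense {x : R | IsUnit x}

/-- A unital C*-algebra is simple if it has no nontrivial closed two-sided ideals. -/
def IsSimpleCStarAlgebra (A : Type*) [CStarAlgebra A] : Prop :=
  ∀ I : TwoSidedIdeal A, IsClosed (I : Set A) → I = ⊥ ∨ I = ⊤
/-! ### Corners `pRp` by a projection `p` -/

section CornerSection

variable {R : Type*} [Ring R] [StarRing R] [Algebra ℂ R] [StarModule ℂ R]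

/-- The corner `p R p` of a unital C*-algebra `R` by a projection `p`, as a unital
`*`-algebra with unit `p`. -/
def Corner (p : R) (_hp : p * p = p) (_hsp : star p = p) : Type _ :=
  {x : R // p * x * p = x}

namespace Corner

variable {p : R} {hp : p * p = p} {hsp : star p = p}

theorem mem_mul_left (hp : p * p = p) {x : R} (hx : p * x * p = x) : p * x = x := by
  conv_lhs => rw [← hx]
  simp only [← mul_assoc]
  rw [hp, hx]

theorem mem_mul_right (hp : p * p = p) {x : R} (hx : p * x * p = x) : x * p = x := by
  conv_lhs => rw [← hx]
  rw [mul_assoc, mul_assoc, hp, ← mul_assoc, hx]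

instance : Add (Corner p hp hsp) :=
  ⟨fun x y => ⟨x.1 + y.1, by rw [mul_add, add_mul, x.2, y.2]⟩⟩

instance : Zero (Corner p hp hsp) :=
  ⟨⟨0, by rw [mul_zero, zero_mul]⟩⟩

instance : Neg (Corner p hp hsp) :=
  ⟨fun x => ⟨-x.1, by rw [mul_neg, neg_mul, x.2]⟩⟩

instance : Mul (Corner p hp hsp) :=
  ⟨fun x y => ⟨x.1 * y.1, by
    rw [← mul_assoc p x.1 y.1, mem_mul_left hp x.2, mul_assoc x.1 y.1 p,
      mem_mul_right hp y.2]⟩⟩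

instance : One (Corner p hp hsp) :=
  ⟨⟨p, by rw [hp, hp]⟩⟩

instance : SMul ℂ (Corner p hp hsp) :=
  ⟨fun c x => ⟨c • x.1, by rw [mul_smul_comm, smul_mul_assoc, x.2]⟩⟩

instance : Star (Corner p hp hsp) :=
  ⟨fun x => ⟨star x.1, by
    conv_rhs => rw [← x.2]
    rw [star_mul, star_mul, hsp, ← mul_assoc]⟩⟩

@[simp] theorem val_add (x y : Corner p hp hsp) : (x + y).1 = x.1 + y.1 := rfl
@[simp] theorem val_mul (x y : Corner p hp hsp) : (x * y).1 = x.1 * y.1 := rfl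
@[simp] theorem val_zero : (0 : Corner p hp hsp).1 = 0 := rfl
@[simp] theorem val_one : (1 : Corner p hp hsp).1 = p := rfl
@[simp] theorem val_neg (x : Corner p hp hsp) : (-x).1 = -x.1 := rfl
@[simp] theorem val_smul (c : ℂ) (x : Corner p hp hsp) : (c • x).1 = c • x.1 := rfl
@[simp] theorem val_star (x : Corner p hp hsp) : (star x).1 = star x.1 := rfl

instance instRing : Ring (Corner p hp hsp) where
  add_assoc x y z := Subtype.ext <| by simp [add_assoc]
  zero_add x := Subtype.ext <| by simp
  add_zero x := Subtype.ext <| by simp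
  add_comm x y := Subtype.ext <| by simp [add_comm]
  neg_add_cancel x := Subtype.ext <| by simp
  nsmul := nsmulRec
  zsmul := zsmulRec
  mul_assoc x y z := Subtype.ext <| by simp [mul_assoc]
  one_mul x := Subtype.ext <| by simpa using mem_mul_left hp x.2
  mul_one x := Subtype.ext <| by simpa using mem_mul_right hp x.2
  left_distrib x y z := Subtype.ext <| by simp [left_distrib]
  right_distrib x y z := Subtype.ext <| by simp [right_distrib]
  zero_mul x := Subtype.ext <| by simp
  mul_zero x := Subtype.ext <| by simp

instance instStarRing : StarRing (Corner p hp hsp) where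
  star_involutive x := Subtype.ext <| by simp
  star_mul x y := Subtype.ext <| by simp
  star_add x y := Subtype.ext <| by simp

instance instModule : Module ℂ (Corner p hp hsp) where
  one_smul x := Subtype.ext <| by simp
  mul_smul c d x := Subtype.ext <| by simp [mul_smul]
  smul_zero c := Subtype.ext <| by simp
  smul_add c x y := Subtype.ext <| by simp
  add_smul c d x := Subtype.ext <| by simp [add_smul]
  zero_smul x := Subtype.ext <| by simp

instance instTop [TopologicalSpace R] : TopologicalSpace (Corner p hp hsp) :=
  instTopologicalSpaceSubtype

end Corner

end CornerSection

/-! ### Sequence algebras: `A^∞ = ℓ^∞(ℕ, A)/c₀(ℕ, A)` via representing sequences -/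

/-- A sequence in a normed space is null (i.e. lies in `c₀(ℕ, A)`). -/
def IsNullSeq {A : Type*} [Norm A] (x : ℕ → A) : Prop :=
  Tendsto (fun n => ‖x n‖) atTop (𝓝 0)

/-- A sequence in a normed space is bounded (i.e. lies in `ℓ^∞(ℕ, A)`). -/
def IsBddSeq {A : Type*} [Norm A] (x : ℕ → A) : Prop :=
  ∃ M : ℝ, ∀ n, ‖x n‖ ≤ M

/-- A linear map `β : A →ₗ[ℂ] ℓ^∞(ℕ, P)` represents a unital *-homomorphism
`A → P^∞ = ℓ^∞(ℕ, P)/c₀(ℕ, P)` : it takes values in bounded sequences and is unital,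
multiplicative and star-preserving modulo `c₀(ℕ, P)`. -/
structure RepresentsHomToSeqAlg {A P : Type*} [CStarAlgebra A] [CStarAlgebra P]
    (β : A →ₗ[ℂ] (ℕ → P)) : Prop where
  bdd : ∀ x : A, IsBddSeq (β x)
  unital : IsNullSeq (β 1 - 1)
  mul : ∀ x y : A, IsNullSeq (β (x * y) - β x * β y)
  star : ∀ x : A, IsNullSeq (β (star x) - star (β x))

/-- A Banach limit: a linear functional on (bounded) complex sequences which is unital,
shift-invariant, positive and bounded. -/
structure IsBanachLimit (L : (ℕ → ℂ) →ₗ[ℂ] ℂ) : Prop where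
  unital : L 1 = 1
  shift : ∀ x : ℕ → ℂ, IsBddSeq x → L (fun n => x (n + 1)) = L x
  pos : ∀ x : ℕ → ℂ, IsBddSeq x → (∀ n, 0 ≤ x n) → 0 ≤ L x
  norm_le : ∀ (x : ℕ → ℂ) (M : ℝ), (∀ n, ‖x n‖ ≤ M) → ‖L x‖ ≤ M

/-- A C*-algebra is *exact* iff it is nuclearly embeddable (Kirchberg): it admits a faithful
representation `π : A → B(H)` which approximately factors through matrix algebras by
completely positive contractions in the point-norm topology. -/
def IsExactCStar (A : Type*) [CStarAlgebra A] : Prop :=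
  ∃ (H : Type) (_ : NormedAddCommGroup H) (_ : InnerProductSpace ℂ H) (_ : CompleteSpace H)
    (π : A →⋆ₐ[ℂ] (H →L[ℂ] H)), Function.Injective π ∧
      ∀ (S : Finset A) (ε : ℝ), 0 < ε →
        ∃ (k : ℕ) (ψ : A →ₗ[ℂ] Matrix (Fin k) (Fin k) ℂ)
          (φ : Matrix (Fin k) (Fin k) ℂ →ₗ[ℂ] (H →L[ℂ] H)),
          IsCompletelyPositive ψ ∧ IsCompletelyPositive φ ∧
          (∀ a : A, ‖ψ a‖ ≤ ‖a‖) ∧ (∀ x, ‖φ x‖ ≤ ‖x‖) ∧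
          ∀ a ∈ S, ‖φ (ψ a) - π a‖ < ε

namespace DRank
section abs
variable {M : Type*} [CStarAlgebra M] [PartialOrder M] [StarOrderedRing M]

lemma norm_le_of_sq {x : M} {K : ℝ} (hK : 0 ≤ K) (h : ‖star x * x‖ ≤ K ^ 2) : ‖x‖ ≤ K := by
  rw [CStarRing.norm_star_mul_self] at h
  nlinarith [norm_nonneg x]

lemma norm_le_of_sq' {x : M} {K : ℝ} (hK : 0 ≤ K) (h : ‖x * star x‖ ≤ K ^ 2) : ‖x‖ ≤ K := by
  rw [CStarRing.norm_self_mul_star] at h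
  nlinarith [norm_nonneg x]

lemma spec_nonneg {B : M} (hB : 0 ≤ B) {x : ℝ} (hx : x ∈ spectrum ℝ B) : 0 ≤ x :=
  spectrum_nonneg_of_nonneg hB hx

lemma star_cfc (q : ℝ → ℝ) (B : M) : star (cfc q B) = cfc q B :=
  (cfc_predicate q B).star_eq

lemma self_mul_cfc {B : M} (hB : 0 ≤ B) {q : ℝ → ℝ} (hq : Continuous q) :
    cfc q B * B * cfc q B = cfc (fun t => t * q t ^ 2) B := by
  have hsa : IsSelfAdjoint B := IsSelfAdjoint.of_nonneg hB
  have h1 : B = cfc (fun t : ℝ => t) B := (cfc_id' ℝ B).symm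
  conv_lhs => rw [h1]
  rw [cfc_id' ℝ B]
  conv_lhs => enter [1, 2]; rw [h1]
  rw [← cfc_mul q (fun t : ℝ => t) B hq.continuousOn continuousOn_id,
    ← cfc_mul _ q B (by fun_prop) hq.continuousOn]
  congr 1; ext t; ring

lemma norm_X_cfc (X : M) {q : ℝ → ℝ} (hq : Continuous q) {K : ℝ} (hK : 0 ≤ K)
    (h : ∀ t : ℝ, 0 ≤ t → t * q t ^ 2 ≤ K ^ 2) : ‖X * cfc q (star X * X)‖ ≤ K := by
  apply norm_le_of_sq hK
  have hB : 0 ≤ star X * X := star_mul_self_nonneg X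
  have : star (X * cfc q (star X * X)) * (X * cfc q (star X * X))
      = cfc (fun t => t * q t ^ 2) (star X * X) := by
    rw [← self_mul_cfc hB hq, star_mul, star_cfc]; simp only [mul_assoc]
  rw [this]
  refine norm_cfc_le (by positivity) fun t ht => ?_
  have h0 := spec_nonneg hB ht
  rw [Real.norm_of_nonneg (by positivity)]
  exact h t h0

lemma norm_X_cfc_mul (X : M) {c s : M} (hs : star s = s) (hsc : s * s = c)
    (hc : c ≤ star X * X) {q : ℝ → ℝ} (hq : Continuous q) {K : ℝ} (hK : 0 ≤ K)
    (h : ∀ t : ℝ, 0 ≤ t → |t * q t| ≤ K) : ‖X * cfc q (star X * X) * s‖ ≤ K := by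
  have hB : 0 ≤ star X * X := star_mul_self_nonneg X
  set B := star X * X with hBdef
  set d := cfc (fun t => Real.sqrt t * q t) B with hd
  have hdsq : d * d = cfc q B * B * cfc q B := by
    rw [self_mul_cfc hB hq, hd, ← cfc_mul _ _ B (by fun_prop) (by fun_prop)]
    apply cfc_congr
    intro t ht
    have := Real.mul_self_sqrt (spec_nonneg hB ht)
    simp only []
    calc _ = (√t * √t) * q t ^ 2 := by ring
      _ = _ := by rw [this]
  have hdd : star d = d := star_cfc _ _
  have e1 : star (X * cfc q B * s) * (X * cfc q B * s) = star (d * s) * (d * s) := by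
    simp only [star_mul, star_cfc, hdd, hs]
    calc s * (cfc q B * star X) * (X * cfc q B * s)
        = s * (cfc q B * (star X * X) * cfc q B) * s := by simp only [mul_assoc]
      _ = _ := by rw [← hBdef, ← hdsq]; simp only [mul_assoc]
  have e2 : ‖X * cfc q B * s‖ = ‖d * s‖ := by
    have := congrArg norm e1
    rw [CStarRing.norm_star_mul_self, CStarRing.norm_star_mul_self] at this
    exact (mul_self_inj (norm_nonneg _) (norm_nonneg _)).1 this
  rw [e2]
  apply norm_le_of_sq' hK
  have e3 : d * s * star (d * s) = d * c * d := by
    rw [star_mul, hdd, hs, ← hsc]; simp only [mul_assoc]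
  rw [e3]
  have hcn : 0 ≤ c := by
    rw [← hsc]; nth_rewrite 1 [← hs]; exact star_mul_self_nonneg s
  have h1 : 0 ≤ d * c * d := by
    have := star_left_conjugate_nonneg hcn d
    rwa [hdd] at this
  have h2 : d * c * d ≤ d * B * d := by
    have := star_left_conjugate_le_conjugate hc d
    rwa [hdd] at this
  refine (CStarAlgebra.norm_le_norm_of_nonneg_of_le h1 h2).trans ?_
  rw [hd, self_mul_cfc hB (by fun_prop)]
  refine norm_cfc_le (by positivity) fun t ht => ?_
  have h0 := spec_nonneg hB ht
  rw [Real.norm_of_nonneg (by positivity)]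
  have h3 := h t h0
  have : t * (√t * q t)^2 = |t * q t|^2 := by
    rw [sq_abs, mul_pow, Real.sq_sqrt h0]; ring
  rw [this]
  gcongr

lemma sqrt_dist {B c : M} (hc : 0 ≤ c) (hcB : c ≤ B) :
    ‖CFC.sqrt B - CFC.sqrt c‖ ≤ Real.sqrt ‖B - c‖ := by
  set η := ‖B - c‖
  have hη : 0 ≤ η := norm_nonneg _
  have h1 : CFC.sqrt c ≤ CFC.sqrt B := CFC.sqrt_le_sqrt c B hcB
  have hsa : IsSelfAdjoint (B - c) := IsSelfAdjoint.of_nonneg (sub_nonneg.2 hcB)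
  have h2 : B ≤ c + algebraMap ℝ M η := by
    have := hsa.le_algebraMap_norm_self
    rwa [sub_le_iff_le_add'] at this
  have h3 : CFC.sqrt B ≤ CFC.sqrt (c + algebraMap ℝ M η) := CFC.sqrt_le_sqrt _ _ h2
  have hcs : IsSelfAdjoint c := IsSelfAdjoint.of_nonneg hc
  have h4 : CFC.sqrt (c + algebraMap ℝ M η) ≤ CFC.sqrt c + algebraMap ℝ M (Real.sqrt η) := by
    have e1 : c + algebraMap ℝ M η = cfc (fun t : ℝ => t + η) c := by
      rw [cfc_add_const η (fun t => t) c, cfc_id' ℝ c]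
    have hn : (0:M) ≤ c + algebraMap ℝ M η := hc.trans (hcB.trans h2)
    rw [CFC.sqrt_eq_real_sqrt _ hn, CFC.sqrt_eq_real_sqrt _ hc, cfcₙ_eq_cfc, cfcₙ_eq_cfc, e1,
      ← cfc_comp' Real.sqrt (fun t : ℝ => t + η) c, ← cfc_add_const (√η) Real.sqrt c]
    refine cfc_mono ?_ (by fun_prop) (by fun_prop)
    intro t ht
    have h0 := spec_nonneg hc ht
    rw [Real.sqrt_le_left (by positivity)]
    nlinarith [Real.sq_sqrt h0, Real.sq_sqrt hη, Real.sqrt_nonneg t, Real.sqrt_nonneg η,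
      mul_nonneg (Real.sqrt_nonneg t) (Real.sqrt_nonneg η)]
  have h5 : CFC.sqrt B - CFC.sqrt c ≤ algebraMap ℝ M (Real.sqrt η) := by
    rw [sub_le_iff_le_add']; exact h3.trans h4
  exact (CStarAlgebra.norm_le_iff_le_algebraMap _ (Real.sqrt_nonneg _) (sub_nonneg.2 h1)).2 h5

/-- regularised inverse square root -/
def kk (t l : ℝ) : ℝ := (Real.sqrt (max l t))⁻¹

lemma kk_cont {t : ℝ} (ht : 0 < t) : Continuous (kk t) := by
  unfold kk
  refine Continuous.inv₀ (by fun_prop) fun l => ?_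
  exact (Real.sqrt_pos.2 (lt_max_of_lt_right ht)).ne'

lemma kk_sq {t : ℝ} (l : ℝ) (ht : 0 < t) : kk t l ^ 2 = (max l t)⁻¹ := by
  unfold kk
  rw [inv_pow, Real.sq_sqrt (lt_max_of_lt_right ht).le]

lemma kk_nonneg (t l : ℝ) : 0 ≤ kk t l := by unfold kk; positivity

lemma kk_sqrt {t l : ℝ} (ht : 0 < t) (hl : 0 ≤ l) : l * kk t l ≤ Real.sqrt l := by
  have h1 : (l * kk t l) ^ 2 ≤ l := by
    rw [mul_pow, kk_sq l ht, ← div_eq_mul_inv, div_le_iff₀ (lt_max_of_lt_right ht), pow_two]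
    exact mul_le_mul_of_nonneg_left (le_max_left _ _) hl
  exact Real.le_sqrt_of_sq_le h1

lemma kk_diff {s t T l : ℝ} (hs : 0 < s) (ht : 0 < t) (hsT : s ≤ T) (htT : t ≤ T) (hl : 0 ≤ l) :
    |l * (kk s l - kk t l)| ≤ Real.sqrt T := by
  rcases le_total T l with h | h
  · have : kk s l = kk t l := by
      unfold kk; rw [max_eq_left (hsT.trans h), max_eq_left (htT.trans h)]
    rw [this]; simp
  · have h1 := kk_sqrt hs hl
    have h2 := kk_sqrt ht hl
    have h3 := Real.sqrt_le_sqrt h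
    have h4 : 0 ≤ l * kk s l := mul_nonneg hl (kk_nonneg _ _)
    have h5 : 0 ≤ l * kk t l := mul_nonneg hl (kk_nonneg _ _)
    rw [mul_sub, abs_le]
    constructor <;> linarith

lemma tendsto_sqrt_t : Tendsto (fun m : ℕ => Real.sqrt (1 / ((m:ℝ) + 1))) atTop (𝓝 0) := by
  have := (Real.continuous_sqrt.tendsto 0).comp tendsto_one_div_add_atTop_nhds_zero_nat
  rw [Real.sqrt_zero] at this
  exact this

lemma tendsto_of_le_sqrt {E : Type*} [NormedAddCommGroup E] {f : ℕ → E} {a : E}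
    (h : ∀ m : ℕ, ‖f m - a‖ ≤ Real.sqrt (1 / ((m:ℝ) + 1))) : Tendsto f atTop (𝓝 a) := by
  rw [tendsto_iff_norm_sub_tendsto_zero]
  exact squeeze_zero (fun _ => norm_nonneg _) h tendsto_sqrt_t

theorem polar (X c : M) (hc : 0 ≤ c) (hcB : c ≤ star X * X) :
    ∃ v : M, star v * v = c ∧ ‖v - X‖ ≤ Real.sqrt ‖star X * X - c‖ ∧
      (∀ q : M, q * X = X → q * v = v) := by
  have hB : 0 ≤ star X * X := star_mul_self_nonneg X
  obtain ⟨B, hBdef⟩ : ∃ B, B = star X * X := ⟨_, rfl⟩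
  obtain ⟨s, hsdef⟩ : ∃ s, s = CFC.sqrt c := ⟨_, rfl⟩
  have hs : star s = s := by
    rw [hsdef]; exact (IsSelfAdjoint.of_nonneg (CFC.sqrt_nonneg c)).star_eq
  have hsc : s * s = c := by rw [hsdef]; exact CFC.sqrt_mul_sqrt_self c hc
  let t : ℕ → ℝ := fun m => 1 / ((m:ℝ) + 1)
  have tpos : ∀ m, 0 < t m := fun m => by positivity
  have tmono : ∀ {m l : ℕ}, m ≤ l → t l ≤ t m := fun h => by
    apply one_div_le_one_div_of_le (by positivity); exact_mod_cast Nat.succ_le_succ h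
  let w : ℕ → M := fun m => X * cfc (kk (t m)) B * s
  have hdiff : ∀ m l, m ≤ l → ‖w m - w l‖ ≤ Real.sqrt (t m) := by
    intro m l hml
    have : w m - w l = X * cfc (fun x => kk (t m) x - kk (t l) x) B * s := by
      rw [cfc_sub (kk (t m)) (kk (t l)) B (kk_cont (tpos m)).continuousOn
        (kk_cont (tpos l)).continuousOn, mul_sub, sub_mul]
    rw [this, hBdef]
    exact norm_X_cfc_mul X hs hsc hcB ((kk_cont (tpos m)).sub (kk_cont (tpos l)))
      (Real.sqrt_nonneg _) fun x hx => kk_diff (tpos m) (tpos l) le_rfl (tmono hml) hx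
  have hcau : CauchySeq w := by
    refine cauchySeq_of_le_tendsto_0 (fun m => 2 * Real.sqrt (t m)) ?_ ?_
    · intro a b m ha hb
      rw [dist_eq_norm]
      calc ‖w a - w b‖ ≤ ‖w a - w m‖ + ‖w m - w b‖ := norm_sub_le_norm_sub_add_norm_sub ..
        _ ≤ _ := by
          rw [norm_sub_rev (w a)]; linarith [hdiff m a ha, hdiff m b hb]
    · have := tendsto_sqrt_t.const_mul 2
      rw [mul_zero] at this
      exact this
  obtain ⟨v, hv⟩ := cauchySeq_tendsto_of_complete hcau
  refine ⟨v, ?_, ?_, ?_⟩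
  · have h1 : Tendsto (fun m => star (w m) * w m) atTop (𝓝 (star v * v)) :=
      (hv.star).mul hv
    have h2 : Tendsto (fun m => star (w m) * w m) atTop (𝓝 c) := by
      rw [tendsto_iff_norm_sub_tendsto_zero]
      refine squeeze_zero (fun _ => norm_nonneg _) (g := t) (fun m => ?_)
        tendsto_one_div_add_atTop_nhds_zero_nat
      set g : ℝ → ℝ := fun x => Real.sqrt (1 - x * kk (t m) x ^ 2) with hg
      have hgc : Continuous g := by
        have := kk_cont (tpos m); fun_prop
      have hxk : ∀ x : ℝ, 0 ≤ x → 0 ≤ 1 - x * kk (t m) x ^ 2 := fun x hx => by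
        rw [kk_sq x (tpos m), ← div_eq_mul_inv, sub_nonneg,
          div_le_one (lt_max_of_lt_right (tpos m))]; exact le_max_left _ _
      have hd : star (cfc g B) = cfc g B := star_cfc _ _
      have e1 : cfc g B * cfc g B = 1 - cfc (kk (t m)) B * B * cfc (kk (t m)) B := by
        have hB' : 0 ≤ B := hBdef ▸ hB
        have hsa : IsSelfAdjoint B := IsSelfAdjoint.of_nonneg hB'
        have hk := kk_cont (tpos m)
        rw [self_mul_cfc hB' hk, ← cfc_one ℝ B (by exact hsa),
          ← cfc_sub _ _ B (by fun_prop) (by fun_prop),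
          ← cfc_mul _ _ B (by fun_prop) (by fun_prop)]
        apply cfc_congr
        intro x hx
        exact Real.mul_self_sqrt (hxk x (spec_nonneg hB' hx))
      have e2 : star (w m) * w m - c = - (s * (cfc g B * cfc g B) * s) := by
        rw [e1]
        simp only [w, star_mul, star_cfc, hs, ← hsc]
        have : s * (cfc (kk (t m)) B * star X) * (X * cfc (kk (t m)) B * s)
          = s * (cfc (kk (t m)) B * B * cfc (kk (t m)) B) * s := by
          have h9 : s * (cfc (kk (t m)) B * star X) * (X * cfc (kk (t m)) B * s)
            = s * (cfc (kk (t m)) B * (star X * X) * cfc (kk (t m)) B) * s := by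
            simp only [mul_assoc]
          rw [h9, ← hBdef]
        rw [this]; noncomm_ring
      have e3 : s * (cfc g B * cfc g B) * s = star (cfc g B * s) * (cfc g B * s) := by
        rw [star_mul, hd, hs]; simp only [mul_assoc]
      have e4 : cfc g B * s * star (cfc g B * s) = cfc g B * c * cfc g B := by
        rw [star_mul, hd, hs, ← hsc]; simp only [mul_assoc]
      rw [e2, norm_neg, e3, CStarRing.norm_star_mul_self, ← CStarRing.norm_self_mul_star, e4]
      have hB' : 0 ≤ B := hBdef ▸ hB
      have h3 : 0 ≤ cfc g B * c * cfc g B := by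
        have := star_left_conjugate_nonneg hc (cfc g B)
        rwa [hd] at this
      have h4 : cfc g B * c * cfc g B ≤ cfc g B * B * cfc g B := by
        have := star_left_conjugate_le_conjugate (hBdef ▸ hcB : c ≤ B) (cfc g B)
        rwa [hd] at this
      refine (CStarAlgebra.norm_le_norm_of_nonneg_of_le h3 h4).trans ?_
      rw [self_mul_cfc hB' hgc]
      refine norm_cfc_le (tpos m).le fun x hx => ?_
      have h0 := spec_nonneg hB' hx
      rw [Real.norm_of_nonneg (by positivity), hg]
      simp only []
      rw [Real.sq_sqrt (hxk x h0), kk_sq x (tpos m)]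
      have tp := tpos m
      rcases le_total x (t m) with h | h
      · have : 0 ≤ x * (max x (t m))⁻¹ := by positivity
        nlinarith
      · rw [max_eq_left h, mul_inv_cancel₀ (tp.trans_le h).ne']; simp [tp.le]
    exact tendsto_nhds_unique h1 h2
  · have hb : ‖X * cfc (fun x => 0 : ℝ → ℝ) B‖ ≤ 1 := by simp [cfc_const_zero]
    have hB' : 0 ≤ B := hBdef ▸ hB
    have hsa : IsSelfAdjoint B := IsSelfAdjoint.of_nonneg hB'
    have hd := sqrt_dist hc hcB
    rw [← hBdef, ← hsdef] at hd
    have hsq : CFC.sqrt B = cfc Real.sqrt B := by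
      rw [CFC.sqrt_eq_real_sqrt _ hB', cfcₙ_eq_cfc]
    have key : ∀ m, ‖w m - X‖ ≤ Real.sqrt ‖B - c‖ + Real.sqrt (t m) := by
      intro m
      have hk := kk_cont (tpos m)
      have e : w m - X = - (X * cfc (kk (t m)) B * (CFC.sqrt B - s))
          - X * cfc (fun x => 1 - kk (t m) x * Real.sqrt x) B := by
        rw [cfc_sub (fun _ => (1:ℝ)) (fun x => kk (t m) x * Real.sqrt x) B (by fun_prop)
          (by fun_prop), cfc_mul (kk (t m)) Real.sqrt B (by fun_prop) (by fun_prop),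
          cfc_const_one ℝ B, hsq]
        simp only [w]
        noncomm_ring
      have n1 : ‖X * cfc (kk (t m)) B‖ ≤ 1 := by
        rw [hBdef]
        refine norm_X_cfc X hk zero_le_one fun x hx => ?_
        rw [kk_sq x (tpos m), ← div_eq_mul_inv, one_pow,
          div_le_one (lt_max_of_lt_right (tpos m))]
        exact le_max_left _ _
      have n2 : ‖X * cfc (fun x => 1 - kk (t m) x * Real.sqrt x) B‖ ≤ Real.sqrt (t m) := by
        rw [hBdef]
        refine norm_X_cfc X (by fun_prop) (Real.sqrt_nonneg _) fun x hx => ?_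
        rw [Real.sq_sqrt (tpos m).le]
        have tp := tpos m
        rcases le_total x (t m) with h | h
        · have h1 : 0 ≤ kk (t m) x * Real.sqrt x := mul_nonneg (kk_nonneg _ _) (Real.sqrt_nonneg _)
          have h2 : kk (t m) x * Real.sqrt x ≤ 1 := by
            unfold kk
            rw [← div_eq_inv_mul, div_le_one (Real.sqrt_pos.2 (lt_max_of_lt_right tp))]
            exact Real.sqrt_le_sqrt (le_max_left _ _)
          have h3 : (1 - kk (t m) x * Real.sqrt x) ^ 2 ≤ 1 := by nlinarith
          nlinarith
        · unfold kk
          rw [max_eq_left h, inv_mul_cancel₀ (Real.sqrt_pos.2 (tp.trans_le h)).ne']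
          simpa using tp.le
      rw [e]
      calc _ ≤ ‖X * cfc (kk (t m)) B * (CFC.sqrt B - s)‖ + _ := by
            refine (norm_sub_le _ _).trans ?_
            rw [norm_neg]
        _ ≤ ‖X * cfc (kk (t m)) B‖ * ‖CFC.sqrt B - s‖ + Real.sqrt (t m) :=
            add_le_add (norm_mul_le _ _) n2
        _ ≤ 1 * Real.sqrt ‖B - c‖ + Real.sqrt (t m) := by gcongr
        _ = _ := by rw [one_mul]
    rw [← hBdef]
    have h1 : Tendsto (fun m => ‖w m - X‖) atTop (𝓝 ‖v - X‖) := (hv.sub_const X).norm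
    have h2 : Tendsto (fun m => Real.sqrt ‖B - c‖ + Real.sqrt (t m)) atTop
        (𝓝 (Real.sqrt ‖B - c‖ + 0)) := by
      exact tendsto_const_nhds.add tendsto_sqrt_t
    rw [add_zero] at h2
    exact le_of_tendsto_of_tendsto' h1 h2 key
  · intro q hq
    have h1 : Tendsto (fun m => q * w m) atTop (𝓝 (q * v)) := hv.const_mul q
    have h2 : (fun m => q * w m) = w := by
      ext m; simp only [w, ← mul_assoc, hq]
    rw [h2] at h1
    exact tendsto_nhds_unique h1 hv

end abs
end DRank

namespace DRank
section mm
variable {R : Type*} [CStarAlgebra R] [PartialOrder R] [StarOrderedRing R]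
variable {N : Type*} [Fintype N] [DecidableEq N]

abbrev MM (N R : Type*) := CStarMatrix (Option N) (Option N) R

def corF (a : R) : MM N R := CStarMatrix.ofMatrix fun i j =>
  match i, j with
  | none, none => a
  | _, _ => 0

def rowF (w : N → R) : MM N R := CStarMatrix.ofMatrix fun i j =>
  match i, j with
  | none, some p => w p
  | _, _ => 0

def dg (c : N → R) : MM N R := CStarMatrix.ofMatrix fun i j =>
  match i, j with
  | some p, some q => if p = q then c p else 0
  | _, _ => 0

def scF (x : Matrix N N ℂ) : MM N R := CStarMatrix.ofMatrix fun i j =>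
  match i, j with
  | some p, some q => x p q • (1 : R)
  | _, _ => 0

section app
variable (a : R) (w c : N → R) (x : Matrix N N ℂ) (p q : N)
@[simp] lemma corF_nn : (corF a : MM N R) none none = a := rfl
@[simp] lemma corF_ns : (corF a : MM N R) none (some q) = 0 := rfl
@[simp] lemma corF_sn : (corF a : MM N R) (some p) none = 0 := rfl
@[simp] lemma corF_ss : (corF a : MM N R) (some p) (some q) = 0 := rfl
@[simp] lemma rowF_nn : (rowF w : MM N R) none none = 0 := rfl
@[simp] lemma rowF_ns : (rowF w : MM N R) none (some q) = w q := rfl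
@[simp] lemma rowF_sn : (rowF w : MM N R) (some p) none = 0 := rfl
@[simp] lemma rowF_ss : (rowF w : MM N R) (some p) (some q) = 0 := rfl
@[simp] lemma dg_nn : (dg c : MM N R) none none = 0 := rfl
@[simp] lemma dg_ns : (dg c : MM N R) none (some q) = 0 := rfl
@[simp] lemma dg_sn : (dg c : MM N R) (some p) none = 0 := rfl
@[simp] lemma dg_ss : (dg c : MM N R) (some p) (some q) = if p = q then c p else 0 := rfl
@[simp] lemma scF_nn : (scF x : MM N R) none none = 0 := rfl
@[simp] lemma scF_ns : (scF x : MM N R) none (some q) = 0 := rfl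
@[simp] lemma scF_sn : (scF x : MM N R) (some p) none = 0 := rfl
@[simp] lemma scF_ss : (scF x : MM N R) (some p) (some q) = x p q • (1 : R) := rfl
end app

lemma mm_ext {X Y : MM N R} (h1 : X none none = Y none none)
    (h2 : ∀ q, X none (some q) = Y none (some q)) (h3 : ∀ p, X (some p) none = Y (some p) none)
    (h4 : ∀ p q, X (some p) (some q) = Y (some p) (some q)) : X = Y := by
  ext i j
  rcases i with _ | i <;> rcases j with _ | j
  exacts [h1, h2 j, h3 i, h4 i j]

lemma mm_mul (X Y : MM N R) (i j : Option N) :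
    (X * Y) i j = X i none * Y none j + ∑ p, X i (some p) * Y (some p) j := by
  rw [CStarMatrix.mul_apply, Fintype.sum_option]

lemma mm_star (X : MM N R) (i j : Option N) : (star X) i j = star (X j i) :=
  CStarMatrix.star_apply

def cor : R →⋆ₙₐ[ℂ] MM N R where
  toFun := corF
  map_smul' k a := by apply mm_ext <;> simp
  map_zero' := by apply mm_ext <;> simp
  map_add' a b := by apply mm_ext <;> simp
  map_mul' a b := by apply mm_ext <;> simp [mm_mul]
  map_star' a := by apply mm_ext <;> simp [mm_star]

def dgH : (N → R) →⋆ₙₐ[ℂ] MM N R where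
  toFun := dg
  map_smul' k a := by apply mm_ext <;> simp
  map_zero' := by apply mm_ext <;> simp
  map_add' a b := by
    apply mm_ext <;> simp
    intro p q; split_ifs <;> simp
  map_mul' a b := by
    apply mm_ext <;> simp [mm_mul]
    intro p q; split_ifs with h
    · rw [h]
    · rfl
  map_star' a := by
    apply mm_ext <;> simp [mm_star]
    intro p q
    by_cases h : p = q
    · subst h; simp
    · simp [h, Ne.symm h]

def scal : Matrix N N ℂ →⋆ₙₐ[ℂ] MM N R where
  toFun := scF
  map_smul' k a := by apply mm_ext <;> simp [smul_smul]
  map_zero' := by apply mm_ext <;> simp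
  map_add' a b := by apply mm_ext <;> simp [add_smul]
  map_mul' a b := by
    apply mm_ext <;> simp [mm_mul, Matrix.mul_apply, Finset.sum_smul, smul_smul]
    intro p q; simp only [mul_comm]
  map_star' a := by apply mm_ext <;> simp [mm_star]

def row : (N → R) →ₗ[ℂ] MM N R where
  toFun := rowF
  map_smul' k a := by apply mm_ext <;> simp
  map_add' a b := by apply mm_ext <;> simp

section app
variable (a : R) (w c : N → R) (x : Matrix N N ℂ) (p q : N)
@[simp] lemma cor_nn : (cor a : MM N R) none none = a := rfl
@[simp] lemma cor_ns : (cor a : MM N R) none (some q) = 0 := rfl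
@[simp] lemma cor_sn : (cor a : MM N R) (some p) none = 0 := rfl
@[simp] lemma cor_ss : (cor a : MM N R) (some p) (some q) = 0 := rfl
@[simp] lemma row_nn : (row w : MM N R) none none = 0 := rfl
@[simp] lemma row_ns : (row w : MM N R) none (some q) = w q := rfl
@[simp] lemma row_sn : (row w : MM N R) (some p) none = 0 := rfl
@[simp] lemma row_ss : (row w : MM N R) (some p) (some q) = 0 := rfl
@[simp] lemma scal_nn : (scal x : MM N R) none none = 0 := rfl
@[simp] lemma scal_ns : (scal x : MM N R) none (some q) = 0 := rfl
@[simp] lemma scal_sn : (scal x : MM N R) (some p) none = 0 := rfl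
@[simp] lemma scal_ss : (scal x : MM N R) (some p) (some q) = x p q • (1 : R) := rfl
end app

lemma dg_mul (c d : N → R) : (dg (c * d) : MM N R) = dg c * dg d := map_mul (dgH : (N → R) →⋆ₙₐ[ℂ] MM N R) c d
lemma dg_sub (c d : N → R) : (dg (c - d) : MM N R) = dg c - dg d := map_sub (dgH : (N → R) →⋆ₙₐ[ℂ] MM N R) c d
lemma dg_add (c d : N → R) : (dg (c + d) : MM N R) = dg c + dg d := map_add (dgH : (N → R) →⋆ₙₐ[ℂ] MM N R) c d
lemma dg_star (c : N → R) : (dg (star c) : MM N R) = star (dg c) := map_star (dgH : (N → R) →⋆ₙₐ[ℂ] MM N R) c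
lemma dg_smul (k : ℂ) (c : N → R) : (dg (k • c) : MM N R) = k • dg c := map_smul (dgH : (N → R) →⋆ₙₐ[ℂ] MM N R) k c
lemma dg_zero : (dg (0 : N → R) : MM N R) = 0 := map_zero (dgH : (N → R) →⋆ₙₐ[ℂ] MM N R)

lemma norm_cor (a : R) : ‖(cor a : MM N R)‖ = ‖a‖ := by
  refine NonUnitalStarAlgHom.norm_map (cor : R →⋆ₙₐ[ℂ] MM N R) (fun a b h => ?_) a
  simpa using congrArg (fun X : MM N R => X none none) h

lemma norm_dg_le (c : N → R) : ‖(dg c : MM N R)‖ ≤ ‖c‖ :=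
  NonUnitalStarAlgHom.norm_apply_le (dgH : (N → R) →⋆ₙₐ[ℂ] MM N R) c

lemma norm_scal_le (x : Matrix N N ℂ) : ‖(scal x : MM N R)‖ ≤ ‖x‖ :=
  NonUnitalStarAlgHom.norm_apply_le (scal : Matrix N N ℂ →⋆ₙₐ[ℂ] MM N R) x

lemma row_mul_star_row (w w' : N → R) :
    (row w * star (row w') : MM N R) = cor (∑ p, w p * star (w' p)) := by
  apply mm_ext <;> simp [mm_mul, mm_star]

lemma norm_row_sq (w : N → R) : ‖(row w : MM N R)‖ ^ 2 = ‖∑ p, w p * star (w p)‖ := by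
  rw [pow_two, ← CStarRing.norm_self_mul_star, row_mul_star_row, norm_cor]

lemma norm_row_comp (w : N → R) {N' : Type*} [Fintype N'] [DecidableEq N'] (e : N' ≃ N) :
    ‖(row (w ∘ e) : MM N' R)‖ = ‖(row w : MM N R)‖ := by
  have h : ‖(row (w ∘ e) : MM N' R)‖ ^ 2 = ‖(row w : MM N R)‖ ^ 2 := by
    rw [norm_row_sq, norm_row_sq]
    congr 1
    exact Equiv.sum_comp e (fun p => w p * star (w p))
  exact (pow_left_inj₀ (norm_nonneg _) (norm_nonneg _) two_ne_zero).1 h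

lemma star_row_mul_row (w w' : N → R) (p q : N) :
    (star (row w) * row w' : MM N R) (some p) (some q) = star (w p) * w' q := by
  simp [mm_mul, mm_star]

lemma cor_mul_row (a : R) (w : N → R) : (cor a * row w : MM N R) = row (fun p => a * w p) := by
  apply mm_ext <;> simp [mm_mul]

lemma row_mul_scal (w : N → R) (x : Matrix N N ℂ) :
    (row w * scal x : MM N R) = row (fun q => ∑ p, x p q • w p) := by
  apply mm_ext <;> simp [mm_mul]

lemma row_mul_dg (w c : N → R) : (row w * dg c : MM N R) = row (fun q => w q * c q) := by
  apply mm_ext <;> simp [mm_mul]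

lemma scal_dg_comm (x : Matrix N N ℂ) (c : N → R) (h : ∀ p q, x p q ≠ 0 → c p = c q) :
    (scal x * dg c : MM N R) = dg c * scal x := by
  apply mm_ext <;> simp [mm_mul]
  intro p q
  by_cases hx : x p q = 0
  · simp [hx]
  · rw [h p q hx]

lemma star_row_mul_row_eq_dg (w w' : N → R) (c : N → R)
    (h : ∀ p q, star (w p) * w' q = if p = q then c p else 0) :
    (star (row w) * row w' : MM N R) = dg c := by
  apply mm_ext <;> simp [mm_mul, mm_star]
  exact h

lemma eq_row {X : MM N R} (h1 : cor 1 * X = X) (h2 : X * dg 1 = X) :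
    X = row (fun p => X none (some p)) := by
  have a1 : ∀ p i, X (some p) i = 0 := fun p i => by rw [← h1]; simp [mm_mul]
  have a2 : X none none = 0 := by rw [← h2]; simp [mm_mul]
  apply mm_ext <;> simp [a1, a2]

lemma dg_nonneg {c : N → R} (h : ∀ p, 0 ≤ c p) : 0 ≤ (dg c : MM N R) := by
  choose s hs using fun p => CStarAlgebra.nonneg_iff_eq_star_mul_self.1 (h p)
  have : c = star s * s := by ext p; exact hs p
  rw [this, dg_mul, dg_star]
  exact star_mul_self_nonneg _

lemma dg_mono {c d : N → R} (h : ∀ p, c p ≤ d p) : (dg c : MM N R) ≤ dg d := by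
  rw [← sub_nonneg, ← dg_sub]
  exact dg_nonneg fun p => sub_nonneg.2 (h p)

end mm
end DRank

namespace DRank
section stepA
lemma norm_one_le (M : Type*) [CStarAlgebra M] : ‖(1 : M)‖ ≤ 1 := by
  have := CStarRing.norm_star_mul_self (x := (1 : M))
  rw [star_one, one_mul] at this
  nlinarith [norm_nonneg (1 : M)]

lemma norm_algebraMap_le (M : Type*) [CStarAlgebra M] {δ : ℝ} (hδ : 0 ≤ δ) :
    ‖algebraMap ℝ M δ‖ ≤ δ := by
  rw [Algebra.algebraMap_eq_smul_one]
  refine (norm_smul_le _ _).trans ?_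
  rw [Real.norm_of_nonneg hδ]
  exact mul_le_of_le_one_right hδ (norm_one_le M)

def fA (δ t : ℝ) : ℝ := max (t - δ) 0 / max t δ

lemma fA_cont {δ : ℝ} (hδ : 0 < δ) : Continuous (fA δ) := by
  unfold fA
  exact Continuous.div (by fun_prop) (by fun_prop) fun t => (lt_max_of_lt_right hδ).ne'

lemma fA_of_le {δ t : ℝ} (h : t ≤ δ) : fA δ t = 0 := by
  unfold fA; rw [max_eq_right (by linarith)]; simp

lemma fA_of_ge {δ t : ℝ} (h : δ ≤ t) : fA δ t = (t - δ) / t := by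
  unfold fA; rw [max_eq_left (by linarith), max_eq_left h]

lemma fA_bd {δ : ℝ} (hδ : 0 < δ) (t : ℝ) : 0 ≤ fA δ t ∧ fA δ t ≤ 1 := by
  rcases le_total t δ with h | h
  · rw [fA_of_le h]; simp
  · have : 0 < t := hδ.trans_le h
    rw [fA_of_ge h]
    constructor
    · apply div_nonneg <;> linarith
    · rw [div_le_one this]; linarith

lemma fA_err {δ : ℝ} (hδ : 0 < δ) (t : ℝ) : (fA δ t - 1) * (t + δ) * (fA δ t - 1) ≤ 2 * δ := by
  rcases le_total t δ with h | h
  · rw [fA_of_le h]; linarith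
  · have ht : 0 < t := hδ.trans_le h
    rw [fA_of_ge h]
    have : (t - δ) / t - 1 = - (δ / t) := by field_simp; ring
    rw [this]
    have h1 : δ / t ≤ 1 := (div_le_one ht).2 h
    have h2 : 0 ≤ δ / t := by positivity
    have h3 : (δ / t) * t = δ := by field_simp
    have h4 : -(δ / t) * (t + δ) * -(δ / t) = ((δ / t) * t) * (δ / t) + δ * ((δ / t) * (δ / t)) := by
      ring
    rw [h4, h3]
    have h5 : (δ / t) * (δ / t) ≤ 1 := mul_le_one₀ h1 h2 h1
    nlinarith

variable {R : Type*} [CStarAlgebra R] [PartialOrder R] [StarOrderedRing R]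
variable {N : Type*} [Fintype N] [DecidableEq N]

def hA (δ : ℝ) (a : R) : R := cfc (fun t => fA δ t * (t - δ) * fA δ t) a

lemma hA_zero {δ : ℝ} (hδ : 0 < δ) : hA δ (0 : R) = 0 := by
  unfold hA
  rw [cfc_apply_zero, fA_of_le hδ.le]; simp

theorem stepA {δ : ℝ} (hδ : 0 < δ) (w c : N → R) (hc : ∀ q, IsSelfAdjoint (c q))
    (h : ‖(star (row w) * row w - dg c : MM N R)‖ ≤ δ) :
    ∃ w' : N → R, (∀ p : R, (∀ q, p * w q = w q) → ∀ q, p * w' q = w' q) ∧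
      (∀ q r, star (w' q) * w' r = if q = r then hA δ (c q) else 0) ∧
      ‖(row w' - row w : MM N R)‖ ≤ 2 * Real.sqrt (2 * δ) := by
  have hfc := fA_cont hδ
  obtain ⟨F, hF⟩ : ∃ F : N → R, F = fun q => cfc (fA δ) (c q) := ⟨_, rfl⟩
  have hFs : star F = F := by
    ext q; simp only [Pi.star_apply, hF]; exact star_cfc _ _
  have hdFs : star (dg F : MM N R) = dg F := by rw [← dg_star, hFs]
  have hFn : ‖(dg F : MM N R)‖ ≤ 1 := by
    refine (norm_dg_le F).trans ((pi_norm_le_iff_of_nonneg zero_le_one).2 fun q => ?_)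
    rw [hF]
    refine norm_cfc_le zero_le_one fun t _ => ?_
    rw [Real.norm_of_nonneg (fA_bd hδ t).1]; exact (fA_bd hδ t).2
  obtain ⟨T, hT⟩ : ∃ T : MM N R, T = star (row w) * row w := ⟨_, rfl⟩
  rw [← hT] at h
  have hcs : star c = c := by ext q; exact (hc q).star_eq
  have hTs : IsSelfAdjoint (T - dg c) := by
    rw [isSelfAdjoint_iff, star_sub, ← dg_star, hcs, hT, star_mul, star_star]
  have hmono : algebraMap ℝ (MM N R) ‖T - dg c‖ ≤ algebraMap ℝ (MM N R) δ :=
    algebraMap_mono _ h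
  have hup : T ≤ dg c + algebraMap ℝ (MM N R) δ := by
    rw [← sub_le_iff_le_add']
    exact hTs.le_algebraMap_norm_self.trans hmono
  have hlo : dg c - algebraMap ℝ (MM N R) δ ≤ T := by
    have := hTs.neg_algebraMap_norm_le_self
    rw [sub_le_iff_le_add, ← sub_le_iff_le_add']
    rw [neg_le] at this
    rw [← neg_sub]
    exact this.trans hmono
  obtain ⟨X, hX⟩ : ∃ X : MM N R, X = row w * dg F := ⟨_, rfl⟩
  have hXX : star X * X = dg F * T * dg F := by
    rw [hX, star_mul, hdFs, hT]; simp only [mul_assoc]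
  have hone : ∀ G : N → R, (dg G * algebraMap ℝ (MM N R) δ * dg G : MM N R)
      = dg (fun q => G q * (algebraMap ℝ R δ) * G q) := by
    intro G
    rw [Algebra.algebraMap_eq_smul_one]
    have : (fun q => G q * (algebraMap ℝ R δ) * G q) = ((δ : ℂ)) • (G * G) := by
      ext q; simp [Algebra.algebraMap_eq_smul_one]
    rw [this, dg_smul, dg_mul]; simp; rfl
  have hC : (dg (fun q => hA δ (c q)) : MM N R)
      = dg F * (dg c - algebraMap ℝ (MM N R) δ) * dg F := by
    rw [mul_sub, sub_mul, hone, ← dg_mul, ← dg_mul, ← dg_sub]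
    congr 1
    ext q
    simp only [Pi.sub_apply, Pi.mul_apply, hF, hA]
    have e := hc q
    rw [cfc_mul _ _ _ (by fun_prop) (by fun_prop), cfc_mul _ _ _ (by fun_prop) (by fun_prop),
      cfc_sub _ _ _ (by fun_prop) (by fun_prop), cfc_id' ℝ (c q), cfc_const δ (c q)]
    rw [mul_sub, sub_mul]
  have hC0 : 0 ≤ (dg (fun q => hA δ (c q)) : MM N R) := by
    refine dg_nonneg fun q => cfc_nonneg fun t _ => ?_
    rcases le_total t δ with h | h
    · rw [fA_of_le h]; simp
    · have := (fA_bd hδ t).1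
      have : 0 ≤ t - δ := by linarith
      positivity
  have hCX : (dg (fun q => hA δ (c q)) : MM N R) ≤ star X * X := by
    rw [hC, hXX]
    have := star_left_conjugate_le_conjugate hlo (dg F)
    rwa [hdFs] at this
  have hdist : ‖star X * X - dg (fun q => hA δ (c q))‖ ≤ 2 * δ := by
    rw [hXX, hC, ← sub_mul, ← mul_sub]
    have : ‖T - (dg c - algebraMap ℝ (MM N R) δ)‖ ≤ 2 * δ := by
      have : T - (dg c - algebraMap ℝ (MM N R) δ) = (T - dg c) + algebraMap ℝ (MM N R) δ := by abel
      rw [this]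
      refine (norm_add_le _ _).trans ?_
      have : ‖algebraMap ℝ (MM N R) δ‖ ≤ δ := norm_algebraMap_le (MM N R) hδ.le
      linarith
    calc _ ≤ ‖dg F‖ * ‖T - (dg c - algebraMap ℝ (MM N R) δ)‖ * ‖dg F‖ :=
          (norm_mul_le _ _).trans (mul_le_mul_of_nonneg_right (norm_mul_le _ _) (norm_nonneg _))
      _ ≤ 1 * (2 * δ) * 1 := by gcongr
      _ = _ := by ring
  obtain ⟨v, hv1, hv2, hv3⟩ := polar X _ hC0 hCX
  have hvd : v * dg 1 = v := by
    have : star (v - v * dg 1) * (v - v * dg 1) = 0 := by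
      have e1 : star (dg 1 : MM N R) = dg 1 := by rw [← dg_star]; simp
      have e2 : (dg (fun q => hA δ (c q)) * dg 1 : MM N R) = dg (fun q => hA δ (c q)) := by
        rw [← dg_mul]; simp
      have e3 : star (v - v * dg 1) * (v - v * dg 1)
        = star v * v - (star v * v) * dg 1 - dg 1 * (star v * v) + dg 1 * ((star v * v) * dg 1) := by
        rw [star_sub, star_mul, e1]; noncomm_ring
      rw [e3, hv1, e2]; abel
    have := CStarRing.star_mul_self_eq_zero_iff _ |>.1 this
    exact (sub_eq_zero.1 this).symm
  have hv1' : cor 1 * v = v := hv3 _ (by rw [hX, ← mul_assoc, cor_mul_row]; simp)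
  have hrow := eq_row hv1' hvd
  refine ⟨fun p => v none (some p), ?_, ?_, ?_⟩
  · intro p hp q
    have := hv3 (cor p) (by rw [hX, ← mul_assoc, cor_mul_row]; simp [hp])
    rw [hrow, cor_mul_row] at this
    simpa using congrArg (fun Y : MM N R => Y none (some q)) this
  · intro q r
    have : (star v * v) (some q) (some r) = if q = r then hA δ (c q) else 0 := by
      rw [hv1]; simp
    rw [hrow, star_row_mul_row] at this
    exact this
  · rw [← hrow]
    have n1 : ‖v - X‖ ≤ Real.sqrt (2 * δ) := hv2.trans (Real.sqrt_le_sqrt hdist)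
    have n2 : ‖X - row w‖ ≤ Real.sqrt (2 * δ) := by
      have e0 : (row w : MM N R) = row w * dg 1 := by rw [row_mul_dg]; simp
      have e : X - row w = row w * dg (F - 1) := by
        rw [dg_sub, mul_sub, ← e0, hX]
      have hGs : star (dg (F - 1) : MM N R) = dg (F - 1) := by rw [← dg_star, star_sub, hFs]; simp
      apply norm_le_of_sq (Real.sqrt_nonneg _)
      rw [Real.sq_sqrt (by positivity)]
      have e2 : star (X - row w) * (X - row w) = dg (F - 1) * T * dg (F - 1) := by
        rw [e, star_mul, hGs, hT]; simp only [mul_assoc]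
      have h0 := star_mul_self_nonneg (X - row w)
      have h1 : star (X - row w) * (X - row w) ≤ dg (fun q => algebraMap ℝ R (2 * δ)) := by
        rw [e2]
        have := star_left_conjugate_le_conjugate hup (dg (F - 1))
        rw [hGs] at this
        refine this.trans ?_
        rw [mul_add, add_mul, hone, ← dg_mul, ← dg_mul, ← dg_add]
        refine dg_mono fun q => ?_
        simp only [Pi.add_apply, Pi.mul_apply, Pi.sub_apply, Pi.one_apply, hF]
        have hq := hc q
        have e3 : (cfc (fA δ) (c q) - 1) * c q * (cfc (fA δ) (c q) - 1)
          + (cfc (fA δ) (c q) - 1) * (algebraMap ℝ R δ) * (cfc (fA δ) (c q) - 1)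
          = cfc (fun t => (fA δ t - 1) * (t + δ) * (fA δ t - 1)) (c q) := by
          rw [cfc_mul _ _ _ (by fun_prop) (by fun_prop), cfc_mul _ _ _ (by fun_prop) (by fun_prop),
            cfc_add (c q) (fun t : ℝ => t) (fun _ => δ) (by fun_prop) (by fun_prop),
            cfc_sub (fA δ) (fun _ => (1:ℝ)) _ (by fun_prop) (by fun_prop), cfc_id' ℝ (c q), cfc_const δ (c q),
            cfc_const_one ℝ (c q)]
          rw [mul_add, add_mul]
        rw [e3]
        exact cfc_le_algebraMap _ _ _ (fun t _ => fA_err hδ t) (by fun_prop)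
      refine (CStarAlgebra.norm_le_norm_of_nonneg_of_le h0 h1).trans ?_
      refine (norm_dg_le _).trans ((pi_norm_le_iff_of_nonneg (by positivity)).2 fun q => ?_)
      exact norm_algebraMap_le R (by positivity)
    calc ‖v - row w‖ ≤ ‖v - X‖ + ‖X - row w‖ := norm_sub_le_norm_sub_add_norm_sub ..
      _ ≤ _ := by linarith

end stepA
end DRank

namespace DRank
section good
variable {R : Type*} [CStarAlgebra R] [PartialOrder R] [StarOrderedRing R]

def Exr {n : ℕ} {N I : Type} [DecidableEq N] (b : N → I) (J : I → Fin (n+1)) (V : N → R)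
    (c : I → R) : Prop :=
  ∀ q r, J (b q) = J (b r) → star (V q) * V r = if q = r then c (b q) else 0

def msk {n : ℕ} {N I : Type} (b : N → I) (J : I → Fin (n+1)) (j : Fin (n+1)) (V : N → R) : N → R :=
  fun q => if J (b q) = j then V q else 0

def err {N : Type} [Fintype N] (a : R) (x : Matrix N N ℂ) (V : N → R) : N → R :=
  fun q => a * V q - ∑ r, x r q • V r

def Good (n : ℕ) (R : Type*) [CStarAlgebra R] [PartialOrder R] [StarOrderedRing R] (p : R) : Prop :=
  ∀ S : Finset R, (∀ a ∈ S, p * a * p = a) → ∀ ε : ℝ, 0 < ε → ∃ K : ℝ, ∀ δ : ℝ, 0 < δ →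
    ∃ (N I : Type) (_ : Fintype N) (_ : DecidableEq N) (_ : Fintype I) (_ : DecidableEq I)
      (b : N → I) (J : I → Fin (n+1)) (V : N → R) (c : I → R) (x : R → Matrix N N ℂ),
      (∀ q, p * V q = V q) ∧ (∀ i, IsSelfAdjoint (c i)) ∧
      (∀ a ∈ S, ‖x a‖ ≤ K ∧ ∀ q r, b q ≠ b r → x a q r = 0) ∧
      (∀ j, ‖(star (row (msk b J j V)) * row (msk b J j V) - dg (msk b J j (c ∘ b)) : MM N R)‖ ≤ δ) ∧
      ‖∑ q, V q * star (V q) - p‖ ≤ ε ∧ ∀ a ∈ S, ‖(row (err a (x a) V) : MM N R)‖ ≤ ε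

def GoodX (n : ℕ) (R : Type*) [CStarAlgebra R] [PartialOrder R] [StarOrderedRing R] (p : R) : Prop :=
  ∀ S : Finset R, (∀ a ∈ S, p * a * p = a) → ∀ ε : ℝ, 0 < ε → ∃ κ : ℝ, 0 < κ ∧ κ ≤ 1 ∧
    ∃ (N I : Type) (_ : Fintype N) (_ : DecidableEq N) (_ : Fintype I) (_ : DecidableEq I)
      (b : N → I) (J : I → Fin (n+1)) (V : N → R) (c : I → R) (x : R → Matrix N N ℂ),
      (∀ q, p * V q = V q) ∧
      (∀ a ∈ S, ∀ q r, b q ≠ b r → x a q r = 0) ∧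
      Exr b J V c ∧ (∀ i, c i = 0 ∨ κ ≤ ‖c i‖) ∧ ‖(row V : MM N R)‖ ≤ 1 ∧
      ‖∑ q, V q * star (V q) - p‖ ≤ ε ∧ ∀ a ∈ S, ‖(row (err a (x a) V) : MM N R)‖ ≤ ε * Real.sqrt κ

variable {n : ℕ} {N I : Type} [Fintype N] [DecidableEq N]
  (b : N → I) (J : I → Fin (n+1))

lemma sum_msk (V : N → R) : ∑ j, msk b J j V = V := by
  ext q; simp [msk, Finset.sum_apply]

lemma row_err (a : R) (x : Matrix N N ℂ) (V : N → R) :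
    (row (err a x V) : MM N R) = cor a * row V - row V * scal x := by
  rw [cor_mul_row, row_mul_scal, ← map_sub]; rfl

lemma exactA {δ : ℝ} (hδ : 0 < δ) (V : N → R) (c : I → R) (hc : ∀ i, IsSelfAdjoint (c i))
    (h : ∀ j, ‖(star (row (msk b J j V)) * row (msk b J j V) - dg (msk b J j (c ∘ b)) : MM N R)‖ ≤ δ) :
    ∃ V' : N → R, (∀ p : R, (∀ q, p * V q = V q) → ∀ q, p * V' q = V' q) ∧
      Exr b J V' (fun i => hA δ (c i)) ∧
      ‖(row V' - row V : MM N R)‖ ≤ (n + 1) * (2 * Real.sqrt (2 * δ)) := by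
  have hs : ∀ j q, IsSelfAdjoint (msk b J j (c ∘ b) q) := fun j q => by
    unfold msk; split_ifs
    · exact hc _
    · exact IsSelfAdjoint.zero _
  choose w h1 h2 h3 using fun j => stepA hδ (msk b J j V) (msk b J j (c ∘ b)) (hs j) (h j)
  have hw0 : ∀ j q, J (b q) ≠ j → w j q = 0 := fun j q hq => by
    have := h2 j q q
    rw [if_pos rfl, msk, if_neg hq, hA_zero hδ] at this
    exact (CStarRing.star_mul_self_eq_zero_iff _).1 this
  have hsum : (fun q => w (J (b q)) q) = ∑ j, w j := by
    ext q
    rw [Finset.sum_apply, Finset.sum_eq_single (J (b q)) (fun j _ hj => hw0 j q hj.symm) (by simp)]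
  refine ⟨fun q => w (J (b q)) q, ?_, ?_, ?_⟩
  · intro p hp q
    refine h1 _ p (fun r => ?_) q
    unfold msk; split_ifs
    · exact hp r
    · simp
  · intro q r hqr
    simp only []
    rw [← hqr, h2]
    simp [msk]
  · rw [hsum, ← map_sub]
    conv_lhs => rw [← sum_msk b J V]
    rw [← Finset.sum_sub_distrib, map_sum]
    refine (norm_sum_le _ _).trans ?_
    calc _ ≤ ∑ j : Fin (n+1), 2 * Real.sqrt (2 * δ) := Finset.sum_le_sum fun j _ => by
            rw [map_sub]; exact h3 j
      _ = _ := by simp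

lemma exr_small {κ : ℝ} (hκ : 0 ≤ κ) (V : N → R) (c : I → R) (h : Exr b J V c)
    (hc : ∀ i, ‖c i‖ ≤ κ) : ‖(row V : MM N R)‖ ≤ (n + 1) * Real.sqrt κ := by
  conv_lhs => rw [← sum_msk b J V]
  rw [map_sum]
  refine (norm_sum_le _ _).trans ?_
  calc _ ≤ ∑ j : Fin (n+1), Real.sqrt κ := Finset.sum_le_sum fun j _ => by
        apply norm_le_of_sq (Real.sqrt_nonneg _)
        rw [Real.sq_sqrt hκ, star_row_mul_row_eq_dg _ _ (msk b J j (c ∘ b))]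
        · refine (norm_dg_le _).trans ((pi_norm_le_iff_of_nonneg hκ).2 fun q => ?_)
          unfold msk; split_ifs
          · exact hc _
          · simpa using hκ
        · intro q r
          unfold msk
          split_ifs with h1 h2 h3 h3 h4 <;> simp_all [Exr]
    _ = _ := by simp

lemma exr_mask (V : N → R) (c : I → R) (h : Exr b J V c) (s : I → Prop) [DecidablePred s] :
    Exr b J (fun q => if s (b q) then V q else 0) (fun i => if s i then c i else 0) := by
  intro q r hqr
  have := h q r hqr
  by_cases e : q = r
  · subst e
    simp only [if_true] at this
    simp only [if_true]
    split_ifs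
    · exact this
    · simp
  · simp only [if_neg e] at this
    simp only []
    rw [if_neg e]
    split_ifs <;> simp [this]

lemma row_mask (V : N → R) (s : N → Prop) [DecidablePred s] :
    (row (fun q => if s q then V q else 0) : MM N R) = row V * dg (fun q => if s q then 1 else 0) := by
  rw [row_mul_dg]; simp

lemma norm_dg_mask (s : N → Prop) [DecidablePred s] :
    ‖(dg (fun q => if s q then (1:R) else 0) : MM N R)‖ ≤ 1 := by
  refine (norm_dg_le _).trans ((pi_norm_le_iff_of_nonneg zero_le_one).2 fun q => ?_)
  split_ifs
  · exact norm_one_le R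
  · simp

lemma err_mask (a : R) (x : Matrix N N ℂ) (hx : ∀ q r, b q ≠ b r → x q r = 0)
    (V : N → R) (s : I → Prop) [DecidablePred s] :
    (row (err a x (fun q => if s (b q) then V q else 0)) : MM N R)
      = row (err a x V) * dg (fun q => if s (b q) then 1 else 0) := by
  rw [row_err, row_err, row_mask, sub_mul, mul_assoc, mul_assoc, mul_assoc, scal_dg_comm]
  intro q r hqr
  have : b q = b r := by
    by_contra h; exact hqr (hx q r h)
  rw [this]

lemma norm_row_mask (V : N → R) (s : N → Prop) [DecidablePred s] :
    ‖(row (fun q => if s q then V q else 0) : MM N R)‖ ≤ ‖(row V : MM N R)‖ := by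
  rw [row_mask]
  refine (norm_mul_le _ _).trans (mul_le_of_le_one_right (norm_nonneg _) (norm_dg_mask s))

lemma norm_err_mask (a : R) (x : Matrix N N ℂ) (hx : ∀ q r, b q ≠ b r → x q r = 0)
    (V : N → R) (s : I → Prop) [DecidablePred s] :
    ‖(row (err a x (fun q => if s (b q) then V q else 0)) : MM N R)‖ ≤ ‖(row (err a x V) : MM N R)‖ := by
  rw [err_mask b a x hx]
  refine (norm_mul_le _ _).trans (mul_le_of_le_one_right (norm_nonneg _) (norm_dg_mask fun q => s (b q)))

end good
end DRank

namespace DRank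
section goodx
variable {R : Type*} [CStarAlgebra R] [PartialOrder R] [StarOrderedRing R]

lemma norm_proj_le {p : R} (hp : p * p = p) (hs : star p = p) : ‖p‖ ≤ 1 := by
  have := CStarRing.norm_star_mul_self (x := p)
  rw [hs, hp] at this
  nlinarith [norm_nonneg p]

lemma norm_cor_sum {N : Type} [Fintype N] [DecidableEq N] (V : N → R) (p : R) :
    ‖∑ q, V q * star (V q) - p‖ = ‖(row V * star (row V) - cor p : MM N R)‖ := by
  rw [row_mul_star_row, ← map_sub, norm_cor]

lemma norm_xx_sub {M : Type*} [CStarAlgebra M] (X Y : M) :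
    ‖X * star X - Y * star Y‖ ≤ ‖X - Y‖ * (‖X‖ + ‖Y‖) := by
  have : X * star X - Y * star Y = (X - Y) * star X + Y * star (X - Y) := by
    rw [star_sub]; noncomm_ring
  rw [this]
  refine (norm_add_le _ _).trans ?_
  have h1 := norm_mul_le (X - Y) (star X)
  have h2 := norm_mul_le Y (star (X - Y))
  rw [norm_star] at h1 h2
  nlinarith

set_option maxHeartbeats 1000000 in
theorem goodX_of_good {n : ℕ} {p : R} (hp : p * p = p) (hsp : star p = p) (h : Good n R p) :
    GoodX n R p := by
  intro S hS ε hε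
  classical
  obtain ⟨e, he0, he1, heε⟩ : ∃ e : ℝ, 0 < e ∧ e ≤ 1 ∧ e ≤ ε :=
    ⟨min ε 1, by positivity, min_le_right _ _, min_le_left _ _⟩
  set m : ℝ := (n : ℝ) + 1 with hm
  have hm1 : 1 ≤ m := by rw [hm]; linarith [Nat.cast_nonneg (α := ℝ) n]
  have hm0 : 0 < m := by linarith
  set κ : ℝ := e / (8 * m ^ 2) with hκ
  have hκ0 : 0 < κ := by positivity
  set σ : ℝ := e * Real.sqrt (κ / 2) / 2 with hσ
  have hσ0 : 0 < σ := by positivity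
  obtain ⟨ε0, h01, h02, h03⟩ : ∃ ε0 : ℝ, 0 < ε0 ∧ ε0 ≤ e / 8 ∧ ε0 ≤ σ :=
    ⟨min (e/8) σ, by positivity, min_le_left _ _, min_le_right _ _⟩
  obtain ⟨K, hK⟩ := h S hS ε0 h01
  set B : ℝ := (∑ a ∈ S, ‖a‖) + |K| + 1 with hB
  have hsum0 : 0 ≤ ∑ a ∈ S, ‖a‖ := Finset.sum_nonneg fun _ _ => norm_nonneg _
  have hB0 : 0 < B := by rw [hB]; positivity
  obtain ⟨η, g1, g2, g3⟩ : ∃ η : ℝ, 0 < η ∧ η ≤ e / 40 ∧ η * B ≤ σ := by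
    refine ⟨min (e/40) (σ / B), by positivity, min_le_left _ _, ?_⟩
    rw [← le_div_iff₀ hB0]; exact min_le_right _ _
  set δ : ℝ := η ^ 2 / (8 * m ^ 2) with hδ
  have hδ0 : 0 < δ := by positivity
  have hδη : m * (2 * Real.sqrt (2 * δ)) = η := by
    have : 2 * δ = (η / (2 * m)) ^ 2 := by rw [hδ]; field_simp; ring
    rw [this, Real.sqrt_sq (by positivity)]
    field_simp
  obtain ⟨N, I, _, _, _, _, b, J, V, c, x, hpV, hc, hx, hVc, hVV, herr⟩ := hK δ hδ0
  obtain ⟨V1, hV1p, hV1x, hV1n⟩ := exactA b J hδ0 V c hc hVc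
  rw [← hm, hδη] at hV1n
  have hp1 := norm_proj_le hp hsp
  have hVn : ‖(row V : MM N R)‖ ≤ 2 := by
    have h1 := norm_row_sq V
    have h2 : ‖∑ q, V q * star (V q)‖ ≤ 2 := by
      calc _ = ‖(∑ q, V q * star (V q) - p) + p‖ := by simp
        _ ≤ ε0 + 1 := (norm_add_le _ _).trans (add_le_add hVV hp1)
        _ ≤ 2 := by linarith
    nlinarith [norm_nonneg (row V : MM N R)]
  have hV1n' : ‖(row V1 : MM N R)‖ ≤ 3 := by
    calc _ = ‖(row V1 - row V : MM N R) + row V‖ := by simp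
      _ ≤ η + 2 := (norm_add_le _ _).trans (add_le_add hV1n hVn)
      _ ≤ 3 := by linarith
  have hVV1 : ‖(row V1 * star (row V1) - cor p : MM N R)‖ ≤ e / 4 := by
    rw [norm_cor_sum] at hVV
    have h1 := norm_xx_sub (row V1 : MM N R) (row V)
    calc _ = ‖(row V1 * star (row V1) - row V * star (row V) : MM N R)
              + (row V * star (row V) - cor p)‖ := by congr 1; abel
      _ ≤ η * (3 + 2) + ε0 := (norm_add_le _ _).trans (add_le_add
          (h1.trans (mul_le_mul hV1n (add_le_add hV1n' hVn) (by positivity) g1.le)) hVV)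
      _ ≤ e / 4 := by linarith
  have herr1 : ∀ a ∈ S, ‖(row (err a (x a) V1) : MM N R)‖ ≤ 2 * σ := by
    intro a ha
    have hdec : (row (err a (x a) V1) : MM N R) = row (err a (x a) V)
        + (cor a * (row V1 - row V) - (row V1 - row V) * scal (x a)) := by
      rw [row_err, row_err]; noncomm_ring
    have hna : ‖a‖ ≤ ∑ a ∈ S, ‖a‖ := Finset.single_le_sum (f := fun a : R => ‖a‖) (fun _ _ => norm_nonneg _) ha
    have hs : ‖(scal (x a) : MM N R)‖ ≤ |K| :=
      ((norm_scal_le _).trans (hx a ha).1).trans (le_abs_self K)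
    rw [hdec]
    refine (norm_add_le _ _).trans ?_
    have h1 : ‖(cor a * (row V1 - row V) : MM N R)‖ ≤ (∑ a ∈ S, ‖a‖) * η :=
      (norm_mul_le _ _).trans (mul_le_mul (by rw [norm_cor]; exact hna) hV1n (norm_nonneg _) hsum0)
    have h2 : ‖((row V1 - row V) * scal (x a) : MM N R)‖ ≤ η * |K| :=
      (norm_mul_le _ _).trans (mul_le_mul hV1n hs (norm_nonneg _) g1.le)
    have h3 := norm_sub_le (cor a * (row V1 - row V) : MM N R) ((row V1 - row V) * scal (x a))
    have h4 := herr a ha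
    have h5 : η * B = (∑ a ∈ S, ‖a‖) * η + η * |K| + η := by rw [hB]; ring
    linarith
  -- mask
  set c1 : I → R := fun i => hA δ (c i) with hc1
  let s : I → Prop := fun i => κ < ‖c1 i‖
  set V2 : N → R := fun q => if s (b q) then V1 q else 0 with hV2
  set W : N → R := fun q => if ¬ s (b q) then V1 q else 0 with hW
  have hX2 := exr_mask b J V1 c1 hV1x s
  have hWn : ‖(row W : MM N R)‖ ≤ m * Real.sqrt κ := by
    refine exr_small b J hκ0.le W _ (exr_mask b J V1 c1 hV1x (fun i => ¬ s i)) fun i => ?_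
    by_cases hi : s i
    · simp [hi, hκ0.le]
    · simp only [hi, not_false_eq_true, if_true]; exact not_lt.1 hi
  have hsplit : ∑ q, V2 q * star (V2 q) = ∑ q, V1 q * star (V1 q) - ∑ q, W q * star (W q) := by
    rw [← Finset.sum_sub_distrib]
    refine Finset.sum_congr rfl fun q _ => ?_
    simp only [hV2, hW]
    by_cases hq : s (b q) <;> simp [hq]
  set θ : ℝ := 3 * e / 8 with hθ
  have hV2p : ‖∑ q, V2 q * star (V2 q) - p‖ ≤ θ := by
    rw [hsplit, sub_right_comm]
    refine (norm_sub_le _ _).trans ?_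
    rw [norm_cor_sum, ← norm_row_sq]
    have h1 : ‖(row W : MM N R)‖ ^ 2 ≤ (m * Real.sqrt κ) ^ 2 :=
      pow_le_pow_left₀ (norm_nonneg _) hWn 2
    rw [mul_pow, Real.sq_sqrt hκ0.le] at h1
    have h2 : m ^ 2 * κ = e / 8 := by rw [hκ]; field_simp
    linarith
  set t : ℝ := 1 / (1 + θ) with ht
  have hθ0 : 0 < θ := by positivity
  have ht0 : 0 < t := by positivity
  have ht1 : t ≤ 1 := by rw [ht, div_le_one (by linarith)]; linarith
  have htθ : t * (1 + θ) = 1 := by rw [ht]; field_simp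
  set τ : ℝ := Real.sqrt t with hτ
  have hτ0 : 0 ≤ τ := Real.sqrt_nonneg _
  have hτ2 : τ * τ = t := Real.mul_self_sqrt ht0.le
  have hτ1 : τ ≤ 1 := Real.sqrt_le_one.2 ht1
  set V3 : N → R := (τ : ℂ) • V2 with hV3
  have hV3e : ∀ q r, star (V3 q) * V3 r = (t : ℂ) • (star (V2 q) * V2 r) := by
    intro q r
    simp only [hV3, Pi.smul_apply, star_smul, smul_mul_smul_comm]
    congr 1
    rw [Complex.star_def, Complex.conj_ofReal, ← hτ2]; push_cast; rfl
  have hV3s : ∑ q, V3 q * star (V3 q) = (t : ℂ) • ∑ q, V2 q * star (V2 q) := by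
    rw [Finset.smul_sum]
    refine Finset.sum_congr rfl fun q _ => ?_
    simp only [hV3, Pi.smul_apply, star_smul, smul_mul_smul_comm]
    congr 1
    rw [Complex.star_def, Complex.conj_ofReal, ← hτ2]; push_cast; rfl
  have htn : ‖(t : ℂ)‖ = t := by rw [Complex.norm_real, Real.norm_of_nonneg ht0.le]
  have hV2n : ‖∑ q, V2 q * star (V2 q)‖ ≤ 1 + θ := by
    calc _ = ‖(∑ q, V2 q * star (V2 q) - p) + p‖ := by simp
      _ ≤ θ + 1 := (norm_add_le _ _).trans (add_le_add hV2p hp1)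
      _ = 1 + θ := add_comm _ _
  refine ⟨κ / 2, by positivity, ?_, N, I, inferInstance, inferInstance, inferInstance, inferInstance,
    b, J, V3, fun i => (t : ℂ) • (if s i then c1 i else 0), x, ?_, fun a ha => (hx a ha).2, ?_, ?_,
    ?_, ?_, ?_⟩
  · have h1 : κ ≤ 1 := by
      rw [hκ, div_le_one (by positivity)]; nlinarith
    linarith
  · intro q
    simp only [hV3, Pi.smul_apply, mul_smul_comm, hV2]
    split_ifs
    · rw [hV1p p hpV q]
    · simp
  · intro q r hqr
    rw [hV3e, hX2 q r hqr]
    split_ifs <;> simp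
  · intro i
    by_cases hi : s i
    · right
      simp only [hi, if_true, norm_smul, htn]
      have h1 : κ < ‖c1 i‖ := hi
      have h2 : 1 / 2 ≤ t := by rw [ht]; apply one_div_le_one_div_of_le <;> linarith
      calc κ / 2 = 1 / 2 * κ := by ring
        _ ≤ t * ‖c1 i‖ := mul_le_mul h2 h1.le hκ0.le ht0.le
    · left; simp [hi]
  · have h1 := norm_row_sq V3
    rw [hV3s, norm_smul, htn] at h1
    have : ‖(row V3 : MM N R)‖ ^ 2 ≤ 1 := by rw [h1, ← htθ]; exact mul_le_mul_of_nonneg_left hV2n ht0.le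
    exact (sq_le_one_iff₀ (norm_nonneg _)).1 this
  · rw [hV3s]
    have h1 : (t : ℂ) • ∑ q, V2 q * star (V2 q) - p
        = (t : ℂ) • (∑ q, V2 q * star (V2 q) - p) - ((1 - t : ℝ) : ℂ) • p := by
      push_cast; rw [smul_sub, sub_smul, one_smul]; abel
    rw [h1]
    refine (norm_sub_le _ _).trans ?_
    rw [norm_smul, norm_smul, htn, Complex.norm_real, Real.norm_of_nonneg (by linarith)]
    have k1 : t * ‖∑ q, V2 q * star (V2 q) - p‖ ≤ θ :=
      (mul_le_of_le_one_left (norm_nonneg _) ht1).trans hV2p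
    have k2 : (1 - t) * ‖p‖ ≤ 1 - t := mul_le_of_le_one_right (by linarith) hp1
    have k3 : 1 - t ≤ θ := by
      have : 1 - t = t * θ := by linarith
      rw [this]; exact mul_le_of_le_one_left hθ0.le ht1
    linarith
  · intro a ha
    have h1 : err a (x a) V3 = (τ : ℂ) • err a (x a) V2 := by
      ext q
      simp only [err, hV3, Pi.smul_apply, mul_smul_comm, smul_sub, Finset.smul_sum]
      congr 1
      exact Finset.sum_congr rfl fun r _ => smul_comm _ _ _
    rw [h1, map_smul, norm_smul, Complex.norm_real, Real.norm_of_nonneg hτ0]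
    have h2 := norm_err_mask b a (x a) (hx a ha).2 V1 s
    have h3 := herr1 a ha
    have h4 : 2 * σ = e * Real.sqrt (κ / 2) := by rw [hσ]; ring
    have h5 : e * Real.sqrt (κ / 2) ≤ ε * Real.sqrt (κ / 2) :=
      mul_le_mul_of_nonneg_right heε (Real.sqrt_nonneg _)
    have h6 : τ * ‖(row (err a (x a) V2) : MM N R)‖ ≤ ‖(row (err a (x a) V2) : MM N R)‖ :=
      mul_le_of_le_one_left (norm_nonneg _) hτ1
    exact h6.trans (h2.trans (h3.trans (h4.le.trans h5)))
end goodx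
end DRank

namespace DRank
section states
variable {R : Type*} [CStarAlgebra R] [PartialOrder R] [StarOrderedRing R]

lemma norm_one_add_nonneg [Nontrivial R] {c : R} (hc : 0 ≤ c) : ‖1 + c‖ = 1 + ‖c‖ := by
  apply le_antisymm
  · simpa using norm_add_le (1 : R) c
  · have h1 : 1 + c ≤ algebraMap ℝ R ‖1 + c‖ :=
      IsSelfAdjoint.le_algebraMap_norm_self (ha := (IsSelfAdjoint.one R).add hc.isSelfAdjoint)
    have h2 : c ≤ algebraMap ℝ R (‖1 + c‖ - 1) := by
      rw [map_sub, map_one]; exact le_sub_iff_add_le'.2 h1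
    have h3 : (0:ℝ) ≤ ‖1 + c‖ - 1 := by
      have h4 : (1:R) ≤ 1 + c := le_add_of_nonneg_right hc
      have := CStarAlgebra.norm_le_norm_of_nonneg_of_le zero_le_one h4
      rw [CStarRing.norm_one] at this; linarith
    have := (CStarAlgebra.norm_le_iff_le_algebraMap c h3 hc).2 h2
    linarith

lemma complex_eq_of_re {z : ℂ} {t : ℝ} (h1 : ‖z‖ ≤ t) (h2 : t ≤ z.re) : z = t := by
  have h3 : z.re ≤ ‖z‖ := Complex.re_le_norm z
  have h4 : z.re = t := by linarith
  have h5 : z.re * z.re + z.im * z.im = ‖z‖ ^ 2 := by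
    rw [← Complex.normSq_apply, Complex.normSq_eq_norm_sq]
  have h6 : ‖z‖ = t := by linarith
  have h7 : z.im * z.im = 0 := by rw [h6, h4] at h5; linarith
  apply Complex.ext
  · simpa using h4
  · simpa using h7

lemma pos_of_unital [Nontrivial R] (f : R →L[ℂ] ℂ) (hf : ‖f‖ ≤ 1) (h1 : f 1 = 1) (a : R)
    (ha : 0 ≤ a) : 0 ≤ f a := by
  have him : (f a).im = 0 := by
    by_contra hne
    set y := (f a).im with hy
    -- test with a + i t, for t real
    have key : ∀ t : ℝ, (y + t) ^ 2 ≤ ‖a‖ ^ 2 + t ^ 2 := by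
      intro t
      have hn : ‖a + (t * Complex.I : ℂ) • (1 : R)‖ ^ 2 ≤ ‖a‖ ^ 2 + t ^ 2 := by
        rw [pow_two, ← CStarRing.norm_star_mul_self]
        have : star (a + (t * Complex.I : ℂ) • (1 : R)) * (a + (t * Complex.I : ℂ) • (1 : R))
            = a * a + ((t ^ 2 : ℝ) : ℂ) • (1 : R) := by
          rw [star_add, star_smul, star_one, ha.isSelfAdjoint.star_eq]
          simp only [add_mul, mul_add, smul_mul_assoc, mul_smul_comm, one_mul, mul_one, smul_smul]
          have e1 : star ((t : ℂ) * Complex.I) = - ((t : ℂ) * Complex.I) := by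
            simp
          rw [e1]
          have e2 : (-(↑t * Complex.I)) * (↑t * Complex.I) = ((t ^ 2 : ℝ) : ℂ) := by
            push_cast; ring_nf; simp
          have e3 : (↑t * Complex.I) * (-(↑t * Complex.I)) = ((t ^ 2 : ℝ) : ℂ) := by
            push_cast; ring_nf; simp
          simp only [e2, e3, neg_smul, smul_add, smul_neg, smul_smul, mul_neg, neg_mul]
          have e4 : -((t:ℂ) * Complex.I * (↑t * Complex.I)) = ((t ^ 2 : ℝ) : ℂ) := by rw [← e2]; ring
          rw [← neg_smul ((t:ℂ) * Complex.I * (↑t * Complex.I)), e4]; abel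
        rw [this]
        refine (norm_add_le _ _).trans (add_le_add ?_ ?_)
        · rw [pow_two]; exact norm_mul_le _ _
        · rw [norm_smul, Complex.norm_real, CStarRing.norm_one, mul_one, Real.norm_of_nonneg (sq_nonneg t)]
      have h2 : ‖f (a + (t * Complex.I : ℂ) • (1 : R))‖ ≤ ‖a + (t * Complex.I : ℂ) • (1 : R)‖ := by
        refine (f.le_opNorm _).trans (mul_le_of_le_one_left (norm_nonneg _) hf)
      have h3 : (f (a + (t * Complex.I : ℂ) • (1 : R))).im = y + t := by
        rw [map_add, map_smul, h1]; simp [hy]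
      have h4 := Complex.abs_im_le_norm (f (a + (t * Complex.I : ℂ) • (1 : R)))
      rw [h3] at h4
      calc (y + t) ^ 2 = |y + t| ^ 2 := (sq_abs _).symm
        _ ≤ ‖a + (t * Complex.I : ℂ) • (1 : R)‖ ^ 2 :=
          pow_le_pow_left₀ (abs_nonneg _) (h4.trans h2) 2
        _ ≤ _ := hn
    have := key ((‖a‖ ^ 2 + 1) / (2 * y))
    have e : 2 * y * ((‖a‖ ^ 2 + 1) / (2 * y)) = ‖a‖ ^ 2 + 1 := by field_simp
    nlinarith [sq_nonneg y]
  have hre : 0 ≤ (f a).re := by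
    have hle : a ≤ algebraMap ℝ R ‖a‖ := IsSelfAdjoint.le_algebraMap_norm_self (ha := ha.isSelfAdjoint)
    have hn : ‖algebraMap ℝ R ‖a‖ - a‖ ≤ ‖a‖ := by
      rw [CStarAlgebra.norm_le_iff_le_algebraMap _ (norm_nonneg _) (sub_nonneg.2 hle)]
      exact sub_le_self _ ha
    have h2 : f (algebraMap ℝ R ‖a‖ - a) = (‖a‖ : ℂ) - f a := by
      rw [map_sub, Algebra.algebraMap_eq_smul_one, ← Complex.coe_smul, map_smul, h1]; simp
    have h3 : ‖(‖a‖ : ℂ) - f a‖ ≤ ‖a‖ := by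
      rw [← h2]; exact (f.le_opNorm _).trans ((mul_le_of_le_one_left (norm_nonneg _) hf).trans hn)
    have h4 := (Complex.re_le_norm _).trans h3
    simp at h4; exact h4
  rw [Complex.nonneg_iff]; exact ⟨hre, him.symm⟩

lemma exists_state (c : R) (hc : 0 ≤ c) :
    ∃ f : R →L[ℂ] ℂ, ‖f‖ ≤ 1 ∧ (∀ a, 0 ≤ a → 0 ≤ f a) ∧ f c = ‖c‖ := by
  rcases subsingleton_or_nontrivial R with h | h
  · exact ⟨0, by simp, by simp, by simp [Subsingleton.elim c 0]⟩
  · have hne : (1 + c) ≠ 0 := by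
      rw [← norm_ne_zero_iff, norm_one_add_nonneg hc]
      positivity
    obtain ⟨f, hf, hfc⟩ := exists_dual_vector ℂ (1 + c) (norm_ne_zero_iff.2 hne)
    have hfn : ∀ x, ‖f x‖ ≤ ‖x‖ := fun x =>
      (f.le_opNorm _).trans (mul_le_of_le_one_left (norm_nonneg _) hf.le)
    rw [norm_one_add_nonneg hc, map_add] at hfc
    have hre := congrArg Complex.re hfc
    simp at hre
    have r1 := (Complex.re_le_norm (f 1)).trans (hfn 1)
    have r2 := (Complex.re_le_norm (f c)).trans (hfn c)
    have n1 : ‖(1:R)‖ = 1 := CStarRing.norm_one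
    have e1 : f 1 = (1:ℝ) := complex_eq_of_re ((hfn 1).trans n1.le) (by linarith)
    have e2 : f c = (‖c‖ : ℝ) := complex_eq_of_re (hfn c) (by linarith)
    exact ⟨f, hf.le, pos_of_unital f hf.le (by simpa using e1), e2⟩

variable {N : Type*} [Fintype N] [DecidableEq N]

lemma norm_comb_le (V : N → R) (ξ : N → ℂ) :
    ‖∑ l, ξ l • V l‖ ≤ ‖(row V : MM N R)‖ * Real.sqrt (∑ l, ‖ξ l‖ ^ 2) := by
  set W : N → R := fun l => star (ξ l) • (1 : R) with hW
  have h1 : (row V * star (row W) : MM N R) = cor (∑ l, ξ l • V l) := by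
    rw [row_mul_star_row]; simp [hW]
  have h2 : ‖(row W : MM N R)‖ ≤ Real.sqrt (∑ l, ‖ξ l‖ ^ 2) := by
    apply Real.le_sqrt_of_sq_le
    rw [norm_row_sq]
    refine (norm_sum_le _ _).trans (Finset.sum_le_sum fun l _ => ?_)
    simp only [hW, star_smul, star_star, star_one, smul_mul_smul_comm, mul_one]
    refine (norm_smul_le _ _).trans ?_
    rw [norm_mul, norm_star, pow_two]
    exact mul_le_of_le_one_right (by positivity) (norm_one_le R)
  rw [← norm_cor (N := N), ← h1]
  refine (norm_mul_le _ _).trans ?_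
  rw [norm_star]
  exact mul_le_mul_of_nonneg_left h2 (norm_nonneg _)

lemma norm_gram_le (f : R →L[ℂ] ℂ) (hf : ‖f‖ ≤ 1) (Y Z : N → R) :
    ‖(Matrix.of fun k l => f (star (Y k) * Z l) : Matrix N N ℂ)‖
      ≤ ‖(row Y : MM N R)‖ * ‖(row Z : MM N R)‖ := by
  set M : Matrix N N ℂ := Matrix.of fun k l => f (star (Y k) * Z l) with hM
  rw [Matrix.l2_opNorm_def]
  refine ContinuousLinearMap.opNorm_le_bound _ (by positivity) fun η => ?_
  set ζ := (LinearMap.toContinuousLinearMap (Matrix.toEuclideanLin M)) η with hζ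
  have hζa : ∀ k, ζ k = ∑ l, M k l * η l := fun k => rfl
  have hsq : ‖ζ‖ ^ 2 = ∑ k, ‖ζ k‖ ^ 2 := EuclideanSpace.norm_sq_eq ζ
  have hin : ((∑ k, ‖ζ k‖ ^ 2 : ℝ) : ℂ) = f (star (∑ k, ζ k • Y k) * ∑ l, η l • Z l) := by
    rw [star_sum, Finset.sum_mul_sum, map_sum]
    push_cast
    refine Finset.sum_congr rfl fun k _ => ?_
    rw [map_sum, ← Complex.conj_mul']
    conv_lhs => rw [hζa k, map_sum, Finset.sum_mul_sum]
    rw [← Finset.sum_mul_sum, ← map_sum, ← hζa k, hζa k, Finset.mul_sum]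
    refine Finset.sum_congr rfl fun l _ => ?_
    rw [star_smul, smul_mul_smul_comm, map_smul, ← hζa k, hM, Matrix.of_apply, smul_eq_mul]
    rw [Complex.star_def]; ring
  have hη : Real.sqrt (∑ l, ‖η l‖ ^ 2) = ‖η‖ := (EuclideanSpace.norm_eq η).symm
  have hζn : Real.sqrt (∑ l, ‖ζ l‖ ^ 2) = ‖ζ‖ := (EuclideanSpace.norm_eq ζ).symm
  have h1 := norm_comb_le Y ζ
  have h2 := norm_comb_le Z η
  rw [hη] at h2; rw [hζn] at h1
  have h3 : ‖ζ‖ ^ 2 ≤ (‖(row Y : MM N R)‖ * ‖ζ‖) * (‖(row Z : MM N R)‖ * ‖η‖) := by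
    have e : ‖ζ‖ ^ 2 = ‖((∑ k, ‖ζ k‖ ^ 2 : ℝ) : ℂ)‖ := by
      rw [Complex.norm_real, ← hsq, Real.norm_of_nonneg (by positivity)]
    rw [e, hin]
    refine (f.le_opNorm _).trans ((mul_le_of_le_one_left (norm_nonneg _) hf).trans ?_)
    refine (norm_mul_le _ _).trans ?_
    rw [norm_star]
    exact mul_le_mul h1 h2 (norm_nonneg _) (by positivity)
  change ‖ζ‖ ≤ _
  rcases eq_or_lt_of_le (norm_nonneg ζ) with h0 | h0
  · rw [← h0]; positivity
  · have : ‖ζ‖ * ‖ζ‖ ≤ ‖ζ‖ * (‖(row Y : MM N R)‖ * ‖(row Z : MM N R)‖ * ‖η‖) := by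
      nlinarith
    exact le_of_mul_le_mul_left this h0

open scoped MatrixOrder in
lemma gram_factor {L : Type*} [Fintype L] (f : R →L[ℂ] ℂ) (hf : ∀ a, 0 ≤ a → 0 ≤ f a)
    (T : L → N → R) (t : ℝ) (ht : 0 ≤ t) :
    ∃ B : Matrix N N ℂ, ∀ q r, (t : ℂ) * f (∑ l, star (T l q) * T l r) = ∑ m, star (B m q) * B m r := by
  set M : Matrix N N ℂ := Matrix.of fun q r => (t : ℂ) * f (∑ l, star (T l q) * T l r) with hM
  have hq : ∀ ξ : N → ℂ, 0 ≤ dotProduct (star ξ) (M.mulVec ξ) := by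
    intro ξ
    have e : dotProduct (star ξ) (M.mulVec ξ)
        = (t : ℂ) * f (∑ l, star (∑ q, ξ q • T l q) * (∑ q, ξ q • T l q)) := by
      simp only [dotProduct, Matrix.mulVec, hM, Matrix.of_apply, Pi.star_apply, star_sum,
        Finset.sum_mul_sum, map_sum, star_smul, smul_mul_smul_comm, map_smul, Finset.mul_sum,
        smul_eq_mul, Finset.sum_mul]
      conv_rhs => rw [Finset.sum_comm]; enter [2, q]; rw [Finset.sum_comm]
      rw [Finset.sum_comm]
      conv_rhs => rw [Finset.sum_comm]
      rw [Finset.sum_comm]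
      refine Finset.sum_congr rfl fun q _ => ?_
      refine Finset.sum_congr rfl fun r _ => ?_
      refine Finset.sum_congr rfl fun l _ => ?_
      ring
    rw [e]
    refine mul_nonneg (by exact_mod_cast ht) (hf _ (Finset.sum_nonneg fun l _ => star_mul_self_nonneg _))
  have hps : M.PosSemidef := by
    rw [Matrix.posSemidef_iff_dotProduct_mulVec]
    refine ⟨?_, hq⟩
    ext q r
    have hs : ∀ a, f (star a) = star (f a) := fun a =>
      map_star (PositiveLinearMap.mk₀ (f : R →ₗ[ℂ] ℂ) hf) a
    simp only [hM, Matrix.conjTranspose_apply, Matrix.of_apply, star_mul', ← hs, star_sum, star_mul, star_star]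
    rw [Complex.star_def, Complex.conj_ofReal]
  obtain ⟨B, hB⟩ := CStarAlgebra.nonneg_iff_eq_star_mul_self.1 hps.nonneg
  refine ⟨B, fun q r => ?_⟩
  have := congrFun (congrFun hB q) r
  simpa [hM, Matrix.mul_apply, Matrix.star_apply] using this
end states
end DRank

namespace DRank
section stepD
variable {R : Type*} [CStarAlgebra R] [PartialOrder R] [StarOrderedRing R]

abbrev Sg {s : ℕ} (r : Fin s → ℕ) : Type := Σ i : Fin s, Fin (r i)

def bd {s : ℕ} {r : Fin s → ℕ} : FDBlock s r →⋆ₙₐ[ℂ] Matrix (Sg r) (Sg r) ℂ where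
  toFun := Matrix.blockDiagonal'
  map_smul' k a := Matrix.blockDiagonal'_smul k a
  map_zero' := Matrix.blockDiagonal'_zero
  map_add' a b := Matrix.blockDiagonal'_add a b
  map_mul' a b := Matrix.blockDiagonal'_mul a b
  map_star' a := (Matrix.blockDiagonal'_conjTranspose a).symm

lemma bd_apply {s : ℕ} {r : Fin s → ℕ} (y : FDBlock s r) (i : Fin s) (k l : Fin (r i)) :
    bd y ⟨i, k⟩ ⟨i, l⟩ = y i k l := Matrix.blockDiagonal'_apply_eq _ _ _ _

lemma bd_apply_ne {s : ℕ} {r : Fin s → ℕ} (y : FDBlock s r) (q q' : Sg r) (h : q.1 ≠ q'.1) :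
    bd y q q' = 0 := Matrix.blockDiagonal'_apply_ne _ _ _ h

lemma norm_bd_le {s : ℕ} {r : Fin s → ℕ} (y : FDBlock s r) : ‖bd y‖ ≤ ‖y‖ :=
  NonUnitalStarAlgHom.norm_apply_le (bd : FDBlock s r →⋆ₙₐ[ℂ] Matrix (Sg r) (Sg r) ℂ) y

lemma goodX_reindex {n : ℕ} {p : R} (h : GoodX n R p) (S : Finset R) (hS : ∀ a ∈ S, p * a * p = a)
    (ε : ℝ) (hε : 0 < ε) : ∃ κ : ℝ, 0 < κ ∧ κ ≤ 1 ∧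
    ∃ (s : ℕ) (r : Fin s → ℕ) (J : Fin s → Fin (n+1)) (V : Sg r → R) (c : Fin s → R)
      (x : R → FDBlock s r), (∀ q, p * V q = V q) ∧ Exr Sigma.fst J V c ∧
      (∀ a i, c i = 0 → x a i = 0) ∧ (∀ i, c i = 0 ∨ κ ≤ ‖c i‖) ∧ ‖(row V : MM (Sg r) R)‖ ≤ 1 ∧
      ‖∑ q, V q * star (V q) - p‖ ≤ ε ∧
      ∀ a ∈ S, ‖(row (err a (bd (x a)) V) : MM (Sg r) R)‖ ≤ ε * Real.sqrt κ := by
  classical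
  obtain ⟨κ, hκ, hκ1, N, I, _, _, _, _, b, J, V, c, x, hpV, hx, hX, hc, hn, hV, herr⟩ := h S hS ε hε
  let e : Fin (Fintype.card I) ≃ I := (Fintype.equivFin I).symm
  let r : Fin (Fintype.card I) → ℕ := fun i => Fintype.card {q // b q = e i}
  let f : Sg r ≃ N := (Equiv.sigmaCongr e fun i => (Fintype.equivFin {q // b q = e i}).symm).trans
    (Equiv.sigmaFiberEquiv b)
  have hf : ∀ q : Sg r, b (f q) = e q.1 := fun q =>
    ((Fintype.equivFin {q' // b q' = e q.1}).symm q.2).2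
  have hz : ∀ q, c (b q) = 0 → V q = 0 := fun q hq => by
    have := hX q q rfl
    rw [if_pos rfl, hq] at this
    exact (CStarRing.star_mul_self_eq_zero_iff _).1 this
  let y : R → FDBlock (Fintype.card I) r := fun a i => if c (e i) = 0 then 0 else
    Matrix.of fun k l => x a (f ⟨i, k⟩) (f ⟨i, l⟩)
  have hy : ∀ a ∈ S, err a (bd (y a)) (V ∘ f) = err a (x a) V ∘ f := by
    intro a ha
    ext q
    obtain ⟨i, l⟩ := q
    simp only [err, Function.comp]
    congr 1
    rw [← Equiv.sum_comp f]
    refine Finset.sum_congr rfl fun q' _ => ?_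
    obtain ⟨i', k⟩ := q'
    by_cases hii : i' = i
    · subst hii
      rw [bd_apply]
      simp only [y]
      by_cases h0 : c (e i') = 0
      · rw [hz (f ⟨i', k⟩) (by rw [hf]; exact h0)]; simp
      · rw [if_neg h0]; rfl
    · rw [bd_apply_ne _ _ _ hii, hx a ha]
      rw [hf, hf]; exact fun h => hii (e.injective h)
  refine ⟨κ, hκ, hκ1, Fintype.card I, r, J ∘ e, V ∘ f, c ∘ e, y, fun q => hpV _, ?_, ?_,
    fun i => hc _, ?_, ?_, ?_⟩
  · intro q q' hqq
    have := hX (f q) (f q') (by rw [hf, hf]; exact hqq)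
    simp only [Function.comp]
    rw [this, hf]
    simp [f.injective.eq_iff]
  · intro a i hi
    exact if_pos hi
  · rw [norm_row_comp]; exact hn
  · have : ∑ q, (V ∘ f) q * star ((V ∘ f) q) = ∑ q, V q * star (V q) :=
      Equiv.sum_comp f (fun q => V q * star (V q))
    rw [this]; exact hV
  · intro a ha
    rw [hy a ha, norm_row_comp]; exact herr a ha

lemma norm_row_block {s : ℕ} {r : Fin s → ℕ} (W : Sg r → R) (i : Fin s) :
    ‖(row (fun k => W ⟨i, k⟩) : MM (Fin (r i)) R)‖ ≤ ‖(row W : MM (Sg r) R)‖ := by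
  have h : ‖(row (fun k => W ⟨i, k⟩) : MM (Fin (r i)) R)‖ ^ 2 ≤ ‖(row W : MM (Sg r) R)‖ ^ 2 := by
    rw [norm_row_sq, norm_row_sq]
    refine CStarAlgebra.norm_le_norm_of_nonneg_of_le
      (Finset.sum_nonneg fun k _ => mul_star_self_nonneg _) ?_
    rw [Fintype.sum_sigma]
    exact Finset.single_le_sum (f := fun i => ∑ k, W ⟨i, k⟩ * star (W ⟨i, k⟩))
      (fun i _ => Finset.sum_nonneg fun k _ => mul_star_self_nonneg _) (Finset.mem_univ i)
  exact (pow_le_pow_iff_left₀ (norm_nonneg _) (norm_nonneg _) two_ne_zero).1 h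

lemma norm_row_blockV {n s : ℕ} {r : Fin s → ℕ} {J : Fin s → Fin (n+1)} {V : Sg r → R} {c : Fin s → R}
    (hX : Exr Sigma.fst J V c) (i : Fin s) :
    ‖(row (fun k => V ⟨i, k⟩) : MM (Fin (r i)) R)‖ ≤ Real.sqrt ‖c i‖ := by
  apply norm_le_of_sq (Real.sqrt_nonneg _)
  rw [Real.sq_sqrt (norm_nonneg _), star_row_mul_row_eq_dg _ _ (fun _ => c i)]
  · refine (norm_dg_le _).trans ((pi_norm_le_iff_of_nonneg (norm_nonneg _)).2 fun q => le_rfl)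
  · intro k l
    rw [hX ⟨i, k⟩ ⟨i, l⟩ rfl]
    simp

lemma nonneg_of_map {D : Type*} [CStarAlgebra D] [PartialOrder D] [StarOrderedRing D]
    (f : D →⋆ₙₐ[ℂ] R) (hf : Function.Injective f) (T : D) (hT : 0 ≤ f T) : 0 ≤ T := by
  have hs : IsSelfAdjoint T := by
    apply hf; rw [map_star]; exact hT.isSelfAdjoint.star_eq
  have h1 : T⁻ * T = - (T⁻ * T⁻) := by
    have : T⁻ * (T⁺ - T⁻) = T⁻ * T := congrArg (fun X => T⁻ * X) (CFC.posPart_sub_negPart T hs)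
    rw [← this, mul_sub, CFC.negPart_mul_posPart, zero_sub]
  have h2 : 0 ≤ T⁻ := CFC.negPart_nonneg T
  have h3 : 0 ≤ f (T⁻ * T * T⁻) := by
    have := star_left_conjugate_nonneg hT (f T⁻)
    rwa [← map_star, h2.isSelfAdjoint.star_eq, ← map_mul, ← map_mul] at this
  have h4 : 0 ≤ T⁻ * T⁻ * T⁻ := by
    have := star_left_conjugate_nonneg h2 (T⁻)
    rwa [h2.isSelfAdjoint.star_eq] at this
  rw [h1, neg_mul, map_neg, Left.nonneg_neg_iff] at h3
  have h5 : 0 ≤ f (T⁻ * T⁻ * T⁻) := by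
    obtain ⟨y, hy⟩ := CStarAlgebra.nonneg_iff_eq_star_mul_self.1 h4
    rw [hy, map_mul, map_star]; exact star_mul_self_nonneg _
  have h6 : T⁻ * T⁻ * T⁻ = 0 := hf (by rw [map_zero]; exact le_antisymm h3 h5)
  have h7 : T⁻ * T⁻ = 0 := by
    have : star (T⁻ * T⁻) * (T⁻ * T⁻) = 0 := by
      rw [star_mul, h2.isSelfAdjoint.star_eq, ← mul_assoc, h6, zero_mul]
    exact (CStarRing.star_mul_self_eq_zero_iff _).1 this
  have h8 : T⁻ = 0 := by
    have : star (T⁻) * (T⁻) = 0 := by rw [h2.isSelfAdjoint.star_eq, h7]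
    exact (CStarRing.star_mul_self_eq_zero_iff _).1 this
  exact (CFC.negPart_eq_zero_iff T hs).1 h8

end stepD
end DRank

namespace DRank
section L2
variable {R : Type*} [CStarAlgebra R] [PartialOrder R] [StarOrderedRing R]

lemma star_row_msk {n : ℕ} {N I : Type} [Fintype N] [DecidableEq N]
    (b : N → I) (J : I → Fin (n+1)) (V : N → R) (c : I → R) (hX : Exr b J V c) (j : Fin (n+1)) :
    (star (row (msk b J j V)) * row (msk b J j V) : MM N R) = dg (msk b J j (c ∘ b)) := by
  apply star_row_mul_row_eq_dg
  intro q q'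
  have h := hX q q'
  unfold msk
  by_cases h1 : J (b q) = j
  · by_cases h2 : J (b q') = j
    · rw [if_pos h1, if_pos h1, if_pos h2, h (h1.trans h2.symm)]; rfl
    · have : q ≠ q' := by rintro rfl; exact h2 h1
      rw [if_neg h2, if_neg this, mul_zero]
  · rw [if_neg h1, if_neg h1, star_zero, zero_mul]; simp

def Phi {s : ℕ} {r : Fin s → ℕ} (V : Sg r → R) : FDBlock s r →ₗ[ℂ] R where
  toFun y := (row V * scal (bd y) * star (row V) : MM (Sg r) R) none none
  map_add' y z := by rw [map_add, map_add, mul_add, add_mul]; rfl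
  map_smul' k y := by rw [map_smul, map_smul, mul_smul_comm, smul_mul_assoc]; rfl

lemma cor_Phi {s : ℕ} {r : Fin s → ℕ} (V : Sg r → R) (y : FDBlock s r) :
    (cor (Phi V y) : MM (Sg r) R) = row V * scal (bd y) * star (row V) := by
  rw [row_mul_scal, row_mul_star_row]
  congr 1
  change (row V * scal (bd y) * star (row V) : MM (Sg r) R) none none = _
  rw [row_mul_scal, row_mul_star_row]; rfl

lemma cor_inj {N : Type*} [Fintype N] [DecidableEq N] {a b : R} (h : (cor a : MM N R) = cor b) : a = b := by
  simpa using congrArg (fun X : MM N R => X none none) h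

lemma norm_Phi_le {s : ℕ} {r : Fin s → ℕ} (V : Sg r → R) (hV : ‖(row V : MM (Sg r) R)‖ ≤ 1)
    (y : FDBlock s r) : ‖Phi V y‖ ≤ ‖y‖ := by
  rw [← norm_cor (N := Sg r), cor_Phi]
  have h2 := (norm_scal_le (R := R) (bd y)).trans (norm_bd_le y)
  calc _ ≤ ‖(row V : MM (Sg r) R)‖ * ‖(scal (bd y) : MM (Sg r) R)‖ * ‖star (row V : MM (Sg r) R)‖ :=
        (norm_mul_le _ _).trans (mul_le_mul_of_nonneg_right (norm_mul_le _ _) (norm_nonneg _))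
    _ ≤ 1 * ‖y‖ * 1 := by
        rw [norm_star]
        gcongr
    _ = ‖y‖ := by ring

lemma Phi_star_mul {s : ℕ} {r : Fin s → ℕ} (V : Sg r → R) (y z : FDBlock s r) :
    Phi V (star y * z) = ∑ q, star (∑ q', bd y q q' • star (V q')) * (∑ q', bd z q q' • star (V q')) := by
  apply cor_inj (N := Sg r)
  rw [cor_Phi, map_mul, map_mul, map_star, map_star]
  have : (row V * (star (scal (bd y)) * scal (bd z)) * star (row V) : MM (Sg r) R)
      = star (scal (bd y) * star (row V)) * (scal (bd z) * star (row V)) := by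
    rw [star_mul, star_star]; simp only [mul_assoc]
  rw [this]
  apply mm_ext <;> simp [mm_mul, mm_star]

lemma Phi_pos {s : ℕ} {r : Fin s → ℕ} (V : Sg r → R) (k : ℕ)
    (X : Matrix (Fin k) (Fin k) (FDBlock s r)) (hX : IsPosElem X) :
    0 ≤ CStarMatrix.ofMatrix (X.map (Phi V)) := by
  obtain ⟨Y, rfl⟩ := hX
  let Z : Sg r → CStarMatrix (Fin k) (Fin k) R := fun q => CStarMatrix.ofMatrix
    (Matrix.of fun l i => ∑ q', bd (Y l i) q q' • star (V q'))
  have : CStarMatrix.ofMatrix ((star Y * Y).map (Phi V)) = ∑ q, star (Z q) * Z q := by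
    ext i j
    have h2 : ∀ W : Sg r → CStarMatrix (Fin k) (Fin k) R, (∑ q, W q) i j = ∑ q, (W q) i j := by
      intro W
      exact Matrix.sum_apply i j Finset.univ W
    rw [h2]
    simp only [CStarMatrix.ofMatrix_apply, Matrix.map_apply, Matrix.mul_apply, Matrix.star_apply, map_sum,
      Phi_star_mul, CStarMatrix.mul_apply, CStarMatrix.star_apply]
    rw [Finset.sum_comm]
    rfl
  rw [this]
  exact Finset.sum_nonneg fun q _ => star_mul_self_nonneg _

lemma Phi_orth {n s : ℕ} {r : Fin s → ℕ} {J : Fin s → Fin (n+1)} {V : Sg r → R} {c : Fin s → R}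
    (hX : Exr Sigma.fst J V c) (j : Fin (n+1)) (y z : FDBlock s r) (hy : y ∈ blockSupp J j)
    (hz : z ∈ blockSupp J j) (hyz : y * z = 0) : Phi V y * Phi V z = 0 := by
  apply cor_inj (N := Sg r)
  rw [map_mul, cor_Phi, cor_Phi, map_zero]
  set W := msk Sigma.fst J j V with hW
  have h0 : ∀ (y : FDBlock s r), y ∈ blockSupp J j → ∀ q q' : Sg r, J q.1 ≠ j → bd y q q' = 0 := by
    intro y hy q q' hq
    obtain ⟨i, k⟩ := q; obtain ⟨i', k'⟩ := q'
    by_cases h : i = i'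
    · subst h; rw [bd_apply, hy i hq]; rfl
    · exact bd_apply_ne _ _ _ h
  have h0' : ∀ (y : FDBlock s r), y ∈ blockSupp J j → ∀ q q' : Sg r, J q'.1 ≠ j → bd y q q' = 0 := by
    intro y hy q q' hq
    obtain ⟨i, k⟩ := q; obtain ⟨i', k'⟩ := q'
    by_cases h : i = i'
    · subst h; rw [bd_apply, hy i hq]; rfl
    · exact bd_apply_ne _ _ _ h
  have e1 : (scal (bd y) * star (row V) : MM (Sg r) R) = scal (bd y) * star (row W) := by
    apply mm_ext <;> simp [mm_mul, mm_star]
    intro q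
    refine Finset.sum_congr rfl fun q' _ => ?_
    by_cases h : J q'.1 = j
    · simp [hW, msk, h]
    · rw [h0' y hy q q' h]; simp
  have e2 : (row V * scal (bd z) : MM (Sg r) R) = row W * scal (bd z) := by
    apply mm_ext <;> simp [mm_mul, mm_star]
    intro q
    refine Finset.sum_congr rfl fun q' _ => ?_
    by_cases h : J q'.1 = j
    · simp [hW, msk, h]
    · rw [h0 z hz q' q h]; simp
  have e3 : (star (row W) * row W : MM (Sg r) R) = dg (msk Sigma.fst J j (c ∘ Sigma.fst)) := by
    exact star_row_msk _ J V c hX j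
  have e4 : (scal (bd y) * dg (msk Sigma.fst J j (c ∘ Sigma.fst)) : MM (Sg r) R)
      = dg (msk Sigma.fst J j (c ∘ Sigma.fst)) * scal (bd y) := by
    apply scal_dg_comm
    intro q q' hqq
    have : q.1 = q'.1 := by
      by_contra h; exact hqq (bd_apply_ne _ _ _ h)
    simp [msk, this]
  calc (row V * scal (bd y) * star (row V) * (row V * scal (bd z) * star (row V)) : MM (Sg r) R)
      = row V * (scal (bd y) * star (row V)) * ((row V * scal (bd z)) * star (row V)) := by
        simp only [mul_assoc]
    _ = row V * (scal (bd y) * (star (row W) * row W)) * (scal (bd z) * star (row V)) := by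
        rw [e1, e2]; simp only [mul_assoc]
    _ = row V * dg (msk Sigma.fst J j (c ∘ Sigma.fst)) * (scal (bd y) * scal (bd z)) * star (row V) := by
        rw [e3, e4]; simp only [mul_assoc]
    _ = 0 := by
        rw [← map_mul, ← map_mul, hyz, map_zero, map_zero, mul_zero, zero_mul]

def Psi {s : ℕ} {r : Fin s → ℕ} (V : Sg r → R) (c : Fin s → R) (ρ : Fin s → R →L[ℂ] ℂ) :
    R →ₗ[ℂ] FDBlock s r where
  toFun a i := Matrix.of fun k l => ((‖c i‖⁻¹ : ℝ) : ℂ) * ρ i (star (V ⟨i, k⟩) * (a * V ⟨i, l⟩))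
  map_add' a b := by
    funext i; ext k l; simp [add_mul, mul_add]
  map_smul' t a := by
    funext i; ext k l; simp; ring

lemma Psi_pos {s : ℕ} {r : Fin s → ℕ} (V : Sg r → R) (c : Fin s → R) (ρ : Fin s → R →L[ℂ] ℂ)
    (hρ : ∀ i a, 0 ≤ a → 0 ≤ ρ i a) : IsCompletelyPositive (Psi V c ρ) := by
  rintro k X ⟨Y, rfl⟩
  choose B hB using fun i => gram_factor (N := Fin k × Fin (r i)) (ρ i) (hρ i)
    (fun (l : Fin k) q => Y l q.1 * V ⟨i, q.2⟩) (‖c i‖⁻¹) (by positivity)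
  refine ⟨Matrix.of fun a b i => Matrix.of fun m l => B i (a, m) (b, l), ?_⟩
  ext a b i m l
  have h := hB i (a, m) (b, l)
  simp only [Matrix.map_apply, Psi, LinearMap.coe_mk, AddHom.coe_mk, Matrix.of_apply, Matrix.mul_apply,
    Matrix.star_apply, Finset.sum_apply, Pi.mul_apply, Pi.star_apply]
  rw [Matrix.sum_apply]
  simp only [Matrix.mul_apply, Matrix.star_apply, Matrix.of_apply]
  rw [Fintype.sum_prod_type] at h
  rw [← h]
  congr 2
  rw [Finset.sum_mul, Finset.mul_sum]
  refine Finset.sum_congr rfl fun l _ => ?_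
  rw [star_mul]; simp only [mul_assoc]

lemma norm_Psi_block {n s : ℕ} {r : Fin s → ℕ} {J : Fin s → Fin (n+1)} {V : Sg r → R} {c : Fin s → R}
    (hX : Exr Sigma.fst J V c) (ρ : R →L[ℂ] ℂ) (hρ : ‖ρ‖ ≤ 1) (i : Fin s) (Z : Fin (r i) → R) :
    ‖(Matrix.of fun k l => ((‖c i‖⁻¹ : ℝ) : ℂ) * ρ (star (V ⟨i, k⟩) * Z l) : Matrix (Fin (r i)) (Fin (r i)) ℂ)‖
      ≤ ‖c i‖⁻¹ * (Real.sqrt ‖c i‖ * ‖(row Z : MM (Fin (r i)) R)‖) := by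
  have : (Matrix.of fun k l => ((‖c i‖⁻¹ : ℝ) : ℂ) * ρ (star (V ⟨i, k⟩) * Z l) : Matrix (Fin (r i)) (Fin (r i)) ℂ)
     = ((‖c i‖⁻¹ : ℝ) : ℂ) • (Matrix.of fun k l => ρ (star (V ⟨i, k⟩) * Z l)) := rfl
  rw [this, norm_smul, Complex.norm_real, Real.norm_of_nonneg (by positivity)]
  refine mul_le_mul_of_nonneg_left ?_ (by positivity)
  refine (norm_gram_le ρ hρ (fun k => V ⟨i, k⟩) Z).trans ?_
  exact mul_le_mul_of_nonneg_right (norm_row_blockV hX i) (norm_nonneg _)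

end L2
end DRank

namespace DRank
section L2
variable {R : Type*} [CStarAlgebra R] [PartialOrder R] [StarOrderedRing R]

lemma posElem_of_nonneg {T : R} (h : 0 ≤ T) : ∃ Y, T = star Y * Y :=
  CStarAlgebra.nonneg_iff_eq_star_mul_self.1 h

lemma Psi_approx {n s : ℕ} {r : Fin s → ℕ} {J : Fin s → Fin (n+1)} {V : Sg r → R} {c : Fin s → R}
    (hX : Exr Sigma.fst J V c) (ρ : Fin s → R →L[ℂ] ℂ) (hρ : ∀ i, ‖ρ i‖ ≤ 1) (hρc : ∀ i, Nonempty (Fin (r i)) → ρ i (c i) = ‖c i‖)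
    {κ ε : ℝ} (hκ : 0 < κ) (hε : 0 < ε) (hc : ∀ i, c i = 0 ∨ κ ≤ ‖c i‖) (a : R) (x : FDBlock s r)
    (hx0 : ∀ i, c i = 0 → x i = 0)
    (herr : ‖(row (err a (bd x) V) : MM (Sg r) R)‖ ≤ ε * Real.sqrt κ) :
    ‖Psi V c ρ a - x‖ ≤ ε := by
  refine (pi_norm_le_iff_of_nonneg hε.le).2 fun i => ?_
  rcases hc i with h0 | h0
  · have : (Psi V c ρ a - x) i = 0 := by
      ext k l
      simp [Psi, h0, hx0 i h0]
    rw [this, norm_zero]; exact hε.le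
  · have hc0 : 0 < ‖c i‖ := hκ.trans_le h0
    have e : (Psi V c ρ a - x) i = Matrix.of fun k l => ((‖c i‖⁻¹ : ℝ) : ℂ) *
        ρ i (star (V ⟨i, k⟩) * (err a (bd x) V ⟨i, l⟩)) := by
      ext k l
      simp only [Psi, LinearMap.coe_mk, AddHom.coe_mk, Pi.sub_apply, Matrix.sub_apply, Matrix.of_apply, err]
      rw [mul_sub, map_sub, mul_sub]
      congr 1
      have : ∑ q : Sg r, bd x q ⟨i, l⟩ • V q = ∑ m, x i m l • V ⟨i, m⟩ := by
        rw [Fintype.sum_sigma, Finset.sum_eq_single i]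
        · refine Finset.sum_congr rfl fun m _ => ?_
          rw [bd_apply]
        · intro i' _ hi
          refine Finset.sum_eq_zero fun m _ => ?_
          rw [bd_apply_ne _ _ _ hi, zero_smul]
        · simp
      rw [this, Finset.mul_sum, map_sum, Finset.sum_eq_single k]
      · rw [mul_smul_comm, hX ⟨i, k⟩ ⟨i, k⟩ rfl, if_pos rfl, map_smul, hρc i ⟨k⟩, smul_eq_mul]
        push_cast
        have : (‖c i‖ : ℂ) ≠ 0 := by exact_mod_cast hc0.ne'
        field_simp
      · intro m _ hm
        rw [mul_smul_comm, hX ⟨i, k⟩ ⟨i, m⟩ rfl, if_neg (by intro h; simp at h; exact hm h.symm), smul_zero, map_zero]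
      · simp
    rw [e]
    refine (norm_Psi_block hX (ρ i) (hρ i) i _).trans ?_
    have h1 := (norm_row_block (err a (bd x) V) i).trans herr
    have h2 : Real.sqrt κ ≤ Real.sqrt ‖c i‖ := Real.sqrt_le_sqrt h0
    have h3 : Real.sqrt ‖c i‖ * Real.sqrt ‖c i‖ = ‖c i‖ := Real.mul_self_sqrt hc0.le
    calc _ ≤ ‖c i‖⁻¹ * (Real.sqrt ‖c i‖ * (ε * Real.sqrt ‖c i‖)) := by
          gcongr
          exact h1.trans (mul_le_mul_of_nonneg_left h2 hε.le)
      _ = ‖c i‖⁻¹ * (ε * (Real.sqrt ‖c i‖ * Real.sqrt ‖c i‖)) := by ring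
      _ = ε := by rw [h3]; field_simp

lemma norm_Psi_le {n s : ℕ} {r : Fin s → ℕ} {J : Fin s → Fin (n+1)} {V : Sg r → R} {c : Fin s → R}
    (hX : Exr Sigma.fst J V c) (ρ : Fin s → R →L[ℂ] ℂ) (hρ : ∀ i, ‖ρ i‖ ≤ 1) (a : R) :
    ‖Psi V c ρ a‖ ≤ ‖a‖ := by
  refine (pi_norm_le_iff_of_nonneg (norm_nonneg _)).2 fun i => ?_
  refine (norm_Psi_block hX (ρ i) (hρ i) i (fun l => a * V ⟨i, l⟩)).trans ?_
  have h1 : ‖(row (fun l => a * V ⟨i, l⟩) : MM (Fin (r i)) R)‖ ≤ ‖a‖ * Real.sqrt ‖c i‖ := by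
    rw [← cor_mul_row]
    refine (norm_mul_le _ _).trans ?_
    rw [norm_cor]
    exact mul_le_mul_of_nonneg_left (norm_row_blockV hX i) (norm_nonneg _)
  have h3 : Real.sqrt ‖c i‖ * Real.sqrt ‖c i‖ = ‖c i‖ := Real.mul_self_sqrt (norm_nonneg _)
  calc _ ≤ ‖c i‖⁻¹ * (Real.sqrt ‖c i‖ * (‖a‖ * Real.sqrt ‖c i‖)) := by gcongr
    _ = ‖c i‖⁻¹ * (‖a‖ * (Real.sqrt ‖c i‖ * Real.sqrt ‖c i‖)) := by ring
    _ = (‖c i‖⁻¹ * ‖c i‖) * ‖a‖ := by rw [h3]; ring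
    _ ≤ 1 * ‖a‖ := by
        gcongr
        exact inv_mul_le_one
    _ = ‖a‖ := one_mul _

set_option maxHeartbeats 1000000 in
theorem dr_of_goodX {n : ℕ} {p : R} (h : GoodX n R p) {D : Type*} [CStarAlgebra D]
    (ι : D →⋆ₙₐ[ℂ] R) (hι : Function.Injective ι) (hp : ι 1 = p)
    (hr : ∀ x, p * x * p = x → ∃ d, ι d = x) : DecompositionRankLE n D := by
  classical
  letI : PartialOrder D := CStarAlgebra.spectralOrder D
  haveI : StarOrderedRing D := CStarAlgebra.spectralOrderedRing D
  intro S ε hε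
  have hpp : p * p = p := by rw [← hp, ← map_mul, one_mul]
  have hsp : star p = p := by rw [← hp, ← map_star, star_one]
  have hιp : ∀ d, p * ι d * p = ι d := fun d => by
    rw [← hp, ← map_mul, ← map_mul, one_mul, mul_one]
  have hιn : ∀ d, ‖ι d‖ = ‖d‖ := NonUnitalStarAlgHom.norm_map ι hι
  set B : ℝ := ∑ a ∈ S, ‖a‖ with hB
  have hB0 : 0 ≤ B := Finset.sum_nonneg fun _ _ => norm_nonneg _
  set e : ℝ := ε / (B + 3) with he
  have he0 : 0 < e := by positivity
  obtain ⟨κ, hκ, hκ1, s, r, J, V, c, x, hpV, hX, hx0, hc, hn, hV, herr⟩ :=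
    goodX_reindex h (S.image ι) (by
      intro a ha
      obtain ⟨d, -, rfl⟩ := Finset.mem_image.1 ha
      exact hιp d) e he0
  have hc0 : ∀ i, ∃ ρ : R →L[ℂ] ℂ, ‖ρ‖ ≤ 1 ∧ (∀ a, 0 ≤ a → 0 ≤ ρ a) ∧
      (Nonempty (Fin (r i)) → ρ (c i) = ‖c i‖) := by
    intro i
    rcases isEmpty_or_nonempty (Fin (r i)) with hi | ⟨⟨k⟩⟩
    · refine ⟨0, by simp, fun a _ => by simp, fun h => (not_isEmpty_iff.2 h hi).elim⟩
    · have : 0 ≤ c i := by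
        have := hX ⟨i, k⟩ ⟨i, k⟩ rfl
        rw [if_pos rfl] at this
        simp only at this
        rw [← this]; exact star_mul_self_nonneg _
      obtain ⟨f, hf, hf1, hf2⟩ := exists_state (c i) this
      exact ⟨f, hf, hf1, fun _ => hf2⟩
  choose ρ hρ1 hρ2 hρ3 using hc0
  have hVp : (cor p * row V : MM (Sg r) R) = row V := by
    rw [cor_mul_row]; congr 1; funext q; exact hpV q
  have hPhi : ∀ y, p * Phi V y * p = Phi V y := by
    intro y
    apply cor_inj (N := Sg r)
    rw [map_mul, map_mul, cor_Phi]
    have h2 : (star (row V) * cor p : MM (Sg r) R) = star (row V) := by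
      have := congrArg star hVp
      rwa [star_mul, ← map_star cor, hsp] at this
    calc (cor p * (row V * scal (bd y) * star (row V)) * cor p : MM (Sg r) R)
        = (cor p * row V) * scal (bd y) * (star (row V) * cor p) := by simp only [mul_assoc]
      _ = _ := by rw [hVp, h2]
  choose g hg using fun y => hr _ (hPhi y)
  let φ : FDBlock s r →ₗ[ℂ] D :=
    { toFun := g
      map_add' := fun y z => hι (by rw [map_add, hg, hg, hg, map_add])
      map_smul' := fun t y => hι (by
        rw [RingHom.id_apply, map_smul, hg, hg, map_smul]) }
  have hφ : ∀ y, ι (φ y) = Phi V y := hg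
  let ιl : D →ₗ[ℂ] R := ⟨⟨ι, map_add ι⟩, fun t a => map_smul ι t a⟩
  refine ⟨s, r, J, (Psi V c ρ).comp ιl, φ, ?_, ?_, ?_, ?_, ?_, ?_⟩
  · rintro k X ⟨Y, rfl⟩
    have := Psi_pos V c ρ hρ2 k ((star Y * Y).map ι) ⟨Y.map ι, by
      ext i j
      simp [Matrix.mul_apply, Matrix.star_apply, map_sum, map_mul, map_star]⟩
    exact this
  · intro k X hXp
    have h1 := Phi_pos V k X hXp
    let F := CStarMatrix.mapₙₐ (n := Fin k) ι
    have hF : Function.Injective F := by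
      intro S T hST
      ext i j
      apply hι
      exact congrFun (congrFun hST i) j
    have h2 : 0 ≤ CStarMatrix.ofMatrix (X.map φ) := by
      apply nonneg_of_map F hF
      have : F (CStarMatrix.ofMatrix (X.map φ)) = CStarMatrix.ofMatrix (X.map (Phi V)) := by
        ext i j
        exact hφ _
      rw [this]; exact h1
    obtain ⟨Y, hY⟩ := posElem_of_nonneg h2
    exact ⟨Y, hY⟩
  · intro a
    exact (norm_Psi_le hX ρ hρ1 (ι a)).trans (hιn a).le
  · intro y
    rw [← hιn, hφ]; exact norm_Phi_le V hn y
  · intro j y hy z hz hyz hzy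
    constructor
    · apply hι; rw [map_mul, hφ, hφ, map_zero]; exact Phi_orth hX j y z hy hz hyz
    · apply hι; rw [map_mul, hφ, hφ, map_zero]; exact Phi_orth hX j z y hz hy hzy
  · intro a ha
    have haB : ‖a‖ ≤ B := Finset.single_le_sum (f := fun a => ‖a‖) (fun _ _ => norm_nonneg _) ha
    have he1 := herr (ι a) (Finset.mem_image_of_mem _ ha)
    have hap := Psi_approx hX ρ hρ1 hρ3 hκ he0 hc (ι a) (x (ι a)) (hx0 _) he1
    have he2 : ‖(row (err (ι a) (bd (x (ι a))) V) : MM (Sg r) R)‖ ≤ e := by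
      refine he1.trans ?_
      have : Real.sqrt κ ≤ 1 := by exact Real.sqrt_le_one.2 hκ1
      calc e * Real.sqrt κ ≤ e * 1 := mul_le_mul_of_nonneg_left this he0.le
        _ = e := mul_one e
    rw [← hιn, map_sub, hφ]
    have e1 : ‖Phi V (Psi V c ρ (ι a)) - Phi V (x (ι a))‖ ≤ e := by
      rw [← map_sub]; exact (norm_Phi_le V hn _).trans hap
    have e2 : ‖Phi V (x (ι a)) - ι a * ∑ q, V q * star (V q)‖ ≤ e := by
      rw [← norm_cor (N := Sg r), map_sub, map_mul, cor_Phi, ← row_mul_star_row]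
      have : (row V * scal (bd (x (ι a))) * star (row V) - cor (ι a) * (row V * star (row V)) : MM (Sg r) R)
          = -(row (err (ι a) (bd (x (ι a))) V) * star (row V)) := by
        rw [row_err]
        noncomm_ring
      rw [this, norm_neg]
      refine (norm_mul_le _ _).trans ?_
      rw [norm_star]
      calc _ ≤ e * 1 := by gcongr
        _ = e := mul_one e
    have e3 : ‖ι a * ∑ q, V q * star (V q) - ι a‖ ≤ B * e := by
      have : ι a * ∑ q, V q * star (V q) - ι a = ι a * (∑ q, V q * star (V q) - p) := by
        rw [mul_sub, ← hp, ← map_mul, mul_one]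
      rw [this]
      refine (norm_mul_le _ _).trans ?_
      rw [hιn]; gcongr
    have e4 : Phi V (Psi V c ρ (ι a)) - ι a = (Phi V (Psi V c ρ (ι a)) - Phi V (x (ι a))) +
        (Phi V (x (ι a)) - ι a * ∑ q, V q * star (V q)) + (ι a * ∑ q, V q * star (V q) - ι a) := by abel
    have e5 : (B + 3) * e = ε := by rw [he]; field_simp
    change ‖Phi V (Psi V c ρ (ι a)) - ι a‖ < ε
    rw [e4]
    refine (norm_add₃_le).trans_lt ?_
    linarith
end L2
end DRank

namespace DRank
section cp
variable {F D : Type*} [CStarAlgebra F] [CStarAlgebra D] [PartialOrder D] [StarOrderedRing D]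

lemma cp2 {φ : F →ₗ[ℂ] D} (h : IsCompletelyPositive φ) (u x : F) : ∃ y z : Fin 2 → D,
    φ (star u * u) = ∑ m, star (y m) * y m ∧ φ (star u * x) = ∑ m, star (y m) * z m ∧
    φ (star x * u) = ∑ m, star (z m) * y m ∧ φ (star x * x) = ∑ m, star (z m) * z m := by
  obtain ⟨Y, hY⟩ := h 2 _ ⟨!![u, x; 0, 0], rfl⟩
  have e := fun i j => congrFun (congrFun hY i) j
  refine ⟨fun m => Y m 0, fun m => Y m 1, ?_, ?_, ?_, ?_⟩
  · have := e 0 0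
    simpa [Matrix.mul_apply, Matrix.star_apply, Fin.sum_univ_two] using this
  · have := e 0 1
    simpa [Matrix.mul_apply, Matrix.star_apply, Fin.sum_univ_two] using this
  · have := e 1 0
    simpa [Matrix.mul_apply, Matrix.star_apply, Fin.sum_univ_two] using this
  · have := e 1 1
    simpa [Matrix.mul_apply, Matrix.star_apply, Fin.sum_univ_two] using this

lemma cp_star {φ : F →ₗ[ℂ] D} (h : IsCompletelyPositive φ) (x : F) : φ (star x) = star (φ x) := by
  obtain ⟨y, z, h1, h2, h3, h4⟩ := cp2 h 1 x
  rw [star_one, one_mul] at h2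
  rw [mul_one] at h3
  rw [h2, h3, star_sum]
  simp

lemma cp_kill {φ : F →ₗ[ℂ] D} (h : IsCompletelyPositive φ) {u : F} {w : D}
    (hw : φ (star u * u) * w = 0) (x : F) : φ (x * u) * w = 0 := by
  obtain ⟨y, z, h1, h2, h3, h4⟩ := cp2 h u (star x)
  have h5 : ∑ m, star (y m * w) * (y m * w) = 0 := by
    have : ∑ m, star (y m * w) * (y m * w) = star w * (φ (star u * u) * w) := by
      rw [h1, Finset.sum_mul, Finset.mul_sum]
      refine Finset.sum_congr rfl fun m _ => ?_
      rw [star_mul]; simp only [mul_assoc]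
    rw [this, hw, mul_zero]
  have h6 := (Finset.sum_eq_zero_iff_of_nonneg (fun m _ => star_mul_self_nonneg (y m * w))).1 h5
  rw [star_star] at h3
  rw [h3, Finset.sum_mul]
  refine Finset.sum_eq_zero fun m hm => ?_
  rw [mul_assoc, (CStarRing.star_mul_self_eq_zero_iff _).1 (h6 m hm), mul_zero]

lemma cp_nonneg {φ : F →ₗ[ℂ] D} (h : IsCompletelyPositive φ) (u : F) : 0 ≤ φ (star u * u) := by
  obtain ⟨y, z, h1, h2, h3, h4⟩ := cp2 h u 0
  rw [h1]; exact Finset.sum_nonneg fun m _ => star_mul_self_nonneg _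

lemma cp_orth {φ : F →ₗ[ℂ] D} (h : IsCompletelyPositive φ) {p q : F} (hp : star p * p = p) (hq : star q * q = q)
    (h0 : φ p * φ q = 0) (x y : F) : φ (x * p) * φ (q * y) = 0 := by
  have hq' : star q = q := by rw [← hq, star_mul, star_star]
  have h1 : ∀ x, φ (x * p) * φ q = 0 := fun x => cp_kill h (by rw [hp]; exact h0) x
  have h2 : φ q * φ (star (x * p)) = 0 := by
    have := congrArg star (h1 x)
    rwa [star_mul, star_zero, ← cp_star h, ← cp_star h, hq'] at this
  have h3 := cp_kill h (u := q) (by rw [hq]; exact h2) (star y)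
  have := congrArg star h3
  rwa [star_mul, star_zero, ← cp_star h, ← cp_star h, star_star, star_mul, star_star, hq'] at this

end cp

section blk
variable {D : Type*} [CStarAlgebra D] [PartialOrder D] [StarOrderedRing D]

def Em {s : ℕ} {r : Fin s → ℕ} (i : Fin s) (k l : Fin (r i)) : FDBlock s r :=
  Pi.single i (Matrix.single k l 1)

lemma Em_mul {s : ℕ} {r : Fin s → ℕ} (i : Fin s) (k l m : Fin (r i)) :
    (Em i k l * Em i l m : FDBlock s r) = Em i k m := by
  rw [Em, Em, ← Pi.single_mul, Matrix.single_mul_single_same, one_mul]; rfl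

lemma Em_mul_ne {s : ℕ} {r : Fin s → ℕ} (i : Fin s) (k l l' m : Fin (r i)) (h : l ≠ l') :
    (Em i k l * Em i l' m : FDBlock s r) = 0 := by
  rw [Em, Em, ← Pi.single_mul, Matrix.single_mul_single_of_ne _ _ _ _ h, Pi.single_zero]

lemma Em_mul_block {s : ℕ} {r : Fin s → ℕ} (i i' : Fin s) (h : i ≠ i') (k l) (k' l') :
    (Em i k l * Em i' k' l' : FDBlock s r) = 0 := by
  funext j
  rw [Pi.mul_apply, Em, Em]
  by_cases hj : j = i
  · subst hj; rw [Pi.single_eq_of_ne h, mul_zero]; rfl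
  · rw [Pi.single_eq_of_ne hj, zero_mul]; rfl

lemma Em_star {s : ℕ} {r : Fin s → ℕ} (i : Fin s) (k l : Fin (r i)) :
    (star (Em i k l) : FDBlock s r) = Em i l k := by
  rw [Em, ← Pi.single_star, Matrix.star_eq_conjTranspose, Matrix.conjTranspose_single, star_one]; rfl

lemma Em_sum {s : ℕ} {r : Fin s → ℕ} (y : FDBlock s r) : y = ∑ i, ∑ k, ∑ l, y i k l • Em i k l := by
  funext j
  rw [Finset.sum_apply, Finset.sum_eq_single j]
  · ext a b
    simp only [Finset.sum_apply, Matrix.sum_apply, Pi.smul_apply, Em, Pi.single_eq_same, Matrix.smul_apply,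
      Matrix.single_apply]
    simp [Finset.sum_ite_eq, ite_and]
  · intro i _ hi
    simp [Finset.sum_apply, Em, Pi.single_eq_of_ne hi.symm]
  · simp

lemma Em_supp {n s : ℕ} {r : Fin s → ℕ} (J : Fin s → Fin (n+1)) (i : Fin s) (k l : Fin (r i)) :
    (Em i k l : FDBlock s r) ∈ blockSupp J (J i) := by
  intro i' h
  rw [Em, Pi.single_eq_of_ne]; rintro rfl; exact h rfl

lemma supp_add {n s : ℕ} {r : Fin s → ℕ} {J : Fin s → Fin (n+1)} {j} {x y : FDBlock s r}
    (hx : x ∈ blockSupp J j) (hy : y ∈ blockSupp J j) : x + y ∈ blockSupp J j :=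
  fun i h => by rw [Pi.add_apply, hx i h, hy i h, add_zero]
lemma supp_sub {n s : ℕ} {r : Fin s → ℕ} {J : Fin s → Fin (n+1)} {j} {x y : FDBlock s r}
    (hx : x ∈ blockSupp J j) (hy : y ∈ blockSupp J j) : x - y ∈ blockSupp J j :=
  fun i h => by rw [Pi.sub_apply, hx i h, hy i h, sub_zero]

section rel
variable {n s : ℕ} {r : Fin s → ℕ} {J : Fin s → Fin (n+1)} {φ : FDBlock s r →ₗ[ℂ] D}
  (hcp : IsCompletelyPositive φ) (hoz : ∀ j, OrderZeroOn φ (blockSupp J j))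
include hcp hoz

lemma oz_ne (i : Fin s) (k l p m : Fin (r i)) (h : l ≠ k) : φ (Em i p l) * φ (Em i k m) = 0 := by
  have := cp_orth hcp (p := Em i l l) (q := Em i k k) (by rw [Em_star, Em_mul]) (by rw [Em_star, Em_mul])
    ((hoz (J i) _ (Em_supp J i l l) _ (Em_supp J i k k) (Em_mul_ne _ _ _ _ _ h) (Em_mul_ne _ _ _ _ _ h.symm)).1)
    (Em i p l) (Em i k m)
  rwa [Em_mul, Em_mul] at this

lemma oz_block (i i' : Fin s) (hJ : J i = J i') (h : i ≠ i') (p l k m) :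
    φ (Em i p l) * φ (Em i' k m) = 0 := by
  have := (hoz (J i) _ (Em_supp J i l l) _ (hJ ▸ Em_supp J i' k k) (Em_mul_block _ _ h _ _ _ _)
      (Em_mul_block _ _ h.symm _ _ _ _)).1
  have := cp_orth hcp (p := Em i l l) (q := Em i' k k) (by rw [Em_star, Em_mul]) (by rw [Em_star, Em_mul])
    this (Em i p l) (Em i' k m)
  rwa [Em_mul, Em_mul] at this

lemma oz_r4 (i : Fin s) (k l m : Fin (r i)) (hm : m ≠ k) (hl : l ≠ k) :
    φ (Em i k m) * φ (Em i m l) = φ (Em i k k) * φ (Em i k l) := by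
  have h := (hoz (J i) (Em i k m - Em i k k) (supp_sub (Em_supp J i _ _) (Em_supp J i _ _))
    (Em i m l + Em i k l) (supp_add (Em_supp J i _ _) (Em_supp J i _ _)) (by
      rw [sub_mul, mul_add, mul_add, Em_mul, Em_mul, Em_mul_ne _ _ _ _ _ hm, Em_mul_ne _ _ _ _ _ hm.symm]
      simp) (by
      rw [mul_sub, add_mul, add_mul, Em_mul_ne _ _ _ _ _ hl, Em_mul_ne _ _ _ _ _ hl,
        Em_mul_ne _ _ _ _ _ hl, Em_mul_ne _ _ _ _ _ hl]; simp)).1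
  rw [map_sub, map_add, sub_mul, mul_add, mul_add, oz_ne hcp hoz i k m k l hm, oz_ne hcp hoz i m k k l hm.symm,
    add_zero, zero_add] at h
  exact sub_eq_zero.1 h

lemma oz_r2 (i : Fin s) (k l : Fin (r i)) :
    φ (Em i k l) * φ (Em i l k) = φ (Em i k k) * φ (Em i k k) := by
  by_cases hkl : l = k
  · subst hkl; rfl
  have z := fun p m => oz_ne hcp hoz i k l p m hkl
  have z' := fun p m => oz_ne hcp hoz i l k p m (Ne.symm hkl)
  have h1 := oz_r4 hcp hoz i k l l hkl hkl
  have h2 := oz_r4 hcp hoz i l k k (Ne.symm hkl) (Ne.symm hkl)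
  have h := (hoz (J i) (Em i k k + Em i k l + (Em i l k + Em i l l))
    (supp_add (supp_add (Em_supp J i _ _) (Em_supp J i _ _)) (supp_add (Em_supp J i _ _) (Em_supp J i _ _)))
    (Em i k k - Em i k l + (Em i l l - Em i l k))
    (supp_add (supp_sub (Em_supp J i _ _) (Em_supp J i _ _)) (supp_sub (Em_supp J i _ _) (Em_supp J i _ _)))
    (by
      simp only [add_mul, mul_add, mul_sub, Em_mul, Em_mul_ne _ _ _ _ _ hkl, Em_mul_ne _ _ _ _ _ (Ne.symm hkl)]
      abel)
    (by
      simp only [mul_add, add_mul, sub_mul, Em_mul, Em_mul_ne _ _ _ _ _ hkl, Em_mul_ne _ _ _ _ _ (Ne.symm hkl)]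
      abel)).1
  have sa : star (φ (Em i k k)) = φ (Em i k k) := by rw [← cp_star hcp, Em_star]
  have sb : star (φ (Em i k l)) = φ (Em i l k) := by rw [← cp_star hcp, Em_star]
  have sc : star (φ (Em i l k)) = φ (Em i k l) := by rw [← cp_star hcp, Em_star]
  simp only [map_add, map_sub] at h
  have zac := z' k k
  have zad := z' k l
  have zba := z k k
  have zbb := z k l
  have zcc := z' l k
  have zcd := z' l l
  have zda := z l k
  have zdb := z l l
  generalize φ (Em i k k) = a at *
  generalize φ (Em i k l) = b at *
  generalize φ (Em i l k) = c at *
  generalize φ (Em i l l) = d at *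
  simp only [add_mul, mul_add, mul_sub, zac, zad, zba, zbb, zcc, zcd, zda, zdb, h1, h2] at h
  have hX : a * a - b * c = c * b - d * d := by
    rw [← sub_eq_zero, ← h]; abel
  have hs : star (a * a - b * c) = a * a - b * c := by
    rw [star_sub, star_mul, star_mul, sa, sb, sc]
  have h0 : star (a * a - b * c) * (a * a - b * c) = 0 := by
    rw [hs]
    nth_rewrite 2 [hX]
    have : (a * a - b * c) * (c * b - d * d) = a * (a * c) * b - a * (a * d) * d - b * (c * c) * b + b * (c * d) * d := by
      noncomm_ring
    rw [this, zac, zad, zcc, zcd]; simp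
  exact (sub_eq_zero.1 ((CStarRing.star_mul_self_eq_zero_iff _).1 h0)).symm

lemma oz_r4' (i : Fin s) (k l m : Fin (r i)) :
    φ (Em i k m) * φ (Em i m l) = φ (Em i k k) * φ (Em i k l) := by
  by_cases hl : l = k
  · subst hl; exact oz_r2 hcp hoz i l m
  by_cases hm : m = k
  · subst hm; rfl
  exact oz_r4 hcp hoz i k l m hm hl
end rel
end blk
end DRank

namespace DRank
section mkV
variable {D : Type*} [CStarAlgebra D] [PartialOrder D] [StarOrderedRing D]

lemma inv_sqrt (a : D) (ha : 0 ≤ a) (t : ℝ) (ht : 0 < t) : ∃ g : D, star g = g ∧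
    (a + algebraMap ℝ D t) * (g * g) = 1 ∧ (g * g) * (a + algebraMap ℝ D t) = 1 ∧ ‖(g * g) * a‖ ≤ 1 := by
  have hsa : IsSelfAdjoint a := ha.isSelfAdjoint
  have hsp : ∀ x ∈ spectrum ℝ a, 0 ≤ x := fun x hx => spectrum_nonneg_of_nonneg ha hx
  have hc : ContinuousOn (fun x : ℝ => (Real.sqrt (x + t))⁻¹) (spectrum ℝ a) := by
    apply ContinuousOn.inv₀ (by fun_prop)
    intro x hx
    have := hsp x hx
    positivity
  have h1 : cfc (fun x : ℝ => (Real.sqrt (x + t))⁻¹) a * cfc (fun x : ℝ => (Real.sqrt (x + t))⁻¹) a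
      = cfc (fun x : ℝ => (x + t)⁻¹) a := by
    rw [← cfc_mul _ _ a hc hc]
    apply cfc_congr
    intro x hx
    have := hsp x hx
    simp only
    rw [← mul_inv, Real.mul_self_sqrt (by linarith)]
  have hc2 : ContinuousOn (fun x : ℝ => (x + t)⁻¹) (spectrum ℝ a) := by
    apply ContinuousOn.inv₀ (by fun_prop)
    intro x hx
    have := hsp x hx
    positivity
  have h2 : a + algebraMap ℝ D t = cfc (fun x : ℝ => x + t) a := by
    rw [cfc_add_const t (fun x => x) a (by fun_prop) hsa, cfc_id' ℝ a]
  refine ⟨cfc (fun x : ℝ => (Real.sqrt (x + t))⁻¹) a, ?_, ?_, ?_, ?_⟩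
  · exact star_cfc _ a
  · rw [h1, h2, ← cfc_mul _ _ a (by fun_prop) hc2, ← cfc_one ℝ a hsa]
    apply cfc_congr
    intro x hx
    have := hsp x hx
    simp only [Pi.one_apply]
    rw [mul_inv_cancel₀ (by positivity)]
  · rw [h1, h2, ← cfc_mul _ _ a hc2 (by fun_prop), ← cfc_one ℝ a hsa]
    apply cfc_congr
    intro x hx
    have := hsp x hx
    simp only [Pi.one_apply]
    rw [inv_mul_cancel₀ (by positivity)]
  · rw [h1]
    nth_rewrite 2 [← cfc_id' ℝ a]
    rw [← cfc_mul _ _ a hc2 (by fun_prop)]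
    apply norm_cfc_le zero_le_one
    intro x hx
    have := hsp x hx
    rw [Real.norm_of_nonneg (by positivity), ← div_eq_inv_mul, div_le_one (by positivity)]
    linarith

lemma Phi_Em {s : ℕ} {r : Fin s → ℕ} (V : Sg r → D) (i : Fin s) (k l : Fin (r i)) :
    Phi V (Em i k l) = V ⟨i, k⟩ * star (V ⟨i, l⟩) := by
  apply cor_inj (N := Sg r)
  rw [cor_Phi, row_mul_scal, row_mul_star_row]
  congr 1
  have h0 : ∀ (q q' : Sg r), bd (Em i k l) q q' = if q = ⟨i, k⟩ ∧ q' = ⟨i, l⟩ then 1 else 0 := by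
    rintro ⟨i1, k1⟩ ⟨i2, k2⟩
    by_cases h : i1 = i2
    · subst h
      rw [bd_apply]
      by_cases h : i1 = i
      · subst h
        simp [Em, Matrix.single_apply, eq_comm]
      · simp [Em, Pi.single_eq_of_ne h, h]
    · rw [bd_apply_ne _ _ _ h, if_neg]
      rintro ⟨h1, h2⟩
      exact h ((congrArg Sigma.fst h1).trans (congrArg Sigma.fst h2).symm)
  rw [Finset.sum_eq_single ⟨i, l⟩, Finset.sum_eq_single ⟨i, k⟩]
  · rw [h0]; simp
  · intro q _ hq; rw [h0, if_neg (by simp [hq]), zero_smul]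
  · simp
  · intro q _ hq
    rw [Finset.sum_eq_zero, zero_mul]
    intro q' _; rw [h0, if_neg (by simp [hq]), zero_smul]
  · simp

lemma entry_le {s : ℕ} {r : Fin s → ℕ} (y : FDBlock s r) (i : Fin s) (k l : Fin (r i)) :
    ‖y i k l‖ ≤ ‖y‖ := by
  refine le_trans ?_ (norm_le_pi_norm y i)
  have h := Matrix.l2_opNorm_mulVec (y i) (EuclideanSpace.single l (1:ℂ))
  rw [EuclideanSpace.norm_single, norm_one, mul_one] at h
  refine le_trans ?_ h
  refine le_trans ?_ (PiLp.norm_apply_le _ k)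
  simp

set_option maxHeartbeats 1000000 in
lemma mkV_t {n s : ℕ} {r : Fin s → ℕ} {J : Fin s → Fin (n+1)} {φ : FDBlock s r →ₗ[ℂ] D}
    (hcp : IsCompletelyPositive φ) (hoz : ∀ j, OrderZeroOn φ (blockSupp J j)) (t : ℝ) (ht : 0 < t) :
    ∃ (V : Sg r → D) (c : Fin s → D), Exr Sigma.fst J V c ∧
      ∀ i k l, ‖V ⟨i, k⟩ * star (V ⟨i, l⟩) - φ (Em i k l)‖ ≤ t := by
  have hst : ∀ i (k l : Fin (r i)), star (φ (Em i k l)) = φ (Em i l k) := fun i k l => by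
    rw [← cp_star hcp, Em_star]
  have hpos : ∀ i (k : Fin (r i)), 0 ≤ φ (Em i k k) := fun i k => by
    have := cp_nonneg hcp (Em i k k)
    rwa [Em_star, Em_mul] at this
  choose g hg1 hg2 hg3 hg4 using fun (q : Sg r) => inv_sqrt (φ (Em q.1 q.2 q.2)) (hpos q.1 q.2) t ht
  let o : ∀ q : Sg r, Sg r := fun q => ⟨q.1, ⟨0, q.2.pos⟩⟩
  let V : Sg r → D := fun q => φ (Em q.1 q.2 (o q).2) * g (o q)
  let c : Fin s → D := fun i => if h : 0 < r i then
    g ⟨i, ⟨0, h⟩⟩ * (φ (Em i ⟨0, h⟩ ⟨0, h⟩) * φ (Em i ⟨0, h⟩ ⟨0, h⟩)) * g ⟨i, ⟨0, h⟩⟩ else 0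
  refine ⟨V, c, ?_, ?_⟩
  · rintro ⟨i, k⟩ ⟨i', k'⟩ hJ
    have e1 : ∀ i k, star (V ⟨i, k⟩) = g (o ⟨i, k⟩) * φ (Em i (o ⟨i, k⟩).2 k) := fun i k => by
      simp only [V]; rw [star_mul, hg1, hst]
    rw [e1]
    simp only [V]
    by_cases hi : i = i'
    · subst hi
      by_cases hk : k = k'
      · subst hk
        rw [if_pos rfl]
        simp only [c]
        rw [dif_pos k.pos, ← mul_assoc, mul_assoc (g _) (φ _) (φ _), oz_r2 hcp hoz]
      · rw [if_neg (by simpa using hk), ← mul_assoc, mul_assoc (g _) (φ _) (φ _),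
          oz_ne hcp hoz i k' k _ _ hk, mul_zero, zero_mul]
    · rw [if_neg (by rintro h; exact hi (congrArg Sigma.fst h)), ← mul_assoc, mul_assoc (g _) (φ _) (φ _),
          oz_block hcp hoz i i' hJ hi, mul_zero, zero_mul]
  · intro i k l
    set z : Fin (r i) := ⟨0, k.pos⟩ with hz
    have e1 : V ⟨i, k⟩ = φ (Em i k z) * g ⟨i, z⟩ := rfl
    have e2 : V ⟨i, l⟩ = φ (Em i l z) * g ⟨i, z⟩ := rfl
    rw [e1, e2, star_mul, hg1, hst]
    have hG2 := hg2 ⟨i, z⟩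
    have hG3 := hg3 ⟨i, k⟩
    have hG4 := hg4 ⟨i, k⟩
    have hs := hg1 ⟨i, k⟩
    simp only at hG2 hG3 hG4
    have r1 := oz_r4' hcp hoz i k z z
    have r2 := oz_r4' hcp hoz i k l z
    have r3 := oz_r2 hcp hoz i k l
    have r4 := hst i k l
    have r5 := hst i k k
    generalize φ (Em i k z) = a at *
    generalize φ (Em i z l) = b at *
    generalize φ (Em i k l) = f at *
    generalize φ (Em i z z) = fz at *
    generalize φ (Em i k k) = fk at *
    generalize g ⟨i, z⟩ = gz at *
    generalize g ⟨i, k⟩ = gk at *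
    generalize φ (Em i l k) = f' at *
    have hcomm : (fk + algebraMap ℝ D t) * a = a * (fz + algebraMap ℝ D t) := by
      rw [add_mul, mul_add, ← r1, Algebra.commutes]
    have h1 : (fk + algebraMap ℝ D t) * (a * gz * (gz * b) - f) = - (algebraMap ℝ D t * f) := by
      calc _ = ((fk + algebraMap ℝ D t) * a) * (gz * gz) * b - (fk + algebraMap ℝ D t) * f := by
            noncomm_ring
        _ = a * ((fz + algebraMap ℝ D t) * (gz * gz)) * b - (fk + algebraMap ℝ D t) * f := by
            rw [hcomm, mul_assoc a]
        _ = _ := by rw [hG2, mul_one, r2, add_mul]; abel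
    have h2 : a * gz * (gz * b) - f = - ((gk * gk) * (algebraMap ℝ D t * f)) := by
      rw [← mul_neg, ← h1, ← mul_assoc (gk * gk), hG3, one_mul]
    rw [h2, norm_neg, Algebra.left_comm, ← Algebra.smul_def, norm_smul, Real.norm_of_nonneg ht.le]
    have h3 : ‖gk * gk * f‖ ≤ 1 := by
      apply norm_le_of_sq' zero_le_one
      have : gk * gk * f * star (gk * gk * f) = (gk * gk * fk) * star (gk * gk * fk) := by
        simp only [star_mul, hs, r4, r5]
        calc _ = gk * gk * (f * f') * (gk * gk) := by simp only [mul_assoc]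
          _ = _ := by rw [r3]; simp only [mul_assoc]
      rw [this, one_pow]
      refine (norm_mul_le _ _).trans ?_
      rw [norm_star]
      exact mul_le_one₀ hG4 (norm_nonneg _) hG4
    calc t * _ ≤ t * 1 := mul_le_mul_of_nonneg_left h3 ht.le
      _ = t := mul_one t

lemma mkV {n s : ℕ} {r : Fin s → ℕ} {J : Fin s → Fin (n+1)} {φ : FDBlock s r →ₗ[ℂ] D}
    (hcp : IsCompletelyPositive φ) (hoz : ∀ j, OrderZeroOn φ (blockSupp J j)) (η : ℝ) (hη : 0 < η) :
    ∃ (V : Sg r → D) (c : Fin s → D), Exr Sigma.fst J V c ∧ ∀ y, ‖Phi V y - φ y‖ ≤ η * ‖y‖ := by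
  obtain ⟨M, hM⟩ : ∃ M : ℝ, M = ∑ i, (r i : ℝ) * (r i : ℝ) := ⟨_, rfl⟩
  have hM0 : 0 ≤ M := by rw [hM]; positivity
  obtain ⟨V, c, hX, hV⟩ := mkV_t hcp hoz (η / (M + 1)) (by positivity)
  refine ⟨V, c, hX, fun y => ?_⟩
  have e : Phi V y - φ y = ∑ i, ∑ k, ∑ l, y i k l • (V ⟨i, k⟩ * star (V ⟨i, l⟩) - φ (Em i k l)) := by
    have e1 : ∀ f : FDBlock s r →ₗ[ℂ] D, f y = ∑ i, ∑ k, ∑ l, y i k l • f (Em i k l) := by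
      intro f
      conv_lhs => rw [Em_sum y]
      rw [map_sum]; refine Finset.sum_congr rfl fun i _ => ?_
      rw [map_sum]; refine Finset.sum_congr rfl fun k _ => ?_
      rw [map_sum]; refine Finset.sum_congr rfl fun l _ => ?_
      rw [map_smul]
    rw [e1 (Phi V), e1 φ]
    rw [← Finset.sum_sub_distrib]; refine Finset.sum_congr rfl fun i _ => ?_
    rw [← Finset.sum_sub_distrib]; refine Finset.sum_congr rfl fun k _ => ?_
    rw [← Finset.sum_sub_distrib]; refine Finset.sum_congr rfl fun l _ => ?_
    rw [Phi_Em, smul_sub]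
  rw [e]
  calc _ ≤ ∑ i, ∑ k : Fin (r i), ∑ l : Fin (r i), ‖y‖ * (η / (M + 1)) * 1 := by
        refine (norm_sum_le _ _).trans (Finset.sum_le_sum fun i _ => ?_)
        refine (norm_sum_le _ _).trans (Finset.sum_le_sum fun k _ => ?_)
        refine (norm_sum_le _ _).trans (Finset.sum_le_sum fun l _ => ?_)
        rw [norm_smul, mul_one]
        exact mul_le_mul (entry_le y i k l) (hV i k l) (norm_nonneg _) (norm_nonneg _)
    _ = ‖y‖ * (η / (M + 1)) * M := by
        rw [hM, Finset.mul_sum]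
        refine Finset.sum_congr rfl fun i _ => ?_
        rw [Finset.sum_const, Finset.sum_const, Finset.card_univ, Fintype.card_fin, nsmul_eq_mul, nsmul_eq_mul]
        ring
    _ = η * ‖y‖ * (M / (M + 1)) := by ring
    _ ≤ η * ‖y‖ * 1 := by
        gcongr
        rw [div_le_one (by positivity)]; linarith
    _ = _ := mul_one _
end mkV
end DRank

namespace DRank
section cpB
variable {F D : Type*} [CStarAlgebra F] [PartialOrder F] [StarOrderedRing F]
  [CStarAlgebra D] [PartialOrder D] [StarOrderedRing D]

lemma cp_nonneg' {φ : F →ₗ[ℂ] D} (h : IsCompletelyPositive φ) {u : F} (hu : 0 ≤ u) : 0 ≤ φ u := by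
  obtain ⟨y, rfl⟩ := posElem_of_nonneg hu
  exact cp_nonneg h y

lemma cp_one {φ : F →ₗ[ℂ] D} (h : IsCompletelyPositive φ) (hc : ∀ a, ‖φ a‖ ≤ ‖a‖) : 0 ≤ 1 - φ 1 := by
  have h0 : 0 ≤ φ 1 := cp_nonneg' h zero_le_one
  rw [sub_nonneg]
  exact (CStarAlgebra.norm_le_one_iff_of_nonneg _ h0).1 ((hc 1).trans (norm_one_le F))

lemma cp_ks {φ : F →ₗ[ℂ] D} (h : IsCompletelyPositive φ) (hc : ∀ a, ‖φ a‖ ≤ ‖a‖) (a : F) :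
    0 ≤ φ (a * star a) - φ a * star (φ a) := by
  obtain ⟨y, z, h1, h2, h3, h4⟩ := cp2 h 1 (star a)
  rw [star_one, one_mul] at h1 h2
  rw [mul_one, star_star] at h3
  rw [star_star] at h4
  have hw : star (φ a) = φ (star a) := (cp_star h a).symm
  have e : φ (a * star a) - φ a * star (φ a) =
      ∑ m, star (z m - y m * star (φ a)) * (z m - y m * star (φ a)) + star (star (φ a)) * (1 - φ 1) * star (φ a) := by
    have e1 : ∑ m, star (z m - y m * star (φ a)) * (z m - y m * star (φ a)) =
        ∑ m, star (z m) * z m - (∑ m, star (z m) * y m) * star (φ a) - φ a * (∑ m, star (y m) * z m)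
          + φ a * (∑ m, star (y m) * y m) * star (φ a) := by
      rw [Finset.sum_mul, Finset.mul_sum, Finset.mul_sum, Finset.sum_mul, ← Finset.sum_sub_distrib,
        ← Finset.sum_sub_distrib, ← Finset.sum_add_distrib]
      refine Finset.sum_congr rfl fun m _ => ?_
      rw [star_sub, star_mul, star_star]
      noncomm_ring
    rw [e1, ← h1, ← h2, ← h3, ← h4, ← hw, star_star]
    noncomm_ring
  rw [e]
  exact add_nonneg (Finset.sum_nonneg fun m _ => star_mul_self_nonneg _)
    (star_left_conjugate_nonneg (cp_one h hc) _)
end cpB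

section L1
def Ex0 (n : ℕ) (D : Type*) [CStarAlgebra D] [PartialOrder D] [StarOrderedRing D] : Prop :=
  ∀ (S : Finset D) (ε : ℝ), 0 < ε → ∃ (s : ℕ) (r : Fin s → ℕ) (J : Fin s → Fin (n+1)) (V : Sg r → D)
    (c : Fin s → D) (x : D → FDBlock s r), Exr Sigma.fst J V c ∧ (∀ a, ‖x a‖ ≤ ‖a‖) ∧
    (∀ a, x (star a) = star (x a)) ∧
    ‖∑ q, V q * star (V q) - 1‖ ≤ ε ∧ ∀ a ∈ S, ‖(row (err a (bd (x a)) V) : MM (Sg r) D)‖ ≤ ε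

variable {D : Type*} [CStarAlgebra D] [PartialOrder D] [StarOrderedRing D]

lemma Phi_one {s : ℕ} {r : Fin s → ℕ} (V : Sg r → D) :
    Phi V 1 = ∑ q, V q * star (V q) := by
  apply cor_inj (N := Sg r)
  rw [cor_Phi, row_mul_scal, row_mul_star_row]
  congr 1
  refine Finset.sum_congr rfl fun q _ => ?_
  have : (bd (1 : FDBlock s r)) = 1 := Matrix.blockDiagonal'_one
  rw [this, Finset.sum_eq_single q]
  · simp
  · intro q' _ h; rw [Matrix.one_apply_ne h, zero_smul]
  · simp

set_option maxHeartbeats 1000000 in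
theorem ex0_of_dr {n : ℕ} (h : DecompositionRankLE n D) : Ex0 n D := by
  classical
  intro S ε hε
  set B : ℝ := 1 + ∑ a ∈ S, ‖a‖ with hB
  have hB1 : 1 ≤ B := by
    have : 0 ≤ ∑ a ∈ S, ‖a‖ := Finset.sum_nonneg fun _ _ => norm_nonneg _
    linarith
  obtain ⟨η, hη, hη1, hη2⟩ : ∃ η : ℝ, 0 < η ∧ 2 * η ≤ ε ∧ η * (8 * B ^ 2) ≤ ε ^ 2 := by
    refine ⟨min (ε / 2) (ε ^ 2 / (8 * B ^ 2)), lt_min (by positivity) (by positivity), ?_, ?_⟩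
    · have := min_le_left (ε / 2) (ε ^ 2 / (8 * B ^ 2)); linarith
    · have := min_le_right (ε / 2) (ε ^ 2 / (8 * B ^ 2))
      calc _ ≤ (ε ^ 2 / (8 * B ^ 2)) * (8 * B ^ 2) := by gcongr
        _ = _ := by field_simp
  obtain ⟨s, r, J, ψ, φ, hψ, hφ, hψ1, hφ1, hoz, happ⟩ :=
    h (insert 1 (S ∪ S.image (fun a => a * star a))) η hη
  obtain ⟨V, c, hX, hV⟩ := mkV hφ hoz η hη
  letI : PartialOrder (FDBlock s r) := CStarAlgebra.spectralOrder (FDBlock s r)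
  haveI : StarOrderedRing (FDBlock s r) := CStarAlgebra.spectralOrderedRing (FDBlock s r)
  have hone : ‖Phi V 1 - 1‖ ≤ 2 * η := by
    have h1 : ‖Phi V 1 - φ 1‖ ≤ η := (hV 1).trans (by
      have := norm_one_le (FDBlock s r)
      calc η * ‖(1 : FDBlock s r)‖ ≤ η * 1 := mul_le_mul_of_nonneg_left this hη.le
        _ = η := mul_one η)
    have h2 : ‖1 - φ 1‖ ≤ ‖1 - φ (ψ 1)‖ := by
      refine CStarAlgebra.norm_le_norm_of_nonneg_of_le (cp_one hφ hφ1) ?_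
      rw [sub_le_sub_iff_left, ← sub_nonneg, ← map_sub]
      exact cp_nonneg' hφ (cp_one hψ hψ1)
    have h3 := happ 1 (Finset.mem_insert_self _ _)
    rw [norm_sub_rev] at h2 h3
    have : Phi V 1 - 1 = (Phi V 1 - φ 1) + (φ 1 - 1) := by abel
    rw [this]
    refine (norm_add_le _ _).trans ?_
    linarith
  refine ⟨s, r, J, V, c, ψ, hX, hψ1, cp_star hψ, ?_, ?_⟩
  · rw [← Phi_one]; linarith
  · intro a ha
    have haB : ‖a‖ ≤ B := by
      have := Finset.single_le_sum (f := fun a => ‖a‖) (fun _ _ => norm_nonneg _) ha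
      linarith
    have h1 : ‖φ (ψ a) - a‖ ≤ η :=
      (happ a (Finset.mem_insert_of_mem (Finset.mem_union_left _ ha))).le
    have h2 : ‖φ (ψ (a * star a)) - a * star a‖ ≤ η :=
      (happ _ (Finset.mem_insert_of_mem (Finset.mem_union_right _ (Finset.mem_image_of_mem _ ha)))).le
    have hx : ‖ψ a‖ ≤ B := (hψ1 a).trans haB
    have h3 : ‖Phi V (ψ a) - a‖ ≤ 2 * η * B := by
      have e : Phi V (ψ a) - a = (Phi V (ψ a) - φ (ψ a)) + (φ (ψ a) - a) := by abel
      rw [e]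
      refine (norm_add_le _ _).trans ?_
      have := (hV (ψ a)).trans (mul_le_mul_of_nonneg_left hx hη.le)
      have : η * 1 ≤ η * B := mul_le_mul_of_nonneg_left hB1 hη.le
      linarith
    have hPs : ∀ y, Phi V (star y) = star (Phi V y) := by
      intro y
      apply cor_inj (N := Sg r)
      rw [map_star cor, cor_Phi, cor_Phi, star_mul, star_mul, star_star, map_star bd, map_star scal, mul_assoc]
    have h4 : ‖Phi V (ψ a * star (ψ a)) - φ (ψ a * star (ψ a))‖ ≤ η * B ^ 2 := by
      refine (hV _).trans (mul_le_mul_of_nonneg_left ?_ hη.le)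
      refine (norm_mul_le _ _).trans ?_
      rw [norm_star, pow_two]
      exact mul_le_mul hx hx (norm_nonneg _) (by linarith)
    have h5 : 0 ≤ φ (ψ (a * star a)) - φ (ψ a * star (ψ a)) := by
      rw [← map_sub]; exact cp_nonneg' hφ (cp_ks hψ hψ1 a)
    apply norm_le_of_sq' hε.le
    set T : MM (Sg r) D := row (err a (bd (ψ a)) V) with hT
    have e1 : T * star T = cor (a * Phi V 1 * star a - a * star (Phi V (ψ a)) - Phi V (ψ a) * star a
        + Phi V (ψ a * star (ψ a))) := by
      rw [map_add, map_sub, map_sub, map_mul, map_mul, map_mul, map_mul, map_star, map_star, cor_Phi, cor_Phi, cor_Phi, hT, row_err]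
      have : (scal (bd (1 : FDBlock s r)) : MM (Sg r) D) * star (row V) = star (row V) := by
        have h1 : (row V * scal (bd (1 : FDBlock s r)) : MM (Sg r) D) = row V := by
          rw [row_mul_scal]
          congr 1
          funext q
          have : (bd (1 : FDBlock s r)) = 1 := Matrix.blockDiagonal'_one
          rw [this, Finset.sum_eq_single q]
          · simp
          · intro q' _ h; rw [Matrix.one_apply_ne h, zero_smul]
          · simp
        have h2 := congrArg star h1
        rwa [star_mul, ← map_star scal, ← map_star bd, star_one] at h2
      rw [mul_assoc (row V) (scal (bd 1)), this, map_mul bd, map_mul scal, map_star bd, map_star scal]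
      simp only [star_sub, star_mul, star_star]
      noncomm_ring
    rw [e1, norm_cor]
    have hTp : 0 ≤ a * Phi V 1 * star a - a * star (Phi V (ψ a)) - Phi V (ψ a) * star a
        + Phi V (ψ a * star (ψ a)) := by
      have : ∀ d : D, 0 ≤ (cor d : MM (Sg r) D) → 0 ≤ d := fun d hd =>
        nonneg_of_map (cor : D →⋆ₙₐ[ℂ] MM (Sg r) D) (fun _ _ h => cor_inj h) d hd
      apply this
      rw [← e1]; exact mul_star_self_nonneg _
    refine le_trans (CStarAlgebra.norm_le_norm_of_nonneg_of_le hTp (le_add_of_nonneg_right h5)) ?_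
    have e2 : a * Phi V 1 * star a - a * star (Phi V (ψ a)) - Phi V (ψ a) * star a
        + Phi V (ψ a * star (ψ a)) + (φ (ψ (a * star a)) - φ (ψ a * star (ψ a)))
        = a * (Phi V 1 - 1) * star a + (- (a * star (Phi V (ψ a) - a))) + (- ((Phi V (ψ a) - a) * star a))
        + (Phi V (ψ a * star (ψ a)) - φ (ψ a * star (ψ a))) + (φ (ψ (a * star a)) - a * star a) := by
      rw [star_sub]
      noncomm_ring
    rw [e2]
    have n1 : ‖a * (Phi V 1 - 1) * star a‖ ≤ B * (2 * η) * B := by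
      refine (norm_mul_le _ _).trans ?_
      rw [norm_star]
      refine mul_le_mul ((norm_mul_le _ _).trans ?_) haB (norm_nonneg _) (by positivity)
      exact mul_le_mul haB hone (norm_nonneg _) (by linarith)
    have n2 : ‖- (a * star (Phi V (ψ a) - a))‖ ≤ B * (2 * η * B) := by
      rw [norm_neg]
      refine (norm_mul_le _ _).trans ?_
      rw [norm_star]
      exact mul_le_mul haB h3 (norm_nonneg _) (by linarith)
    have n3 : ‖- ((Phi V (ψ a) - a) * star a)‖ ≤ (2 * η * B) * B := by
      rw [norm_neg]
      refine (norm_mul_le _ _).trans ?_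
      rw [norm_star]
      exact mul_le_mul h3 haB (norm_nonneg _) (by positivity)
    have n4 : η ≤ η * B ^ 2 := le_mul_of_one_le_right hη.le (one_le_pow₀ hB1)
    refine (norm_add_le _ _).trans ?_
    refine (add_le_add_left (norm_add_le _ _) _).trans ?_
    refine (add_le_add_left (add_le_add_left norm_add₃_le _) _).trans ?_
    refine le_trans ?_ hη2
    linarith
end L1
end DRank

namespace DRank
section exg
variable {R : Type*} [CStarAlgebra R] [PartialOrder R] [StarOrderedRing R]

def ExGood (n : ℕ) (R : Type*) [CStarAlgebra R] [PartialOrder R] [StarOrderedRing R] : Prop :=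
  ∀ S : Finset R, ∀ ε : ℝ, 0 < ε →
    ∃ (N I : Type) (_ : Fintype N) (_ : DecidableEq N) (_ : Fintype I) (_ : DecidableEq I)
      (b : N → I) (J : I → Fin (n+1)) (V : N → R) (c : I → R) (x : R → Matrix N N ℂ),
      (∀ a ∈ S, ∀ q r, b q ≠ b r → x a q r = 0) ∧ Exr b J V c ∧
      ‖∑ q, V q * star (V q) - 1‖ ≤ ε ∧ ∀ a ∈ S, ‖(row (err a (x a) V) : MM N R)‖ ≤ ε

lemma good_of_exGood {n : ℕ} (h : ExGood n R) : Good n R 1 := by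
  classical
  intro S _ ε hε
  obtain ⟨N, I, _, _, _, _, b, J, V, c, x, hx, hX, h1, h2⟩ := h S ε hε
  refine ⟨∑ a ∈ S, ‖x a‖, fun δ hδ => ?_⟩
  refine ⟨N, I, inferInstance, inferInstance, inferInstance, inferInstance, b, J, V,
    fun i => if ∃ q, b q = i then c i else 0, x, fun q => one_mul _, ?_, ?_, ?_, h1, h2⟩
  · intro i
    simp only
    split_ifs with hi
    · obtain ⟨q, rfl⟩ := hi
      have := hX q q rfl
      rw [if_pos rfl] at this
      rw [← this]; exact IsSelfAdjoint.star_mul_self _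
    · exact IsSelfAdjoint.zero _
  · intro a ha
    exact ⟨Finset.single_le_sum (f := fun a => ‖x a‖) (fun _ _ => norm_nonneg _) ha, hx a ha⟩
  · intro j
    have hX' : Exr b J V (fun i => if ∃ q, b q = i then c i else 0) := by
      intro q r hqr
      have : (if ∃ q', b q' = b q then c (b q) else 0) = c (b q) := if_pos ⟨q, rfl⟩
      rw [hX q r hqr]
      simp only [this]
    rw [star_row_msk b J V _ hX' j, sub_self, norm_zero]
    exact hδ.le

theorem dr_of_exGood {n : ℕ} (h : ExGood n R) {D : Type*} [CStarAlgebra D]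
    (e : D ≃⋆ₐ[ℂ] R) : DecompositionRankLE n D := by
  let ι : D →⋆ₙₐ[ℂ] R := ((e : D →⋆ₐ[ℂ] R) : D →⋆ₙₐ[ℂ] R)
  have hι : ∀ d, ι d = e d := fun d => rfl
  refine dr_of_goodX (goodX_of_good (by simp) (by simp) (good_of_exGood h)) ι
    (fun a b hab => e.injective hab) ?_ ?_
  · rw [hι, map_one]
  · intro x _
    exact ⟨e.symm x, by rw [hι, StarAlgEquiv.apply_symm_apply]⟩

lemma exGood_of_ex0 {n : ℕ} (h : Ex0 n R) : ExGood n R := by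
  intro S ε hε
  obtain ⟨s, r, J, V, c, x, hX, h1, h2, h3, h4⟩ := h S ε hε
  exact ⟨Sg r, Fin s, inferInstance, inferInstance, inferInstance, inferInstance, Sigma.fst, J, V, c,
    fun a => bd (x a), fun a _ q q' hq => bd_apply_ne _ _ _ hq, hX, h3, h4⟩

theorem dr_iso {n : ℕ} {B D : Type*} [CStarAlgebra B] [CStarAlgebra D] (h : DecompositionRankLE n B)
    (e : D ≃⋆ₐ[ℂ] B) : DecompositionRankLE n D := by
  letI : PartialOrder B := CStarAlgebra.spectralOrder B
  haveI : StarOrderedRing B := CStarAlgebra.spectralOrderedRing B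
  exact dr_of_exGood (exGood_of_ex0 (ex0_of_dr h)) e

lemma norm_row_le_iff {N : Type*} [Fintype N] [DecidableEq N] (w : N → R) {ε : ℝ} (hε : 0 ≤ ε) :
    ‖(row w : MM N R)‖ ≤ ε ↔ ‖∑ q, w q * star (w q)‖ ≤ ε ^ 2 := by
  rw [← norm_row_sq, pow_le_pow_iff_left₀ (norm_nonneg _) hε two_ne_zero]

set_option maxHeartbeats 1000000 in
theorem dr_prod {n : ℕ} {B C D : Type*} [CStarAlgebra B] [CStarAlgebra C] [CStarAlgebra D]
    (hB : DecompositionRankLE n B) (hC : DecompositionRankLE n C)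
    (e : D ≃⋆ₐ[ℂ] (B × C)) : DecompositionRankLE n D := by
  classical
  letI : PartialOrder B := CStarAlgebra.spectralOrder B
  haveI : StarOrderedRing B := CStarAlgebra.spectralOrderedRing B
  letI : PartialOrder C := CStarAlgebra.spectralOrder C
  haveI : StarOrderedRing C := CStarAlgebra.spectralOrderedRing C
  letI oBC : PartialOrder (B × C) := CStarAlgebra.spectralOrder (B × C)
  haveI sBC : StarOrderedRing (B × C) := CStarAlgebra.spectralOrderedRing (B × C)
  refine dr_of_exGood (R := B × C) ?_ e
  intro S ε hε
  obtain ⟨s, r, J, V, c, x, hX, h1, h2, h3, h4⟩ := ex0_of_dr hB (S.image Prod.fst) ε hε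
  obtain ⟨s', r', J', V', c', x', hX', h1', h2', h3', h4'⟩ := ex0_of_dr hC (S.image Prod.snd) ε hε
  have hsum : ∀ (w : Sg r → B) (w' : Sg r' → C), ∑ q : Sg r ⊕ Sg r',
      (Sum.elim (fun q => ((w q, 0) : B × C)) (fun q => (0, w' q)) q) *
      star (Sum.elim (fun q => ((w q, 0) : B × C)) (fun q => (0, w' q)) q)
      = (∑ q, w q * star (w q), ∑ q, w' q * star (w' q)) := by
    intro w w'
    rw [Fintype.sum_sum_type]
    refine Prod.ext ?_ ?_
    · simp [Prod.fst_sum]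
    · simp [Prod.snd_sum]
  refine ⟨Sg r ⊕ Sg r', Fin s ⊕ Fin s', inferInstance, inferInstance, inferInstance, inferInstance,
    Sum.map Sigma.fst Sigma.fst, Sum.elim J J', Sum.elim (fun q => (V q, 0)) (fun q => (0, V' q)),
    Sum.elim (fun i => (c i, 0)) (fun i => (0, c' i)),
    fun a => Matrix.fromBlocks (bd (x a.1)) 0 0 (bd (x' a.2)), ?_, ?_, ?_, ?_⟩
  · rintro a - (q | q) (q' | q') hq
    · exact bd_apply_ne _ _ _ (fun h => hq (by simpa using h))
    · rfl
    · rfl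
    · exact bd_apply_ne _ _ _ (fun h => hq (by simpa using h))
  · rintro (q | q) (q' | q') hq
    · have := hX q q' hq
      simp only [Sum.elim_inl, Sum.map_inl]
      refine Prod.ext ?_ ?_
      · by_cases h : q = q'
        · subst h; simpa using this
        · simp [this, h]
      · by_cases h : q = q' <;> simp [h]
    · refine Prod.ext ?_ ?_ <;> simp
    · refine Prod.ext ?_ ?_ <;> simp
    · have := hX' q q' hq
      simp only [Sum.elim_inr, Sum.map_inr]
      refine Prod.ext ?_ ?_
      · by_cases h : q = q' <;> simp [h]
      · by_cases h : q = q'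
        · subst h; simpa using this
        · simp [this, h]
  · rw [hsum]
    exact norm_prod_le_iff.2 ⟨h3, h3'⟩
  · intro a ha
    have e1 : err a (Matrix.fromBlocks (bd (x a.1)) 0 0 (bd (x' a.2)))
        (Sum.elim (fun q => ((V q, 0) : B × C)) (fun q => (0, V' q)))
        = Sum.elim (fun q => (err a.1 (bd (x a.1)) V q, 0)) (fun q => (0, err a.2 (bd (x' a.2)) V' q)) := by
      funext q
      rcases q with q | q
      · refine Prod.ext ?_ ?_ <;> simp [err, Prod.fst_sum, Prod.snd_sum]
      · refine Prod.ext ?_ ?_ <;> simp [err, Prod.fst_sum, Prod.snd_sum]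
    rw [e1, norm_row_le_iff _ hε.le, hsum]
    refine norm_prod_le_iff.2 ⟨?_, ?_⟩
    · exact (norm_row_le_iff _ hε.le).1 (h4 _ (Finset.mem_image_of_mem _ ha))
    · exact (norm_row_le_iff _ hε.le).1 (h4' _ (Finset.mem_image_of_mem _ ha))
end exg
end DRank

namespace DRank
section mat
variable {B : Type*} [CStarAlgebra B] [PartialOrder B] [StarOrderedRing B] {k : ℕ}

abbrev MF (k : ℕ) (B : Type*) := CStarMatrix (Fin (k+1)) (Fin (k+1)) B

def inc (a b : Fin (k+1)) (y : B) : MF k B := CStarMatrix.ofMatrix (Matrix.single a b y)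

lemma inc_apply (a b i j : Fin (k+1)) (y : B) :
    (inc a b y : MF k B) i j = if a = i ∧ b = j then y else 0 := by
  simp [inc, CStarMatrix.ofMatrix_apply, Matrix.single_apply]

lemma inc_mul (a b c d : Fin (k+1)) (y z : B) :
    (inc a b y * inc c d z : MF k B) = if b = c then inc a d (y * z) else 0 := by
  ext i j
  rw [CStarMatrix.mul_apply]
  simp only [inc_apply]
  split_ifs with h
  · subst h
    rw [inc_apply, Finset.sum_eq_single b]
    · by_cases h1 : a = i <;> by_cases h2 : d = j <;> simp [h1, h2]
    · intro x _ hx; simp [hx.symm]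
    · simp
  · refine Finset.sum_eq_zero fun x _ => ?_
    by_cases h1 : b = x
    · subst h1; simp [Ne.symm h]
    · simp [h1]

lemma inc_star (a b : Fin (k+1)) (y : B) : star (inc a b y : MF k B) = inc b a (star y) := by
  ext i j
  rw [CStarMatrix.star_apply, inc_apply, inc_apply]
  by_cases h1 : a = j <;> by_cases h2 : b = i <;> simp [h1, h2]

def incL (a b : Fin (k+1)) : B →ₗ[ℂ] MF k B where
  toFun := inc a b
  map_add' x y := by
    ext i j; simp only [CStarMatrix.add_apply, inc_apply]; split_ifs <;> simp
  map_smul' c y := by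
    ext i j; simp only [CStarMatrix.smul_apply, inc_apply, RingHom.id_apply]; split_ifs <;> simp

lemma mf_sum_apply {K : Type*} (t : Finset K) (f : K → MF k B) (i j : Fin (k+1)) :
    (∑ a ∈ t, f a) i j = ∑ a ∈ t, f a i j := by
  classical
  induction t using Finset.induction_on with
  | empty => simp
  | insert a t ha ih => rw [Finset.sum_insert ha, Finset.sum_insert ha, CStarMatrix.add_apply, ih]

lemma mul_inc (A : MF k B) (a : Fin (k+1)) (y : B) :
    A * inc a 0 y = ∑ b, inc b 0 (A b a * y) := by
  ext i j
  rw [mf_sum_apply, CStarMatrix.mul_apply]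
  simp only [inc_apply]
  by_cases h : 0 = j
  · simp [h]
  · simp [h]

def incD : B →⋆ₙₐ[ℂ] MF k B where
  toFun y := ∑ a, inc a a y
  map_smul' c y := by
    rw [Finset.smul_sum]; exact Finset.sum_congr rfl fun a _ => map_smul (incL a a) c y
  map_zero' := Finset.sum_eq_zero fun a _ => map_zero (incL a a)
  map_add' x y := by
    rw [← Finset.sum_add_distrib]; exact Finset.sum_congr rfl fun a _ => map_add (incL a a) x y
  map_mul' x y := by
    rw [Finset.sum_mul_sum]
    refine Finset.sum_congr rfl fun a _ => ?_
    simp only [inc_mul]; simp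
  map_star' x := by
    rw [star_sum]; exact Finset.sum_congr rfl fun a _ => (inc_star a a x).symm

lemma incD_one : (incD (1 : B) : MF k B) = 1 := by
  ext i j
  change (∑ a, inc a a (1:B) : MF k B) i j = _
  rw [mf_sum_apply]
  simp only [inc_apply, CStarMatrix.one_apply]
  by_cases h : i = j
  · subst h; simp
  · rw [if_neg h]
    refine Finset.sum_eq_zero fun x _ => if_neg ?_
    rintro ⟨rfl, rfl⟩; exact h rfl

def incZ (b : Fin (k+1)) : B →⋆ₙₐ[ℂ] MF k B where
  toFun y := inc b b y
  map_smul' c y := map_smul (incL b b) c y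
  map_zero' := map_zero (incL b b)
  map_add' x y := map_add (incL b b) x y
  map_mul' x y := by simp [inc_mul]
  map_star' x := (inc_star _ _ x).symm

lemma norm_inc_le (b : Fin (k+1)) (y : B) : ‖(inc b b y : MF k B)‖ ≤ ‖y‖ :=
  NonUnitalStarAlgHom.norm_apply_le (incZ b : B →⋆ₙₐ[ℂ] MF k B) y

set_option maxHeartbeats 1000000 in
theorem exGood_mat {n : ℕ} (h : Ex0 n B) [PartialOrder (MF k B)] [StarOrderedRing (MF k B)] :
    ExGood n (MF k B) := by
  classical
  intro S ε hε
  have hk : (0:ℝ) < ((k:ℝ)+1) := by positivity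
  obtain ⟨s, r, J, V, c, x, hX, h1, h2, h3, h4⟩ := h
    (S.biUnion fun A => Finset.univ.image fun ab : Fin (k+1) × Fin (k+1) => A ab.1 ab.2)
    (min ε (ε / ((k+1)*(k+1)))) (by positivity)
  refine ⟨Sg r × Fin (k+1), Fin s, inferInstance, inferInstance, inferInstance, inferInstance,
    fun q => q.1.1, J, fun q => inc q.2 0 (V q.1), fun i => inc 0 0 (c i),
    fun A => Matrix.of fun q' q => bd (x (A q'.2 q.2)) q'.1 q.1, ?_, ?_, ?_, ?_⟩
  · intro a _ q q' hq
    exact bd_apply_ne _ _ _ hq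
  · rintro ⟨q, a⟩ ⟨q', a'⟩ hq
    have := hX q q' hq
    simp only [inc_star, inc_mul, this]
    by_cases h1 : a = a'
    · subst h1
      by_cases h2 : q = q'
      · subst h2; simp
      · simp [h2]; exact map_zero (incL 0 0)
    · simp [h1]
  · rw [Fintype.sum_prod_type]
    have : ∑ q, ∑ a, (inc a 0 (V q) * star (inc a 0 (V q)) : MF k B) = incD (∑ q, V q * star (V q)) := by
      rw [map_sum]
      refine Finset.sum_congr rfl fun q _ => Finset.sum_congr rfl fun a _ => ?_
      simp [inc_star, inc_mul]
    rw [this, ← incD_one, ← map_sub]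
    exact (NonUnitalStarAlgHom.norm_apply_le (incD : B →⋆ₙₐ[ℂ] MF k B) _).trans (h3.trans (min_le_left _ _))
  · intro A hA
    let W : Fin (k+1) → Fin (k+1) → Sg r × Fin (k+1) → MF k B := fun b0 a0 q =>
      if q.2 = a0 then inc b0 0 (err (A b0 a0) (bd (x (A b0 a0))) V q.1) else 0
    have hW : err A (Matrix.of fun q' q : Sg r × Fin (k+1) => bd (x (A q'.2 q.2)) q'.1 q.1)
        (fun q => inc q.2 0 (V q.1)) = ∑ b0, ∑ a0, W b0 a0 := by
      funext ⟨q, a⟩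
      rw [Finset.sum_apply]
      have : ∀ b0, (∑ a0, W b0 a0) (q, a) = inc b0 0 (err (A b0 a) (bd (x (A b0 a))) V q) := by
        intro b0
        rw [Finset.sum_apply]
        simp [W]
      simp only [this]
      unfold err
      rw [Fintype.sum_prod_type, Finset.sum_comm, mul_inc, ← Finset.sum_sub_distrib]
      refine Finset.sum_congr rfl fun b0 _ => ?_
      change _ = incL b0 0 _
      rw [map_sub, map_sum]
      simp only [map_smul]
      rfl
    rw [hW]
    have hb : ∀ b0 a0, ‖(row (W b0 a0) : MM _ (MF k B))‖ ≤ ε / ((k+1)*(k+1)) := by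
      intro b0 a0
      rw [norm_row_le_iff _ (by positivity), Fintype.sum_prod_type]
      have : ∑ q, ∑ a, W b0 a0 (q, a) * star (W b0 a0 (q, a)) =
          inc b0 b0 (∑ q, err (A b0 a0) (bd (x (A b0 a0))) V q * star (err (A b0 a0) (bd (x (A b0 a0))) V q)) := by
        refine Eq.trans ?_ (map_sum (incL b0 b0) _ _).symm
        refine Finset.sum_congr rfl fun q _ => ?_
        rw [Finset.sum_eq_single a0]
        · simp [W, inc_star, inc_mul]; rfl
        · intro a _ ha; simp [W, ha]
        · simp
      rw [this]
      refine (norm_inc_le _ _).trans ((norm_row_le_iff _ (by positivity)).1 ?_)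
      refine (h4 _ ?_).trans (min_le_right _ _)
      rw [Finset.mem_biUnion]
      exact ⟨A, hA, Finset.mem_image.2 ⟨(b0, a0), Finset.mem_univ _, rfl⟩⟩
    rw [map_sum]
    refine (norm_sum_le _ _).trans ?_
    calc _ ≤ ∑ b0 : Fin (k+1), ∑ a0 : Fin (k+1), ε / (((k:ℝ)+1)*(k+1)) :=
          Finset.sum_le_sum fun b0 _ => by
            rw [map_sum]
            exact (norm_sum_le _ _).trans (Finset.sum_le_sum fun a0 _ => hb b0 a0)
      _ = ε := by
          simp; field_simp

theorem dr_mat {n : ℕ} {B D : Type*} [CStarAlgebra B] [CStarAlgebra D] (k : ℕ)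
    (h : DecompositionRankLE n B)
    (e : D ≃⋆ₐ[ℂ] Matrix (Fin (k+1)) (Fin (k+1)) B) : DecompositionRankLE n D := by
  letI : PartialOrder B := CStarAlgebra.spectralOrder B
  haveI : StarOrderedRing B := CStarAlgebra.spectralOrderedRing B
  letI o1 : PartialOrder (MF k B) := CStarAlgebra.spectralOrder (MF k B)
  haveI s1 : StarOrderedRing (MF k B) := CStarAlgebra.spectralOrderedRing (MF k B)
  exact dr_of_exGood (R := MF k B) (exGood_mat (ex0_of_dr h))
    (e.trans CStarMatrix.ofMatrixStarAlgEquiv)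
end mat
end DRank

namespace DRank
section corner
variable {R : Type*} [CStarAlgebra R] [PartialOrder R] [StarOrderedRing R]
variable {n : ℕ} {N I : Type} [Fintype N] [DecidableEq N]

lemma exr_unitary (b : N → I) (J : I → Fin (n+1)) (V : N → R) (c : I → R) (h : Exr b J V c)
    (u : Matrix N N ℂ) (hu : ∀ q r, b q ≠ b r → u q r = 0) (huu : star u * u = 1) :
    Exr b J (fun q => ∑ p, u p q • V p) c := by
  intro q r hqr
  have ht : ∀ p p', star (u p q • V p) * (u p' r • V p') =
      if p' = p then (star (u p q) * u p r) • c (b q) else 0 := by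
    intro p p'
    rw [star_smul, smul_mul_smul_comm]
    by_cases h1 : b p = b q
    · by_cases h2 : b p' = b r
      · rw [h p p' (by rw [h1, h2, hqr])]
        by_cases h3 : p = p'
        · subst h3; simp [h1]
        · simp [h3, Ne.symm h3]
      · rw [hu _ _ h2]
        split_ifs with h3
        · subst h3; rw [hu _ _ h2]; simp
        · simp
    · rw [hu _ _ h1]; simp
  simp only [star_sum, Finset.sum_mul_sum, ht]
  simp only [Finset.sum_ite_eq', Finset.mem_univ, if_true]
  rw [← Finset.sum_smul]
  have : ∑ p, star (u p q) * u p r = (star u * u) q r := by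
    rw [Matrix.mul_apply]; rfl
  rw [this, huu, Matrix.one_apply]
  split_ifs <;> simp

lemma sum_sub' {M : Type*} [AddCommMonoid M] (s : N → Prop) [DecidablePred s] (w : N → M) :
    ∑ q : {q // s q}, w q = ∑ q, if s q then w q else 0 := by
  rw [← Finset.sum_filter]
  exact (Finset.sum_subtype _ (by simp) _).symm

lemma norm_row_sub (s : N → Prop) [DecidablePred s] (w : N → R) :
    ‖(row (fun q : {q // s q} => w q) : MM {q // s q} R)‖ = ‖(row (fun q => if s q then w q else 0) : MM N R)‖ := by
  have h : ‖(row (fun q : {q // s q} => w q) : MM {q // s q} R)‖ ^ 2 =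
      ‖(row (fun q => if s q then w q else 0) : MM N R)‖ ^ 2 := by
    rw [norm_row_sq, norm_row_sq]
    congr 1
    rw [sum_sub' s (fun q => w q * star (w q))]
    refine Finset.sum_congr rfl fun q _ => ?_
    split_ifs <;> simp
  exact (pow_left_inj₀ (norm_nonneg _) (norm_nonneg _) two_ne_zero).1 h

lemma norm_submatrix_le (s : N → Prop) [DecidablePred s] (X : Matrix N N ℂ) :
    ‖X.submatrix (Subtype.val : {q // s q} → N) (Subtype.val : {q // s q} → N)‖ ≤ ‖X‖ := by
  let C : Matrix N {q // s q} ℂ := Matrix.of fun q q' => if q = q' then 1 else 0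
  have h1 : X.submatrix (Subtype.val : {q // s q} → N) (Subtype.val : {q // s q} → N) = C.conjTranspose * X * C := by
    ext i j
    simp [C, Matrix.mul_apply, Matrix.conjTranspose_apply, apply_ite]
  have h2 : C.conjTranspose * C = 1 := by
    ext i j
    simp [C, Matrix.mul_apply, Matrix.conjTranspose_apply, apply_ite, Matrix.one_apply, Subtype.ext_iff, eq_comm]
  have h3 : ‖C‖ ≤ 1 := by
    have h4 := Matrix.l2_opNorm_conjTranspose_mul_self C
    rw [h2] at h4
    have h5 := norm_one_le (Matrix {q // s q} {q // s q} ℂ)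
    nlinarith [norm_nonneg C]
  rw [h1]
  calc _ ≤ ‖C.conjTranspose‖ * ‖X‖ * ‖C‖ := (Matrix.l2_opNorm_mul _ _).trans
        (mul_le_mul_of_nonneg_right (Matrix.l2_opNorm_mul _ _) (norm_nonneg _))
    _ ≤ 1 * ‖X‖ * 1 := by
        rw [Matrix.l2_opNorm_conjTranspose]
        gcongr
    _ = ‖X‖ := by ring

lemma corner_alg {T : Type*} [CStarAlgebra T] {P v h U L X M : T} {ε : ℝ} (hP : P * P = P)
    (hP1 : ‖P‖ ≤ 1) (hh : ‖h‖ ≤ 1) (hU : ‖U‖ ≤ 1) (hM : ‖M‖ ≤ 2) (hUL : h * U = U * L)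
    (hLM : (L - L * L) * M = L - X) (hE : ‖P * v - v * h‖ ≤ ε) :
    ‖P * (v * U) - v * U * X‖ ≤ 7 * ε := by
  have hε : 0 ≤ ε := (norm_nonneg _).trans hE
  set E := P * v - v * h with hEd
  have e1 : v * h - v * (h * h) = E * h + P * E - E := by
    rw [hEd, mul_sub, ← mul_assoc P P, hP]; noncomm_ring
  have e2 : P * (v * U) - v * U * X = E * U + (E * h + P * E - E) * U * M := by
    rw [← e1]
    have : (v * h - v * (h * h)) * U * M = v * U * (L - X) := by
      rw [← hLM]
      calc _ = v * (h * U - h * (h * U)) * M := by noncomm_ring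
        _ = v * (U * L - U * L * L) * M := by rw [hUL, ← mul_assoc h U, hUL]
        _ = _ := by noncomm_ring
    rw [this, mul_sub]
    have : v * U * L = v * (h * U) := by rw [hUL, mul_assoc]
    rw [this, hEd]; noncomm_ring
  rw [e2]
  have e3 : ‖E * h + P * E - E‖ ≤ 3 * ε := by
    have a1 : ‖E * h‖ ≤ ε * 1 := (norm_mul_le _ _).trans (by gcongr)
    have a2 : ‖P * E‖ ≤ 1 * ε := (norm_mul_le _ _).trans (by gcongr)
    have := norm_sub_le (E * h + P * E) E
    have := norm_add_le (E * h) (P * E)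
    linarith
  have a1 : ‖E * U‖ ≤ ε * 1 := (norm_mul_le _ _).trans (by gcongr)
  have a2 : ‖(E * h + P * E - E) * U * M‖ ≤ 3 * ε * 1 * 2 :=
    (norm_mul_le _ _).trans (mul_le_mul ((norm_mul_le _ _).trans (by gcongr)) hM (norm_nonneg _) (by positivity))
  have := norm_add_le (E * U) ((E * h + P * E - E) * U * M)
  linarith

lemma diag_block {s : ℕ} {r : Fin s → ℕ} (h : FDBlock s r) (hh : star h = h) :
    ∃ (u : FDBlock s r) (l : Sg r → ℝ), star u * u = 1 ∧ u * star u = 1 ∧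
      bd h * bd u = bd u * Matrix.diagonal (fun q => (l q : ℂ)) := by
  have hH : ∀ i, (h i).IsHermitian := fun i => congrFun hh i
  refine ⟨fun i => (hH i).eigenvectorUnitary, fun q => (hH q.1).eigenvalues q.2, ?_, ?_, ?_⟩
  · funext i
    exact Unitary.coe_star_mul_self (hH i).eigenvectorUnitary
  · funext i
    exact Unitary.coe_mul_star_self (hH i).eigenvectorUnitary
  · have : Matrix.diagonal (fun q : Sg r => ((hH q.1).eigenvalues q.2 : ℂ)) =
        bd (fun i => Matrix.diagonal (fun k => ((hH i).eigenvalues k : ℂ))) :=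
      (Matrix.blockDiagonal'_diagonal (fun i k => ((hH i).eigenvalues k : ℂ))).symm
    rw [this, ← map_mul, ← map_mul]
    congr 1
    funext i
    have h1 := (hH i).spectral_theorem
    rw [Unitary.conjStarAlgAut_apply] at h1
    change h i * _ = _ * _
    conv_lhs => rw [h1]
    rw [mul_assoc, Unitary.coe_star_mul_self, mul_one]
    rfl

lemma exr_sa (b : N → I) (J : I → Fin (n+1)) (V : N → R) (c : I → R) (hX : Exr b J V c) :
    ∃ c' : I → R, (∀ i, IsSelfAdjoint (c' i)) ∧ Exr b J V c' := by
  classical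
  refine ⟨fun i => if ∃ q, b q = i then c i else 0, ?_, ?_⟩
  · intro i
    simp only
    split_ifs with hi
    · obtain ⟨q, rfl⟩ := hi
      have := hX q q rfl
      rw [if_pos rfl] at this
      rw [← this]; exact IsSelfAdjoint.star_mul_self _
    · exact IsSelfAdjoint.zero _
  · intro q r hqr
    have : (if ∃ q', b q' = b q then c (b q) else 0) = c (b q) := if_pos ⟨q, rfl⟩
    rw [hX q r hqr]
    simp only [this]

lemma row_mul_chi (s : N → Prop) [DecidablePred s] (w : N → R) :
    (row w * scal (Matrix.diagonal fun q => if s q then 1 else 0) : MM N R)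
      = row (fun q => if s q then w q else 0) := by
  rw [row_mul_scal]
  congr 1; funext q
  rw [Finset.sum_eq_single q]
  · simp
  · intro p _ hp; simp [Matrix.diagonal_apply_ne _ hp]
  · simp

lemma norm_mm_one (u : Matrix N N ℂ) (huu : star u * u = 1) : ‖u‖ ≤ 1 := by
  have h4 := Matrix.l2_opNorm_conjTranspose_mul_self u
  have h6 : u.conjTranspose * u = 1 := huu
  rw [h6] at h4
  have h5 := norm_one_le (Matrix N N ℂ)
  nlinarith [norm_nonneg u]

lemma row_mul_scal_one (w : N → R) : (row w * scal 1 : MM N R) = row w := by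
  rw [row_mul_scal]
  congr 1; funext q
  simp [Matrix.one_apply]

lemma chi_m (l : ℝ) : ∃ m : ℝ, |m| ≤ 2 ∧ (l - l * l) * m = l - (if 1/2 < l then 1 else 0) := by
  split_ifs with h
  · refine ⟨-l⁻¹, ?_, ?_⟩
    · rw [abs_neg, abs_inv, abs_of_pos (by linarith)]
      rw [inv_le_comm₀ (by linarith) (by norm_num)]; linarith
    · have : l ≠ 0 := by linarith
      field_simp; ring
  · refine ⟨(1-l)⁻¹, ?_, ?_⟩
    · rw [abs_inv, abs_of_pos (by linarith)]
      rw [inv_le_comm₀ (by linarith) (by norm_num)]; linarith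
    · have : 1 - l ≠ 0 := by linarith
      field_simp; ring

set_option maxHeartbeats 2000000 in
theorem good_corner (h : Ex0 n R) (p : R) (hp : p * p = p) (hsp : star p = p) : Good n R p := by
  classical
  intro S hS ε hε
  have hp1 := norm_proj_le hp hsp
  set K : ℝ := ∑ a ∈ S, ‖a‖ with hK
  have hK0 : 0 ≤ K := Finset.sum_nonneg fun _ _ => norm_nonneg _
  have haK : ∀ a ∈ S, ‖a‖ ≤ K := fun a ha =>
    Finset.single_le_sum (f := fun a => ‖a‖) (fun _ _ => norm_nonneg _) ha
  refine ⟨K, fun δ hδ => ?_⟩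
  obtain ⟨ε', hε', hε1, hε2, hε3⟩ : ∃ ε' : ℝ, 0 < ε' ∧ ε' ≤ 1 ∧ ε' * (29 + 7 * K) ≤ ε ∧ 56 * ε' ≤ δ := by
    refine ⟨min 1 (min (ε/(29+7*K)) (δ/56)), by positivity, min_le_left _ _, ?_, ?_⟩
    · rw [← le_div_iff₀ (by positivity)]
      exact (min_le_right _ _).trans (min_le_left _ _)
    · have := (min_le_right 1 (min (ε/(29+7*K)) (δ/56))).trans (min_le_right _ _)
      linarith
  obtain ⟨s, r, J, V, c, x, hX, hxn, hxs, hV, herr⟩ := h (insert p S) ε' hε'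
  obtain ⟨u, l, hu1, hu2, hul⟩ := diag_block (x p) (by rw [← hxs, hsp])
  choose m hm1 hm2 using chi_m
  have hbu1 : star (bd u) * bd u = 1 := by
    rw [← map_star bd, ← map_mul, hu1]; exact Matrix.blockDiagonal'_one
  have hbu2 : bd u * star (bd u) = 1 := by
    rw [← map_star bd, ← map_mul, hu2]; exact Matrix.blockDiagonal'_one
  have hbun : ‖bd u‖ ≤ 1 := norm_mm_one _ hbu1
  let χ : Sg r → Prop := fun q => 1/2 < l q
  let Y : Sg r → R := fun q => ∑ p, bd u p q • V p
  set v : MM (Sg r) R := row V with hv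
  set Pc : MM (Sg r) R := cor p with hPc
  set U : MM (Sg r) R := scal (bd u) with hU
  set X : MM (Sg r) R := scal (Matrix.diagonal fun q => if χ q then 1 else 0) with hXd
  have hY : (row Y : MM (Sg r) R) = v * U := (row_mul_scal _ _).symm
  have hPP : Pc * Pc = Pc := by rw [hPc, ← map_mul, hp]
  have hPs : star Pc = Pc := by rw [hPc, ← map_star cor, hsp]
  have hP1 : ‖Pc‖ ≤ 1 := norm_proj_le hPP hPs
  have hUn : ‖U‖ ≤ 1 := (norm_scal_le _).trans hbun
  have hXn : ‖X‖ ≤ 1 := by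
    refine (norm_scal_le _).trans ?_
    rw [Matrix.l2_opNorm_diagonal]
    refine (pi_norm_le_iff_of_nonneg zero_le_one).2 fun q => ?_
    split_ifs <;> simp
  have hvn : ‖v‖ ≤ 2 := by
    have h1 := norm_row_sq V
    have h2 : ‖∑ q, V q * star (V q)‖ ≤ 2 := by
      have h3 := norm_add_le (∑ q, V q * star (V q) - 1) 1
      rw [sub_add_cancel] at h3
      have := norm_one_le R
      linarith
    nlinarith [norm_nonneg v]
  have hYn : ‖v * U‖ ≤ 2 := (norm_mul_le _ _).trans (by
    calc _ ≤ (2:ℝ) * 1 := by gcongr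
      _ = 2 := by norm_num)
  have hA : ‖Pc * (v * U) - v * U * X‖ ≤ 7 * ε' := by
    refine corner_alg (h := scal (bd (x p))) (L := scal (Matrix.diagonal fun q => (l q : ℂ)))
      (M := scal (Matrix.diagonal fun q => (m (l q) : ℂ))) hPP hP1 ?_ hUn ?_ ?_ ?_ ?_
    · exact (norm_scal_le _).trans ((norm_bd_le _).trans ((hxn p).trans hp1))
    · refine (norm_scal_le _).trans ?_
      rw [Matrix.l2_opNorm_diagonal]
      refine (pi_norm_le_iff_of_nonneg zero_le_two).2 fun q => ?_
      rw [Complex.norm_real]; exact hm1 _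
    · rw [hU, ← map_mul scal, ← map_mul scal, hul]
    · rw [hXd, ← map_mul, ← map_sub, ← map_mul, ← map_sub]
      congr 1
      rw [Matrix.diagonal_mul_diagonal, Matrix.diagonal_sub, Matrix.diagonal_mul_diagonal, Matrix.diagonal_sub]
      congr 1
      funext q
      have := congrArg (fun t : ℝ => (t : ℂ)) (hm2 (l q))
      simp only [Complex.ofReal_sub, Complex.ofReal_mul] at this
      rw [this]
      congr 1
      simp only [χ]
      split_ifs <;> simp
    · rw [← row_err]; exact herr p (Finset.mem_insert_self _ _)
  have hA2 : ‖Pc * (v * U) * X - Pc * (v * U)‖ ≤ 7 * ε' := by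
    have : Pc * (v * U) * X - Pc * (v * U) = Pc * -(Pc * (v * U) - v * U * X) := by
      rw [neg_sub, mul_sub, ← mul_assoc Pc Pc, hPP, mul_assoc Pc]
    rw [this]
    refine (norm_mul_le _ _).trans ?_
    rw [norm_neg]
    calc _ ≤ 1 * (7 * ε') := by gcongr
      _ = _ := one_mul _
  have hB : ‖Pc * (v * U) * X - v * U * X‖ ≤ 14 * ε' := by
    have := norm_add_le (Pc * (v * U) * X - Pc * (v * U)) (Pc * (v * U) - v * U * X)
    rw [sub_add_sub_cancel] at this
    linarith
  have hYX : Exr Sigma.fst J Y c := exr_unitary _ J V c hX (bd u) (fun q q' hq => bd_apply_ne _ _ _ hq) hbu1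
  have hYX' : Exr (fun q : {q // χ q} => q.1.1) J (fun q : {q // χ q} => Y q) c := by
    intro q q' hq
    rw [hYX q q' hq]
    simp [Subtype.ext_iff]
  obtain ⟨c', hc', hYc⟩ := exr_sa _ J _ c hYX'
  have hn1 : ‖(row (fun q : {q // χ q} => Y q) : MM _ R)‖ ≤ 2 := by
    rw [norm_row_sub]
    exact (norm_row_mask Y χ).trans (hY ▸ hYn)
  have hn2 : ‖(row (fun q : {q // χ q} => p * Y q) : MM _ R)‖ ≤ 2 := by
    have := cor_mul_row (N := {q // χ q}) p (fun q : {q // χ q} => Y q)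
    rw [← this]
    refine (norm_mul_le _ _).trans ?_
    rw [norm_cor]
    calc _ ≤ (1:ℝ) * 2 := by gcongr
      _ = 2 := by norm_num
  have hn3 : ‖(row (fun q : {q // χ q} => p * Y q) - row (fun q : {q // χ q} => Y q) : MM {q // χ q} R)‖ ≤ 14 * ε' := by
    rw [← map_sub]
    have := norm_row_sub χ (fun q => p * Y q - Y q)
    refine le_trans (le_of_eq this) ?_
    rw [← row_mul_chi]
    have e1 : (row (fun q => p * Y q - Y q) : MM (Sg r) R) = Pc * (v * U) - v * U := by
      rw [← hY, hPc, cor_mul_row, ← map_sub]; rfl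
    rw [e1, sub_mul]
    exact hB
  refine ⟨{q // χ q}, Fin s, inferInstance, inferInstance, inferInstance, inferInstance,
    fun q => q.1.1, J, fun q => p * Y q, c',
    fun a => (bd (star u * x a * u)).submatrix Subtype.val Subtype.val, ?_, hc', ?_, ?_, ?_, ?_⟩
  · intro q; rw [← mul_assoc, hp]
  · intro a ha
    refine ⟨?_, fun q q' hq => bd_apply_ne _ _ _ hq⟩
    refine (norm_submatrix_le χ _).trans ?_
    rw [map_mul, map_mul, map_star bd]
    refine (norm_mul_le _ _).trans ?_
    have h1 : ‖star (bd u) * bd (x a)‖ ≤ 1 * K := (norm_mul_le _ _).trans (by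
      rw [norm_star]
      have := (norm_bd_le (x a)).trans ((hxn a).trans (haK a ha))
      gcongr)
    calc _ ≤ (1 * K) * 1 := by gcongr
      _ = K := by ring
  · intro j
    rw [← star_row_msk _ J _ c' hYc j]
    set Z : MM {q // χ q} R := row (msk (fun q : {q // χ q} => q.1.1) J j (fun q : {q // χ q} => p * Y q)) with hZ
    set W : MM {q // χ q} R := row (msk (fun q : {q // χ q} => q.1.1) J j (fun q : {q // χ q} => Y q)) with hW
    have hZn : ‖Z‖ ≤ 2 := (norm_row_mask _ (fun q : {q // χ q} => J q.1.1 = j)).trans hn2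
    have hWn : ‖W‖ ≤ 2 := (norm_row_mask _ (fun q : {q // χ q} => J q.1.1 = j)).trans hn1
    have hZW : ‖Z - W‖ ≤ 14 * ε' := by
      rw [← map_sub] at hn3
      refine le_trans (le_of_eq ?_) ((norm_row_mask _ (fun q : {q // χ q} => J q.1.1 = j)).trans hn3)
      rw [hZ, hW, ← map_sub]
      congr 2
      funext q
      simp only [msk, Pi.sub_apply]
      split_ifs <;> simp
    have e : star Z * Z - star W * W = star Z * (Z - W) + star (Z - W) * W := by
      rw [star_sub]; noncomm_ring
    rw [e]
    have a1 : ‖star Z * (Z - W)‖ ≤ 2 * (14 * ε') := (norm_mul_le _ _).trans (by rw [norm_star]; gcongr)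
    have a2 : ‖star (Z - W) * W‖ ≤ (14 * ε') * 2 := (norm_mul_le _ _).trans (by rw [norm_star]; gcongr)
    have := norm_add_le (star Z * (Z - W)) (star (Z - W) * W)
    linarith
  · set Z : MM (Sg r) R := Pc * (v * U) * X with hZ
    set W : MM (Sg r) R := Pc * (v * U) with hW
    have hZr : Z = row (fun q => if χ q then p * Y q else 0) := by
      rw [hZ, ← row_mul_chi, hW, ← hY, hPc, cor_mul_row]
    have e1 : (cor (∑ q : {q // χ q}, (p * Y q) * star (p * Y q) - p) : MM (Sg r) R) = Z * star Z - Pc := by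
      rw [map_sub, hZr, row_mul_star_row, sum_sub' χ (fun q => (p * Y q) * star (p * Y q))]
      congr 3
      funext q
      split_ifs <;> simp
    have e2 : W * star W - Pc = Pc * cor (∑ q, V q * star (V q) - 1) * Pc := by
      rw [map_sub, ← row_mul_star_row, mul_sub, sub_mul, hW, star_mul, star_mul, hPs]
      have : U * star U = scal 1 := by
        rw [hU, ← map_star scal, ← map_mul, hbu2]
      have e3 : v * U * (star U * star v) = v * star v := by
        rw [← mul_assoc, mul_assoc v, this, hv, row_mul_scal_one]
      have e4 : Pc * cor 1 * Pc = Pc := by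
        rw [hPc, ← map_mul, ← map_mul, mul_one, hp]
      rw [e4, ← mul_assoc (Pc * (v * U)), mul_assoc Pc (v * U), e3]
    have hWn : ‖W‖ ≤ 2 := (norm_mul_le _ _).trans (by
      calc _ ≤ (1:ℝ) * 2 := by gcongr
        _ = 2 := by norm_num)
    have hZn : ‖Z‖ ≤ 2 := (norm_mul_le _ _).trans (by
      calc _ ≤ (2:ℝ) * 1 := by gcongr
        _ = 2 := by norm_num)
    have e3 : Z * star Z - Pc = Z * star (Z - W) + (Z - W) * star W + (W * star W - Pc) := by
      rw [star_sub]; noncomm_ring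
    rw [← norm_cor (N := Sg r), e1, e3]
    have a1 : ‖Z * star (Z - W)‖ ≤ 2 * (7 * ε') := (norm_mul_le _ _).trans (by rw [norm_star]; gcongr)
    have a2 : ‖(Z - W) * star W‖ ≤ (7 * ε') * 2 := (norm_mul_le _ _).trans (by rw [norm_star]; gcongr)
    have a3 : ‖W * star W - Pc‖ ≤ ε' := by
      rw [e2]
      calc _ ≤ 1 * ε' * 1 := by
            refine (norm_mul_le _ _).trans (mul_le_mul ((norm_mul_le _ _).trans ?_) hP1 (norm_nonneg _) (by positivity))
            have hc := (norm_cor (N := Sg r) (∑ q, V q * star (V q) - 1)).le.trans hV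
            gcongr
        _ = ε' := by ring
    have := norm_add₃_le (a := Z * star (Z - W)) (b := (Z - W) * star W) (c := W * star W - Pc)
    have : 0 ≤ ε' * K := by positivity
    linarith
  · intro a ha
    have hap : a * p = a := by
      have := hS a ha
      rw [← this, mul_assoc, hp]
    have hxa : ‖(scal (bd (star u * x a * u)) : MM (Sg r) R)‖ ≤ K := by
      refine (norm_scal_le _).trans ?_
      rw [map_mul, map_mul, map_star bd]
      refine (norm_mul_le _ _).trans ?_
      have h1 : ‖star (bd u) * bd (x a)‖ ≤ 1 * K := (norm_mul_le _ _).trans (by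
        rw [norm_star]
        have := (norm_bd_le (x a)).trans ((hxn a).trans (haK a ha))
        gcongr)
      calc _ ≤ (1 * K) * 1 := by gcongr
        _ = K := by ring
    set Xa := bd (star u * x a * u) with hXa
    have e0 : err a (Xa.submatrix Subtype.val Subtype.val) (fun q : {q // χ q} => p * Y q)
        = fun q : {q // χ q} => err a ((Matrix.diagonal fun q => if χ q then 1 else 0) * Xa) (fun q => p * Y q) q := by
      funext q
      simp only [err, Matrix.diagonal_mul, Matrix.submatrix_apply]
      rw [sum_sub' χ (fun q' => Xa q' q • (p * Y q'))]
      congr 1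
      refine Finset.sum_congr rfl fun q' _ => ?_
      split_ifs <;> simp
    rw [e0, norm_row_sub]
    refine (norm_row_mask _ χ).trans ?_
    have e1 : (row (fun q => p * Y q) : MM (Sg r) R) = Pc * (v * U) := by
      rw [← hY, hPc, cor_mul_row]
    rw [row_err, e1, map_mul, ← mul_assoc]
    have e2 : (cor a * Pc : MM (Sg r) R) = cor a := by rw [hPc, ← map_mul, hap]
    have e3 : v * U * scal Xa = v * scal (bd (x a)) * U := by
      have hXa2 : Xa = star (bd u) * (bd (x a) * bd u) := by
        rw [hXa, map_mul bd, map_mul bd, map_star bd, mul_assoc]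
      rw [hXa2, hU, mul_assoc v, ← map_mul scal, ← mul_assoc, hbu2, one_mul, map_mul scal, mul_assoc]
    have e4 : cor a * Pc * (v * U) - Pc * (v * U) * (X * scal Xa)
        = Pc * (cor a * v - v * scal (bd (x a))) * U - (Pc * (v * U) * X - Pc * (v * U)) * scal Xa := by
      have e5 : Pc * cor a = cor a := by
        rw [hPc, ← map_mul]; congr 1
        have := hS a ha
        rw [← this, mul_assoc, ← mul_assoc p p, hp]
      have e6 : Pc * (v * U) * scal Xa = Pc * (v * scal (bd (x a)) * U) := by rw [mul_assoc, e3]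
      rw [e2, sub_mul (Pc * (v * U) * X), e6, mul_sub, sub_mul, ← mul_assoc Pc (cor a), e5]
      noncomm_ring
    rw [← mul_assoc] at e4
    rw [← mul_assoc, e4]
    have a1 : ‖Pc * (cor a * v - v * scal (bd (x a))) * U‖ ≤ ε' := by
      rw [← row_err]
      have := herr a (Finset.mem_insert_of_mem ha)
      calc _ ≤ 1 * ε' * 1 := by
            refine (norm_mul_le _ _).trans (mul_le_mul ((norm_mul_le _ _).trans ?_) hUn (norm_nonneg _) (by positivity))
            gcongr
        _ = ε' := by ring
    have a2 : ‖(Pc * (v * U) * X - Pc * (v * U)) * scal Xa‖ ≤ 7 * ε' * K :=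
      (norm_mul_le _ _).trans (by gcongr)
    have := norm_sub_le (Pc * (cor a * v - v * scal (bd (x a))) * U) ((Pc * (v * U) * X - Pc * (v * U)) * scal Xa)
    linarith

theorem dr_corner {n : ℕ} {B D : Type*} [CStarAlgebra B] [CStarAlgebra D]
    (h : DecompositionRankLE n B) (p : B) (hp : p * p = p) (hsp : star p = p)
    (ι : D →⋆ₙₐ[ℂ] B) (hι : Function.Injective ι) (h1 : ι 1 = p)
    (hr : Set.range ι = {x | p * x * p = x}) : DecompositionRankLE n D := by
  letI : PartialOrder B := CStarAlgebra.spectralOrder B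
  haveI : StarOrderedRing B := CStarAlgebra.spectralOrderedRing B
  refine dr_of_goodX (goodX_of_good hp hsp (good_corner (ex0_of_dr h) p hp hsp)) ι hι h1 ?_
  intro x hx
  have : x ∈ Set.range ι := by rw [hr]; exact hx
  exact this
end corner
end DRank

namespace DRank

theorem dr_finsat {n : ℕ} {B : CStarAlg} (h : FinSat (drClass n) B) : DecompositionRankLE n B.carrier := by
  induction h with
  | base h => exact h.2
  | iso _ e ih => exact dr_iso ih e.some
  | sum _ _ e ih1 ih2 => exact dr_prod ih1 ih2 e.some
  | matrix k _ e ih => exact dr_mat k ih e.some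
  | corner p _ _ h2 h3 h4 ih =>
    obtain ⟨ι, h5, h6, h7⟩ := h4
    exact dr_corner ih p h2 h3 ι h5 h6 h7

section psd
variable {R : Type*} [CStarAlgebra R] [PartialOrder R] [StarOrderedRing R]

lemma neg_part_aux (G : R) (hG : star G = G) : ∃ N Z : R, star N = N ∧ N * G * N = -(star Z * Z) ∧
    (Z = 0 → 0 ≤ G) := by
  have hs : IsSelfAdjoint G := hG
  have hn : 0 ≤ G⁻ := CFC.negPart_nonneg G
  have hsn : star G⁻ = G⁻ := hn.isSelfAdjoint
  obtain ⟨Y, hY⟩ := posElem_of_nonneg hn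
  have h1 := CFC.posPart_sub_negPart G hs
  refine ⟨G⁻, Y * G⁻, hsn, ?_, ?_⟩
  · rw [star_mul, hsn]
    have h2 : G⁻ * star Y * (Y * G⁻) = G⁻ * G⁻ * G⁻ := by
      nth_rewrite 4 [hY]; noncomm_ring
    have h3 : G⁻ * star Y * (Y * G⁻) = G⁻ * (star Y * Y) * G⁻ := by noncomm_ring
    rw [h3, ← hY]
    nth_rewrite 2 [← h1]
    rw [mul_sub, CFC.negPart_mul_posPart]; noncomm_ring
  · intro hz
    have h4 : G⁻ * G⁻ = 0 := by
      nth_rewrite 1 [hY]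
      rw [mul_assoc, hz, mul_zero]
    have h5 : G⁻ = 0 := by
      rw [← CStarRing.star_mul_self_eq_zero_iff, hsn, h4]
    rw [← h1, h5, sub_zero]
    exact CFC.posPart_nonneg G

lemma psd_of_vec {N : Type*} [Fintype N] [DecidableEq N] (G : CStarMatrix N N R) (hs : star G = G)
    (h : ∀ p : N → R, 0 ≤ ∑ l, ∑ m, star (p l) * G l m * p m) :
    ∃ K : CStarMatrix N N R, G = star K * K := by
  obtain ⟨M, Z, h1, h2, h3⟩ := neg_part_aux G hs
  refine posElem_of_nonneg (h3 ?_)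
  have hz : ∀ a, ∑ t, star (Z t a) * Z t a = 0 := by
    intro a
    have h4 := h (fun l => M l a)
    have h5 : ∑ l, ∑ m, star (M l a) * G l m * M m a = (M * G * M) a a := by
      rw [CStarMatrix.mul_apply, Finset.sum_comm]
      refine Finset.sum_congr rfl fun m _ => ?_
      rw [CStarMatrix.mul_apply, Finset.sum_mul]
      refine Finset.sum_congr rfl fun l _ => ?_
      rw [← CStarMatrix.star_apply (f := M), h1]
    rw [h5, h2] at h4
    have h6 : (-(star Z * Z)) a a = - ∑ t, star (Z t a) * Z t a := by
      rw [CStarMatrix.neg_apply, CStarMatrix.mul_apply]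
      rfl
    rw [h6] at h4
    refine le_antisymm (by simpa using h4) (Finset.sum_nonneg fun t _ => star_mul_self_nonneg _)
  ext t a
  have := (Finset.sum_eq_zero_iff_of_nonneg (fun t _ => star_mul_self_nonneg (Z t a))).1 (hz a) t (Finset.mem_univ _)
  rw [CStarRing.star_mul_self_eq_zero_iff] at this
  exact this
end psd

section seq
variable {X Y : Type*} [CStarAlgebra X] [CStarAlgebra Y]

def Nu (f : ℕ → X) : Prop := Tendsto f atTop (𝓝 0)
def Bd (f : ℕ → X) : Prop := ∃ M : ℝ, ∀ k, ‖f k‖ ≤ M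

lemma Bd.const (a : X) : Bd (fun _ => a) := ⟨‖a‖, fun _ => le_rfl⟩
lemma Bd.add {f g : ℕ → X} (hf : Bd f) (hg : Bd g) : Bd (fun k => f k + g k) := by
  obtain ⟨M, hM⟩ := hf
  obtain ⟨M', hM'⟩ := hg
  exact ⟨M + M', fun k => (norm_add_le _ _).trans (add_le_add (hM k) (hM' k))⟩
lemma Bd.sub {f g : ℕ → X} (hf : Bd f) (hg : Bd g) : Bd (fun k => f k - g k) := by
  obtain ⟨M, hM⟩ := hf
  obtain ⟨M', hM'⟩ := hg
  exact ⟨M + M', fun k => (norm_sub_le _ _).trans (add_le_add (hM k) (hM' k))⟩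
lemma Bd.mul {f g : ℕ → X} (hf : Bd f) (hg : Bd g) : Bd (fun k => f k * g k) := by
  obtain ⟨M, hM⟩ := hf
  obtain ⟨M', hM'⟩ := hg
  exact ⟨M * M', fun k => (norm_mul_le _ _).trans
    (mul_le_mul (hM k) (hM' k) (norm_nonneg _) ((norm_nonneg _).trans (hM k)))⟩
lemma Bd.star {f : ℕ → X} (hf : Bd f) : Bd (fun k => star (f k)) := by
  obtain ⟨M, hM⟩ := hf
  exact ⟨M, fun k => by rw [norm_star]; exact hM k⟩
lemma Bd.map {f : ℕ → X} (hf : Bd f) (T : X → Y) {C : ℝ} (hC : 0 ≤ C) (hT : ∀ a, ‖T a‖ ≤ C * ‖a‖) :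
    Bd (fun k => T (f k)) := by
  obtain ⟨M, hM⟩ := hf
  exact ⟨C * M, fun k => (hT _).trans (by have := hM k; gcongr)⟩

lemma Nu.add {f g : ℕ → X} (hf : Nu f) (hg : Nu g) : Nu (fun k => f k + g k) := by
  simpa [Nu] using Tendsto.add hf hg
lemma Nu.sub {f g : ℕ → X} (hf : Nu f) (hg : Nu g) : Nu (fun k => f k - g k) := by
  simpa [Nu] using Tendsto.sub hf hg
lemma Nu.star {f : ℕ → X} (hf : Nu f) : Nu (fun k => star (f k)) := by
  simpa [Nu] using Tendsto.star hf
lemma Nu.sum {K : Type*} {s : Finset K} {f : K → ℕ → X} (hf : ∀ i ∈ s, Nu (f i)) :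
    Nu (fun k => ∑ i ∈ s, f i k) := by
  simpa [Nu] using tendsto_finset_sum s hf
lemma Nu.mulB {f g : ℕ → X} (hf : Nu f) (hg : Bd g) : Nu (fun k => f k * g k) := by
  obtain ⟨M, hM⟩ := hg
  have : Tendsto (fun k => ‖f k‖ * M) atTop (𝓝 0) := by
    simpa using (tendsto_zero_iff_norm_tendsto_zero.1 hf).mul_const M
  exact squeeze_zero_norm (fun k => (norm_mul_le _ _).trans (by have := hM k; gcongr)) this
lemma Nu.Bmul {f g : ℕ → X} (hg : Bd g) (hf : Nu f) : Nu (fun k => g k * f k) := by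
  obtain ⟨M, hM⟩ := hg
  have : Tendsto (fun k => M * ‖f k‖) atTop (𝓝 0) := by
    simpa using (tendsto_zero_iff_norm_tendsto_zero.1 hf).const_mul M
  exact squeeze_zero_norm (fun k => (norm_mul_le _ _).trans (by have := hM k; gcongr)) this
lemma Nu.map {f : ℕ → X} (hf : Nu f) (T : X → Y) {C : ℝ} (hT : ∀ a, ‖T a‖ ≤ C * ‖a‖) :
    Nu (fun k => T (f k)) := by
  have : Tendsto (fun k => C * ‖f k‖) atTop (𝓝 0) := by
    simpa using (tendsto_zero_iff_norm_tendsto_zero.1 hf).const_mul C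
  exact squeeze_zero_norm (fun k => hT _) this
lemma Nu.congr {f g : ℕ → X} (hf : Nu f) (h : ∀ k, g k = f k) : Nu g := by
  have : g = f := funext h
  rw [this]; exact hf
lemma nu_of_norm {f : ℕ → X} (h : Tendsto (fun k => ‖f k‖) atTop (𝓝 0)) : Nu f :=
  tendsto_zero_iff_norm_tendsto_zero.2 h
lemma Nu.of_sq {f : ℕ → X} {g : ℕ → X} (hg : Nu g) (h : ∀ k, ‖f k‖ ^ 2 ≤ ‖g k‖) : Nu f := by
  apply nu_of_norm
  have h1 : Tendsto (fun k => Real.sqrt ‖g k‖) atTop (𝓝 0) := by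
    have := (Real.continuous_sqrt.tendsto 0).comp (tendsto_zero_iff_norm_tendsto_zero.1 hg)
    rw [Real.sqrt_zero] at this; exact this
  exact squeeze_zero (fun _ => norm_nonneg _) (fun k => Real.le_sqrt_of_sq_le (h k)) h1
end seq

end DRank

namespace DRank
section rok
variable {Q T : Type*} [CStarAlgebra Q] [CStarAlgebra T]

structure RD (ι : Q →⋆ₐ[ℂ] T) (E : T →ₗ[ℂ] Q) {m : ℕ} (u v : Fin m → T) (e : ℕ → T) (z : Q)
    (C : ℝ) : Prop where
  hE : IsCondExpect ι E
  qb : IsQuasiBasis ι E u v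
  st : ∀ x, E (star x) = star (E x)
  hC : 0 ≤ C
  bdd : ∀ x, ‖E x‖ ≤ C * ‖x‖
  Be : Bd e
  e2 : Nu (fun k => e k * e k - e k)
  es : Nu (fun k => star (e k) - e k)
  com : ∀ a, Nu (fun k => e k * a - a * e k)
  zi : ∑ i, u i * v i = ι z
  zc : ∀ p, z * p = p * z
  zs : star z = z
  Ee : Nu (fun k => z * E (e k) - 1)

lemma iota_le (ι : Q →⋆ₐ[ℂ] T) (a : Q) : ‖ι a‖ ≤ 1 * ‖a‖ := by
  rw [one_mul]; exact NonUnitalStarAlgHom.norm_apply_le ι a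

variable {ι : Q →⋆ₐ[ℂ] T} {E : T →ₗ[ℂ] Q} 

lemma ce_left (h : IsCondExpect ι E) (p : Q) (x : T) : E (ι p * x) = p * E x := by
  have := h.bimodule p 1 x
  simpa using this
lemma ce_right (h : IsCondExpect ι E) (p : Q) (x : T) : E (x * ι p) = E x * p := by
  have := h.bimodule 1 p x
  simpa using this

lemma ce_star (h : IsCondExpect ι E) (x : T) : E (star x) = star (E x) := by
  have sa : ∀ y, star (E (star y * y)) = E (star y * y) := fun y => by
    obtain ⟨w, hw⟩ := h.pos y
    rw [hw]; simp
  have h1 : ∀ x : T, star (E (x + star x)) = E (x + star x) := fun x => by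
    have e1 : x + star x = (1/2 : ℂ) • (star (x+1) * (x+1) - star (x-1) * (x-1)) := by
      have : star (x+1) * (x+1) - star (x-1) * (x-1) = (2:ℂ) • (x + star x) := by
        simp only [star_add, star_sub, star_one, two_smul]; noncomm_ring
      rw [this, smul_smul]; norm_num
    rw [e1, map_smul, map_sub, star_smul, star_sub, sa, sa]
    simp
  have h2 := h1 x
  have h3 := h1 (Complex.I • x)
  simp only [map_add, star_add, star_smul, map_smul, Complex.star_def, Complex.conj_I, star_star, star_neg, neg_smul, map_neg, neg_neg] at h2 h3
  have h4 : Complex.I • (Complex.I • star (E (star x)) + -(Complex.I • star (E x))) = Complex.I • (Complex.I • E x + -(Complex.I • E (star x))) := by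
    congr 1
    rw [← h3]; abel
  simp only [smul_add, smul_neg, smul_smul, Complex.I_mul_I, neg_smul, one_smul, neg_neg] at h4
  have h5 : (2:ℂ) • star (E x) = (2:ℂ) • E (star x) := by
    rw [two_smul, two_smul]
    calc star (E x) + star (E x) = (star (E x) + star (E (star x))) + (-star (E (star x)) + star (E x)) := by abel
      _ = _ := by rw [h2, h4]; abel
  exact (smul_right_injective _ (two_ne_zero : (2:ℂ) ≠ 0) h5).symm

lemma ce_bdd (h : IsCondExpect ι E) : ∃ C : ℝ, 0 ≤ C ∧ ∀ x, ‖E x‖ ≤ C * ‖x‖ := by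
  letI := CStarAlgebra.spectralOrder T
  haveI := CStarAlgebra.spectralOrderedRing T
  letI := CStarAlgebra.spectralOrder Q
  haveI := CStarAlgebra.spectralOrderedRing Q
  have hp : ∀ a : T, 0 ≤ a → 0 ≤ E a := fun a ha => by
    obtain ⟨y, hy⟩ := posElem_of_nonneg ha
    obtain ⟨w, hw⟩ := h.pos y
    rw [hy, hw]; exact star_mul_self_nonneg _
  obtain ⟨C, hC⟩ := PositiveLinearMap.exists_norm_apply_le (PositiveLinearMap.mk₀ E hp)
  exact ⟨C, C.2, hC⟩

lemma qb_star {m : ℕ} {u v : Fin m → T} (h : IsCondExpect ι E) (hq : IsQuasiBasis ι E u v) (y : T) :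
    ∑ i, star (v i) * ι (E (star (u i) * y)) = y := by
  have := (hq (star y)).2
  apply_fun star at this
  rw [star_star, star_sum] at this
  rw [this]
  refine Finset.sum_congr rfl fun i _ => ?_
  rw [star_mul, ← map_star ι, ← ce_star h, star_mul, star_star, ← this]

lemma ind_central {m : ℕ} {u v : Fin m → T} (hq : IsQuasiBasis ι E u v) (a : T) :
    a * ∑ i, u i * v i = (∑ i, u i * v i) * a := by
  rw [Finset.mul_sum, Finset.sum_mul]
  calc ∑ i, a * (u i * v i) = ∑ i, ∑ j, u j * ι (E (v j * a * u i)) * v i := by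
        refine Finset.sum_congr rfl fun i _ => ?_
        rw [← mul_assoc, ← Finset.sum_mul]
        congr 1
        conv_lhs => rw [(hq (a * u i)).1]
        simp only [mul_assoc]
    _ = ∑ j, u j * ∑ i, ι (E (v j * a * u i)) * v i := by
        rw [Finset.sum_comm]
        refine Finset.sum_congr rfl fun j _ => ?_
        rw [Finset.mul_sum]; simp only [mul_assoc]
    _ = _ := by
        refine Finset.sum_congr rfl fun j _ => ?_
        rw [← (hq (v j * a)).2, mul_assoc]

lemma rd_of {m : ℕ} {u v : Fin m → T} (h : IsCondExpect ι E) (hq : IsQuasiBasis ι E u v)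
    (hR : CondExpectHasRokhlin ι E (∑ i, u i * v i)) : ∃ e z C, RD ι E u v e z C := by
  obtain ⟨e, hb, h2, hs, hc, ⟨w, hw1, hw2, hw3⟩, -⟩ := hR
  obtain ⟨C, hC, hbd⟩ := ce_bdd h
  have hw3' := nu_of_norm hw3
  have hEe : Nu (fun k => E (e k) - E w) :=
    (hw3'.map E hbd).congr fun k => by rw [map_sub, h.restricts]
  have hw : w = ι (E w) := by
    have h1 : Nu (fun k => ι (E (e k)) - ι (E w)) := (hEe.map ι (iota_le ι)).congr fun k => by rw [map_sub]
    have h2 : Nu (fun _ : ℕ => ι (E w) - w) := (hw3'.sub h1).congr fun k => by abel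
    have := tendsto_nhds_unique h2 tendsto_const_nhds
    exact (sub_eq_zero.1 this.symm).symm
  set ind := ∑ i, u i * v i with hind
  have hz1 : E w * E ind = 1 := by
    rw [← ce_left h, ← hw, hw1, ← map_one ι, h.restricts]
  have hz2 : E ind * E w = 1 := by
    rw [← ce_right h, ← hw, hw2, ← map_one ι, h.restricts]
  have hi : ind = ι (E ind) := by
    calc ind = ind * ι (E w * E ind) := by rw [hz1, map_one, mul_one]
      _ = ind * w * ι (E ind) := by rw [map_mul, ← hw, mul_assoc]
      _ = _ := by rw [hw2, one_mul]
  have hws : star (E w) = E w := by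
    have h1 : Nu (fun k => star (E (e k)) - star (E w)) := hEe.star.congr fun k => by rw [star_sub]
    have h2 : Nu (fun k => star (E (e k)) - E (e k)) := ((nu_of_norm hs).map E hbd).congr fun k => by
      rw [map_sub, ce_star h]
    have h3 : Nu (fun _ : ℕ => star (E w) - E w) := ((h2.sub h1).add hEe).congr fun k => by abel
    have := tendsto_nhds_unique h3 tendsto_const_nhds
    exact (sub_eq_zero.1 this.symm)
  refine ⟨e, E ind, C, h, hq, ce_star h, hC, hbd, hb, nu_of_norm h2, nu_of_norm hs, fun a => nu_of_norm (hc a),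
    hi, fun p => ?_, ?_, ?_⟩
  · rw [← ce_right h, ← ce_left h, hind, ind_central hq]
  · have h1 : E w * star (E ind) = 1 := by
      rw [← hws, ← star_mul, hz2, star_one]
    calc star (E ind) = E ind * E w * star (E ind) := by rw [hz2, one_mul]
      _ = _ := by rw [mul_assoc, h1, mul_one]
  · exact (hEe.Bmul (Bd.const (E ind))).congr fun k => by rw [mul_sub, hz2]

lemma L1 {m : ℕ} {v : Fin m → T} (h : IsCondExpect ι E) (g k : Fin m → Q) :
    ∑ a, ∑ b, star (g a) * E (v a * star (v b)) * k b =
      E (star (∑ a, star (v a) * ι (g a)) * ∑ b, star (v b) * ι (k b)) := by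
  rw [star_sum, Finset.sum_mul, map_sum]
  refine Finset.sum_congr rfl fun a _ => ?_
  rw [Finset.mul_sum, map_sum]
  refine Finset.sum_congr rfl fun b _ => ?_
  rw [star_mul, star_star, ← map_star ι, ← h.bimodule]
  simp only [mul_assoc]

lemma L2 {m : ℕ} {G K : CStarMatrix (Fin m) (Fin m) Q} (hG : G = star K * K) (g k : Fin m → Q) :
    ∑ t, star (∑ a, K t a * g a) * (∑ b, K t b * k b) = ∑ a, ∑ b, star (g a) * G a b * k b := by
  have : ∀ a b, G a b = ∑ t, star (K t a) * K t b := fun a b => by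
    rw [hG, CStarMatrix.mul_apply]; rfl
  simp only [this, star_sum, Finset.sum_mul, Finset.mul_sum, star_mul]
  rw [Finset.sum_comm]
  rw [show (∑ x, ∑ y, ∑ i, star (g x) * (star (K i x) * K i y) * k y) = ∑ x, ∑ i, ∑ y, star (g x) * (star (K i x) * K i y) * k y from Finset.sum_congr rfl fun x _ => Finset.sum_comm]
  rw [Finset.sum_comm]
  conv_rhs => rw [Finset.sum_comm]
  refine Finset.sum_congr rfl fun t _ => ?_
  rw [Finset.sum_comm]
  refine Finset.sum_congr rfl fun a _ => Finset.sum_congr rfl fun b _ => ?_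
  simp only [mul_assoc]

end rok
end DRank

namespace DRank
section rok2
variable {Q T : Type*} [CStarAlgebra Q] [CStarAlgebra T]
variable {ι : Q →⋆ₐ[ℂ] T} {E : T →ₗ[ℂ] Q} {m : ℕ} {u v : Fin m → T} {e : ℕ → T} {z : Q} {C : ℝ}

lemma RD.step2 (h : RD ι E u v e z C) (x y : T) :
    Nu (fun k => E (star (e k * x - e k * ι (z * E (e k * x))) * (e k * y - e k * ι (z * E (e k * y))))
      - (E (star x * e k * y) - E (star x * e k) * z * E (e k * y))) := by
  have hN : Nu (fun k => star (e k) * e k - e k) :=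
    ((h.es.mulB h.Be).add h.e2).congr fun k => by noncomm_ring
  have hB : ∀ x, Bd (fun k => E (e k * x)) := fun x => (h.Be.mul (Bd.const x)).map E h.hC h.bdd
  have hX : ∀ x, Bd (fun k => x - ι (z * E (e k * x))) := fun x =>
    (Bd.const x).sub (((Bd.const z).mul (hB x)).map ι zero_le_one (iota_le ι))
  have h1 := ((Nu.Bmul (hX x).star hN).mulB (hX y)).map E h.bdd
  have h2 := (Nu.Bmul (hB x).star h.Ee).mulB ((Bd.const z).mul (hB y))
  refine (h1.add h2).congr fun k => ?_
  have hs : star (E (e k * x)) = E (star x * star (e k)) := by rw [← h.st, star_mul]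
  have e1 : star (e k * x - e k * ι (z * E (e k * x))) * (e k * y - e k * ι (z * E (e k * y))) =
     star (x - ι (z * E (e k * x))) * (star (e k) * e k - e k) * (y - ι (z * E (e k * y))) +
     (star x * e k * y - (star x * e k) * ι (z * E (e k * y)) - ι (star (E (e k * x)) * z) * (e k * y)
       + ι (star (E (e k * x)) * z) * e k * ι (z * E (e k * y))) := by
    have : star (ι (z * E (e k * x))) = ι (star (E (e k * x)) * z) := by
      rw [← map_star ι, star_mul, h.zs]
    simp only [star_sub, star_mul, this]
    noncomm_ring
  rw [e1]
  simp only [map_add, map_sub, ce_right h.hE, ce_left h.hE, h.hE.bimodule]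
  rw [hs]
  noncomm_ring

lemma RD.step3 (h : RD ι E u v e z C) :
    Nu (fun k => ∑ a, ∑ b, star (v a) * ι (E (star (e k * u a - e k * ι (z * E (e k * u a))) *
      (e k * u b - e k * ι (z * E (e k * u b))))) * v b) := by
  have h1 : Nu (fun k => ∑ a, ∑ b, star (v a) * ι (E (star (e k * u a - e k * ι (z * E (e k * u a))) *
      (e k * u b - e k * ι (z * E (e k * u b)))) -
      (E (star (u a) * e k * u b) - E (star (u a) * e k) * z * E (e k * u b))) * v b) :=
    Nu.sum fun a _ => Nu.sum fun b _ =>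
      ((Nu.Bmul (Bd.const (star (v a))) ((h.step2 (u a) (u b)).map ι (iota_le ι))).mulB (Bd.const (v b)))
  have h2 : Nu (fun k => ι z * (e k * e k - e k)) := Nu.Bmul (Bd.const _) h.e2
  have h3 : Nu (fun k => (e k * ι z - ι z * e k) * e k) := (h.com (ι z)).mulB h.Be
  refine ((h1.sub h2).sub h3).congr fun k => ?_
  have m1 : ∑ a, ∑ b, star (v a) * ι (E (star (u a) * e k * u b)) * v b = ι z * e k := by
    calc _ = ∑ a, star (v a) * (star (u a) * e k) := by
          refine Finset.sum_congr rfl fun a _ => ?_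
          conv_rhs => rw [(h.qb (star (u a) * e k)).2, Finset.mul_sum]
          simp only [mul_assoc]
      _ = star (∑ a, u a * v a) * e k := by
          rw [star_sum, Finset.sum_mul]; simp only [star_mul, mul_assoc]
      _ = _ := by rw [h.zi, ← map_star ι, h.zs]
  have m2 : ∑ a, ∑ b, star (v a) * ι (E (star (u a) * e k) * z * E (e k * u b)) * v b = e k * ι z * e k := by
    calc _ = (∑ a, star (v a) * ι (E (star (u a) * e k))) * ι z * (∑ b, ι (E (e k * u b)) * v b) := by
          rw [Finset.sum_mul, Finset.sum_mul]
          refine Finset.sum_congr rfl fun a _ => ?_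
          rw [Finset.mul_sum]
          refine Finset.sum_congr rfl fun b _ => ?_
          rw [map_mul, map_mul]; simp only [mul_assoc]
      _ = _ := by rw [qb_star h.hE h.qb, ← (h.qb (e k)).2]
  simp only [map_sub ι, mul_sub, sub_mul, Finset.sum_sub_distrib] at m1 m2 ⊢
  rw [m1, m2]
  noncomm_ring

set_option maxHeartbeats 1000000 in
lemma RD.step4 (h : RD ι E u v e z C) (y : T) : Nu (fun k => e k * y - e k * ι (z * E (e k * y))) := by
  letI := CStarAlgebra.spectralOrder Q
  haveI := CStarAlgebra.spectralOrderedRing Q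
  letI := CStarAlgebra.spectralOrder T
  haveI := CStarAlgebra.spectralOrderedRing T
  obtain ⟨K, hK⟩ := psd_of_vec (CStarMatrix.ofMatrix (fun l n : Fin m => E (v l * star (v n)))) (by
    ext i j
    rw [CStarMatrix.star_apply]
    show star (E (v j * star (v i))) = E (v i * star (v j))
    rw [← h.st, star_mul, star_star]) (fun p => by
      have := L1 (v := v) h.hE p p
      obtain ⟨w, hw⟩ := h.hE.pos (∑ a, star (v a) * ι (p a))
      rw [hw] at this
      exact (star_mul_self_nonneg w).trans_eq this.symm)
  have hKe : ∀ l n, E (v l * star (v n)) = ∑ t, star (K t l) * K t n := fun l n => by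
    have := congrFun (congrFun hK l) n
    rw [CStarMatrix.mul_apply] at this
    exact this
  set d : Fin m → ℕ → T := fun j k => e k * u j - e k * ι (z * E (e k * u j)) with hd
  set κ : Fin m → Fin m → ℕ → Q := fun t j k => ∑ n, K t n * E (star (u n) * d j k) with hκ
  set w : Fin m → ℕ → T := fun t k => ∑ j, ι (κ t j k) * v j with hw
  have hdd : ∀ i j k, E (star (d i k) * d j k) = ∑ t, star (κ t i k) * κ t j k := fun i j k => by
    have h1 := L1 (v := v) h.hE (fun n => E (star (u n) * d i k)) (fun n => E (star (u n) * d j k))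
    rw [qb_star h.hE h.qb, qb_star h.hE h.qb] at h1
    rw [← h1]
    exact (L2 hK (fun n => E (star (u n) * d i k)) (fun n => E (star (u n) * d j k))).symm
  have hww : ∀ k, ∑ t, star (w t k) * w t k = ∑ a, ∑ b, star (v a) * ι (E (star (d a k) * d b k)) * v b := by
    intro k
    simp only [hdd, hw, map_sum, map_mul, map_star, star_sum, star_mul, Finset.sum_mul, Finset.mul_sum]
    rw [Finset.sum_comm]
    conv_rhs => rw [Finset.sum_comm]
    refine Finset.sum_congr rfl fun b _ => ?_
    rw [Finset.sum_comm]
    refine Finset.sum_congr rfl fun a _ => Finset.sum_congr rfl fun t _ => ?_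
    simp only [mul_assoc]
  have hwn : ∀ t, Nu (w t) := fun t => by
    refine h.step3.of_sq fun k => ?_
    rw [← hww k, sq, ← CStarRing.norm_star_mul_self]
    exact CStarAlgebra.norm_le_norm_of_nonneg_of_le (star_mul_self_nonneg _)
      (Finset.single_le_sum (f := fun t => star (w t k) * w t k) (fun i _ => star_mul_self_nonneg _) (Finset.mem_univ t))
  have hfin : Nu (fun k => ∑ l, u l * ι (∑ t, star (K t l) * E (w t k * y))) :=
    Nu.sum fun l _ => Nu.Bmul (Bd.const _) ((Nu.sum fun t _ => Nu.Bmul (Bd.const _)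
      (((hwn t).mulB (Bd.const y)).map E h.bdd)).map ι (iota_le ι))
  refine hfin.congr fun k => ?_
  have s1 : ∀ l, ∑ t, star (K t l) * E (w t k * y) = ∑ j, E (v l * d j k) * E (v j * y) := fun l => by
    have s2 : ∀ j, E (v l * d j k) = ∑ t, star (K t l) * κ t j k := fun j => by
      calc E (v l * d j k) = ∑ n, E (v l * star (v n)) * E (star (u n) * d j k) := by
            conv_lhs => rw [← qb_star h.hE h.qb (d j k), Finset.mul_sum, map_sum]
            refine Finset.sum_congr rfl fun n _ => ?_
            rw [← mul_assoc, ce_right h.hE]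
        _ = _ := by
            simp only [hKe, hκ, Finset.sum_mul, Finset.mul_sum]
            rw [Finset.sum_comm]
            simp only [mul_assoc]
    have s3 : ∀ t, E (w t k * y) = ∑ j, κ t j k * E (v j * y) := fun t => by
      simp only [hw]
      rw [Finset.sum_mul, map_sum]
      refine Finset.sum_congr rfl fun j _ => ?_
      rw [mul_assoc, ce_left h.hE]
    simp only [s2, s3, Finset.sum_mul, Finset.mul_sum]
    rw [Finset.sum_comm]
    simp only [mul_assoc]
  simp only [s1]
  have s4 : e k * y - e k * ι (z * E (e k * y)) = ∑ j, d j k * ι (E (v j * y)) := by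
    simp only [hd, sub_mul, Finset.sum_sub_distrib]
    have a1 : ∑ j, e k * u j * ι (E (v j * y)) = e k * y := by
      conv_rhs => rw [(h.qb y).1, Finset.mul_sum]
      simp only [mul_assoc]
    have a2 : E (e k * y) = ∑ j, E (e k * u j) * E (v j * y) := by
      rw [← a1, map_sum]
      exact Finset.sum_congr rfl fun j _ => ce_right h.hE _ _
    rw [a1, a2]
    simp only [Finset.mul_sum, map_sum, map_mul, mul_assoc]
  have s5 : ∀ j, d j k = ∑ l, u l * ι (E (v l * d j k)) := fun j => (h.qb (d j k)).1
  rw [s4]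
  calc ∑ j, d j k * ι (E (v j * y)) = ∑ j, (∑ l, u l * ι (E (v l * d j k))) * ι (E (v j * y)) :=
        Finset.sum_congr rfl fun j _ => by rw [← s5 j]
    _ = _ := by
        simp only [Finset.sum_mul, Finset.mul_sum, map_sum, map_mul]
        rw [Finset.sum_comm]
        simp only [mul_assoc]

lemma RD.beta (h : RD ι E u v e z C) : ∃ (β : ℕ → T →ₗ[ℂ] Q) (M : ℝ), 1 ≤ M ∧ (∀ k x, ‖β k x‖ ≤ M * ‖x‖) ∧
    (∀ p, Nu (fun k => β k (ι p) - p)) ∧ (∀ x y, Nu (fun k => β k (x * y) - β k x * β k y)) ∧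
    (∀ x, Nu (fun k => β k (star x) - star (β k x))) := by
  obtain ⟨M, hM⟩ := h.Be
  have hM0 : 0 ≤ M := (norm_nonneg _).trans (hM 0)
  have hB : ∀ x, Bd (fun k => z * E (e k * x)) := fun x =>
    (Bd.const z).mul ((h.Be.mul (Bd.const x)).map E h.hC h.bdd)
  have hm : ∀ x, Nu (fun k => z * E (x * e k) - z * E (e k * x)) := fun x =>
    (Nu.Bmul (Bd.const (-z)) ((h.com x).map E h.bdd)).congr fun k => by
      rw [map_sub]; noncomm_ring
  refine ⟨fun k => (LinearMap.mulLeft ℂ z) ∘ₗ E ∘ₗ (LinearMap.mulLeft ℂ (e k)), ‖z‖ * (C * M) + 1, ?_, ?_, ?_, ?_, ?_⟩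
  · have := h.hC; have : 0 ≤ ‖z‖ * (C * M) := by positivity
    linarith
  · intro k x
    show ‖z * E (e k * x)‖ ≤ _
    calc _ ≤ ‖z‖ * (C * (M * ‖x‖)) := by
          refine (norm_mul_le _ _).trans ?_
          gcongr
          refine (h.bdd _).trans ?_
          have := h.hC
          gcongr
          refine (norm_mul_le _ _).trans ?_
          have := hM k
          gcongr
      _ ≤ _ := by rw [add_mul, one_mul]; have := norm_nonneg x; linarith
  · intro p
    show Nu (fun k => z * E (e k * ι p) - p)
    exact (h.Ee.mulB (Bd.const p)).congr fun k => by rw [ce_right h.hE]; noncomm_ring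
  · intro x y
    show Nu (fun k => z * E (e k * (x * y)) - z * E (e k * x) * (z * E (e k * y)))
    have h1 : Nu (fun k => (e k * x - x * e k) * y) := (h.com x).mulB (Bd.const y)
    have h2 : Nu (fun k => x * (e k * y - e k * ι (z * E (e k * y)))) := Nu.Bmul (Bd.const x) (h.step4 y)
    have h3 : Nu (fun k => (e k * x - x * e k) * ι (z * E (e k * y))) :=
      (h.com x).mulB ((hB y).map ι zero_le_one (iota_le ι))
    refine (Nu.Bmul (Bd.const z) (((h1.add h2).sub h3).map E h.bdd)).congr fun k => ?_
    have e1 : (e k * x - x * e k) * y + x * (e k * y - e k * ι (z * E (e k * y))) - (e k * x - x * e k) * ι (z * E (e k * y))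
      = e k * (x * y) - e k * x * ι (z * E (e k * y)) := by noncomm_ring
    rw [e1, map_sub, ce_right h.hE]; noncomm_ring
  · intro x
    show Nu (fun k => z * E (e k * star x) - star (z * E (e k * x)))
    have h1 : Nu (fun k => z * E (star x * (star (e k) - e k))) :=
      Nu.Bmul (Bd.const z) ((Nu.Bmul (Bd.const (star x)) h.es).map E h.bdd)
    refine (Nu.sub (Nu.sub (f := fun _ => 0) tendsto_const_nhds h1) (hm (star x))).congr fun k => ?_
    rw [star_mul, h.zs, ← h.zc, ← h.st, star_mul, mul_sub, map_sub]
    noncomm_ring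

end rok2
end DRank

namespace DRank
section fin1
variable {Q T B : Type*} [CStarAlgebra Q] [CStarAlgebra T] [CStarAlgebra B]
  [PartialOrder Q] [StarOrderedRing Q] [PartialOrder T] [StarOrderedRing T] [PartialOrder B] [StarOrderedRing B]

lemma Nu.bd {f : ℕ → Q} (h : Nu f) : Bd f := by
  obtain ⟨C, hC⟩ := (Metric.isBounded_range_of_tendsto f h).exists_norm_le
  exact ⟨C, fun k => hC _ ⟨k, rfl⟩⟩

lemma Nu.evle {g h : ℕ → Q} (hg : Nu g) {c ε : ℝ} (hc : c < ε) (hh : ∀ k, ‖h k - g k‖ ≤ c) :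
    ∀ᶠ k in atTop, ‖h k‖ ≤ ε := by
  have := (tendsto_zero_iff_norm_tendsto_zero.1 hg).eventually (gt_mem_nhds (sub_pos.2 hc))
  filter_upwards [this] with k hk
  have h1 := norm_add_le (h k - g k) (g k)
  rw [sub_add_cancel] at h1
  linarith [hh k]

lemma nu_matrix {N : Type*} [Fintype N] [DecidableEq N] {Y : ℕ → MM N Q} (h : ∀ p q, Nu (fun k => Y k p q)) {δ : ℝ} (hδ : 0 < δ) :
    ∀ᶠ k in atTop, ‖Y k‖ ≤ δ := by
  have h1 : Tendsto Y atTop (𝓝 0) := tendsto_pi_nhds.2 fun p => tendsto_pi_nhds.2 fun q => h p q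
  have h2 := (tendsto_zero_iff_norm_tendsto_zero.1 h1).eventually (gt_mem_nhds hδ)
  filter_upwards [h2] with k hk using hk.le

lemma row_map_le {N : Type*} [Fintype N] [DecidableEq N] (φ : B →⋆ₐ[ℂ] T) (w : N → B) :
    ‖(row (fun q => φ (w q)) : MM N T)‖ ≤ ‖(row w : MM N B)‖ := by
  rw [← pow_le_pow_iff_left₀ (norm_nonneg _) (norm_nonneg _) two_ne_zero, norm_row_sq, norm_row_sq]
  refine le_trans (le_of_eq ?_) (NonUnitalStarAlgHom.norm_apply_le φ _)
  simp only [map_sum, map_mul, map_star]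

structure BT (ι : Q →⋆ₐ[ℂ] T) (β : ℕ → T →ₗ[ℂ] Q) (M : ℝ) : Prop where
  hM : 1 ≤ M
  bdd : ∀ k x, ‖β k x‖ ≤ M * ‖x‖
  one : ∀ p, Nu (fun k => β k (ι p) - p)
  mul : ∀ x y, Nu (fun k => β k (x * y) - β k x * β k y)
  st : ∀ x, Nu (fun k => β k (star x) - star (β k x))

variable {ι : Q →⋆ₐ[ℂ] T} {β : ℕ → T →ₗ[ℂ] Q} {M : ℝ}

lemma BT.Bd (h : BT ι β M) (x : T) : Bd (fun k => β k x) := ⟨M * ‖x‖, fun k => h.bdd k x⟩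

lemma BT.gram (h : BT ι β M) {N : Type*} [Fintype N] (F : N → ℕ → Q) (f : N → T)
    (hF : ∀ q, Nu (fun k => F q k - β k (f q))) :
    Nu (fun k => ∑ q, F q k * star (F q k) - β k (∑ q, f q * star (f q))) := by
  have h1 : ∀ q, Nu (fun k => F q k * star (F q k) - β k (f q * star (f q))) := fun q => by
    have a1 := (hF q).mulB (hF q).bd.star
    have a2 := (hF q).mulB (h.Bd (f q)).star
    have a3 := Nu.Bmul (h.Bd (f q)) (hF q).star
    have a4 := h.mul (f q) (star (f q))
    have a5 := Nu.Bmul (h.Bd (f q)) (h.st (f q))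
    refine ((((a1.add a2).add a3).sub a4).sub a5).congr fun k => ?_
    rw [star_sub]
    noncomm_ring
  refine (Nu.sum (s := Finset.univ) fun q _ => h1 q).congr fun k => ?_
  rw [map_sum, Finset.sum_sub_distrib]

lemma BT.orth (h : BT ι β M) (φ : B →⋆ₐ[ℂ] T) {n : ℕ} {N I : Type} [Fintype N] [DecidableEq N] (b : N → I)
    (J : I → Fin (n+1)) (V : N → B) (c : I → B) (hc : ∀ i, IsSelfAdjoint (c i)) (hX : Exr b J V c) (j : Fin (n+1))
    {δ : ℝ} (hδ : 0 < δ) :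
    ∀ᶠ k in atTop, ‖(star (row (msk b J j (fun q => β k (φ (V q))))) * row (msk b J j (fun q => β k (φ (V q)))) -
      dg (msk b J j ((fun i => (1/2 : ℂ) • (β k (φ (c i)) + star (β k (φ (c i))))) ∘ b)) : MM N Q)‖ ≤ δ := by
  refine nu_matrix (fun p q => ?_) hδ
  have hz : Nu (fun _ : ℕ => (0 : Q)) := tendsto_const_nhds
  rcases p with _ | p <;> rcases q with _ | q
  · exact hz.congr fun k => by simp [mm_mul, mm_star]
  · exact hz.congr fun k => by simp [mm_mul, mm_star]
  · exact hz.congr fun k => by simp [mm_mul, mm_star]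
  · by_cases hp : J (b p) = j
    · by_cases hq : J (b q) = j
      · have h1 := hX p q (hp.trans hq.symm)
        have a1 : Nu (fun k => star (β k (φ (V p))) * β k (φ (V q)) - β k (φ (star (V p) * V q))) := by
          refine ((Nu.sub hz ((h.st (φ (V p))).mulB (h.Bd (φ (V q))))).sub (h.mul (star (φ (V p))) (φ (V q)))).congr fun k => ?_
          rw [map_mul φ, map_star φ]; noncomm_ring
        by_cases hpq : p = q
        · subst hpq
          rw [if_pos rfl] at h1
          have a2 := Nu.Bmul (Bd.const ((1/2 : ℂ) • (1 : Q))) (h.st (φ (c (b p))))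
          refine (a1.add a2).congr fun k => ?_
          rw [CStarMatrix.sub_apply, star_row_mul_row, dg_ss, if_pos rfl, h1, ← map_star φ, (hc (b p)).star_eq, smul_mul_assoc, one_mul]
          simp only [msk, hp, if_true, Function.comp]
          have : β k (φ (c (b p))) = (1/2 : ℂ) • β k (φ (c (b p))) + (1/2 : ℂ) • β k (φ (c (b p))) := by
            rw [← add_smul]; norm_num
          rw [smul_add, smul_sub]
          nth_rewrite 3 [this]
          abel
        · rw [if_neg hpq] at h1
          refine a1.congr fun k => ?_
          rw [CStarMatrix.sub_apply, star_row_mul_row, dg_ss, if_neg hpq, h1]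
          simp [msk, hp, hq]
      · refine hz.congr fun k => ?_
        rw [CStarMatrix.sub_apply, star_row_mul_row, dg_ss]
        have : p ≠ q := fun e => hq (e ▸ hp)
        simp [msk, hq, this]
    · refine hz.congr fun k => ?_
      rw [CStarMatrix.sub_apply, star_row_mul_row, dg_ss]
      simp [msk, hp]
end fin1

section fin2
variable {Q T : Type} [CStarAlgebra Q] [CStarAlgebra T]
  [PartialOrder Q] [StarOrderedRing Q] [PartialOrder T] [StarOrderedRing T] 
variable {ι : Q →⋆ₐ[ℂ] T} {β : ℕ → T →ₗ[ℂ] Q} {M : ℝ}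

set_option maxHeartbeats 1000000 in
lemma BT.good (h : BT ι β M) {n : ℕ} (hA : IsUnitalLocalAlg (drClass n) T) : Good n Q 1 := by
  classical
  intro S _ ε hε
  have hM := h.hM
  have hM0 : 0 < M := lt_of_lt_of_le one_pos hM
  obtain ⟨ε₁, h0, h1, h2, h3⟩ : ∃ ε₁ : ℝ, 0 < ε₁ ∧ ε₁ ≤ 1 ∧ M * ε₁ < ε ∧ M * (3 * ε₁) ^ 2 < ε ^ 2 := by
    refine ⟨min 1 (ε / (8 * M)), by positivity, min_le_left _ _, ?_, ?_⟩
    · have : M * min 1 (ε / (8 * M)) ≤ M * (ε / (8 * M)) := by gcongr; exact min_le_right _ _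
      have e1 : M * (ε / (8 * M)) = ε / 8 := by field_simp
      linarith
    · have : M * (3 * min 1 (ε / (8 * M))) ^ 2 ≤ M * (3 * (ε / (8 * M))) ^ 2 := by gcongr; exact min_le_right _ _
      have e1 : M * (3 * (ε / (8 * M))) ^ 2 = 9 / 64 * ε ^ 2 / M := by field_simp; norm_num
      have e2 : 9 / 64 * ε ^ 2 / M ≤ 9 / 64 * ε ^ 2 := div_le_self (by positivity) hM
      have : 0 < ε ^ 2 := by positivity
      linarith
  obtain ⟨B, hB, φ, hφ⟩ := hA (S.image ι) ε₁ h0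
  letI := CStarAlgebra.spectralOrder B.carrier
  haveI := CStarAlgebra.spectralOrderedRing B.carrier
  have hφ' : ∀ a ∈ S, ∃ y : B.carrier, ‖ι a - φ y‖ < ε₁ := fun a ha => hφ _ (Finset.mem_image_of_mem _ ha)
  choose! bb hbb using hφ'
  obtain ⟨s, r, J, V, c0, x, hX0, -, -, hV, hx⟩ := ex0_of_dr (dr_finsat hB) (S.image bb) ε₁ h0
  obtain ⟨c, hc, hX⟩ := exr_sa _ _ _ _ hX0
  refine ⟨∑ a ∈ S, ‖bd (x (bb a))‖, fun δ hδ => ?_⟩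
  have ev1 : ∀ᶠ k in atTop, ‖∑ q, β k (φ (V q)) * star (β k (φ (V q))) - 1‖ ≤ ε := by
    have g1 := h.gram (fun q k => β k (φ (V q))) (fun q => φ (V q)) (fun q =>
      Nu.congr (f := fun _ => 0) tendsto_const_nhds fun k => sub_self _)
    have g2 := g1.add (h.one 1)
    refine g2.evle h2 fun k => ?_
    have : ∑ q, β k (φ (V q)) * star (β k (φ (V q))) - 1 - (∑ q, β k (φ (V q)) * star (β k (φ (V q))) - β k (∑ q, φ (V q) * star (φ (V q))) + (β k (ι 1) - 1)) = β k (φ (∑ q, V q * star (V q) - 1)) := by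
      rw [map_sub φ, map_sub (β k), map_sum φ, map_one φ, map_one ι]
      simp only [map_mul, map_star]
      abel
    rw [this]
    refine (h.bdd k _).trans ?_
    gcongr
    exact (NonUnitalStarAlgHom.norm_apply_le φ _).trans hV
  have ev2 : ∀ᶠ k in atTop, ∀ j, ‖(star (row (msk Sigma.fst J j (fun q => β k (φ (V q))))) * row (msk Sigma.fst J j (fun q => β k (φ (V q)))) -
      dg (msk Sigma.fst J j ((fun i => (1/2 : ℂ) • (β k (φ (c i)) + star (β k (φ (c i))))) ∘ Sigma.fst)) : MM (Sg r) Q)‖ ≤ δ :=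
    eventually_all.2 fun j => h.orth φ Sigma.fst J V c hc hX j hδ
  have ev3 : ∀ᶠ k in atTop, ∀ a ∈ S, ‖(row (err a (bd (x (bb a))) (fun q => β k (φ (V q)))) : MM (Sg r) Q)‖ ≤ ε := by
    refine (Filter.eventually_all_finset S).2 fun a ha => ?_
    have g1 := h.gram (fun q k => err a (bd (x (bb a))) (fun q => β k (φ (V q))) q)
      (err (ι a) (bd (x (bb a))) (fun q => φ (V q))) (fun q => by
        have k1 := (h.one a).mulB (h.Bd (φ (V q)))
        have k2 := h.mul (ι a) (φ (V q))
        refine (Nu.sub (Nu.sub (f := fun _ => 0) tendsto_const_nhds k1) k2).congr fun k => ?_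
        simp only [err, map_sub, map_sum, map_smul]
        noncomm_ring)
    have g2 : ∀ᶠ k in atTop, ‖∑ q, err a (bd (x (bb a))) (fun q => β k (φ (V q))) q * star (err a (bd (x (bb a))) (fun q => β k (φ (V q))) q)‖ ≤ ε ^ 2 := by
      refine g1.evle h3 fun k => ?_
      rw [sub_sub_cancel]
      refine (h.bdd k _).trans ?_
      gcongr
      rw [← norm_row_le_iff _ (by positivity)]
      have e1 : err (ι a) (bd (x (bb a))) (fun q => φ (V q)) =
          (fun q => (ι a - φ (bb a)) * φ (V q)) + (fun q => φ (err (bb a) (bd (x (bb a))) V q)) := by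
        funext q
        simp only [err, Pi.add_apply, map_sub, map_sum, map_smul, map_mul]
        noncomm_ring
      rw [e1, map_add]
      have n1 : ‖(row (fun q => (ι a - φ (bb a)) * φ (V q)) : MM (Sg r) T)‖ ≤ ε₁ * 2 := by
        rw [← cor_mul_row]
        refine (norm_mul_le _ _).trans ?_
        rw [norm_cor]
        refine mul_le_mul (hbb a ha).le ?_ (norm_nonneg _) h0.le
        refine (row_map_le φ V).trans ?_
        rw [norm_row_le_iff _ (by norm_num)]
        have := norm_add_le (∑ q, V q * star (V q) - 1) 1
        rw [sub_add_cancel] at this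
        have h5 := norm_one_le B.carrier
        linarith
      have n2 := (row_map_le φ (err (bb a) (bd (x (bb a))) V)).trans (hx _ (Finset.mem_image_of_mem _ ha))
      refine (norm_add_le _ _).trans ?_
      linarith
    filter_upwards [g2] with k hk
    exact (norm_row_le_iff _ hε.le).2 hk
  obtain ⟨k, hk1, hk2, hk3⟩ := (ev1.and (ev2.and ev3)).exists
  refine ⟨Sg r, Fin s, inferInstance, inferInstance, inferInstance, inferInstance, Sigma.fst, J,
    fun q => β k (φ (V q)), fun i => (1/2 : ℂ) • (β k (φ (c i)) + star (β k (φ (c i)))),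
    fun a => bd (x (bb a)), fun q => one_mul _, fun i => ?_, fun a ha => ⟨?_, ?_⟩, hk2, hk1, hk3⟩
  · rw [IsSelfAdjoint, star_smul, star_add, star_star, add_comm]
    simp
  · exact Finset.single_le_sum (f := fun a => ‖bd (x (bb a))‖) (fun _ _ => norm_nonneg _) ha
  · intro q q' hq
    exact bd_apply_ne _ q q' hq
end fin2

theorem final_dr {n : ℕ} {Q T : Type} [CStarAlgebra Q] [CStarAlgebra T] {ι : Q →⋆ₐ[ℂ] T}
    {E : T →ₗ[ℂ] Q} (hE : IsCondExpect ι E) {m : ℕ} {u v : Fin m → T} (hq : IsQuasiBasis ι E u v)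
    (hR : CondExpectHasRokhlin ι E (∑ i, u i * v i)) (hA : IsUnitalLocalAlg (drClass n) T) :
    DecompositionRankLE n Q := by
  letI := CStarAlgebra.spectralOrder Q
  haveI := CStarAlgebra.spectralOrderedRing Q
  letI := CStarAlgebra.spectralOrder T
  haveI := CStarAlgebra.spectralOrderedRing T
  obtain ⟨e, z, C, h⟩ := rd_of hE hq hR
  obtain ⟨β, M, h1, h2, h3, h4, h5⟩ := h.beta
  have hb : BT ι β M := ⟨h1, h2, h3, h4, h5⟩
  exact dr_of_goodX (goodX_of_good (one_mul 1) (star_one Q) (hb.good hA)) (NonUnitalStarAlgHom.id ℂ Q)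
    Function.injective_id rfl (fun x _ => ⟨x, rfl⟩)

end DRank

open TopologicalSpace in
theorem stmt5 (n : ℕ) (P A : Type) [CStarAlgebra P] [CStarAlgebra A]
    [SeparableSpace P] [SeparableSpace A]
    (ι : P →⋆ₐ[ℂ] A) (hι : Function.Injective ι)
    (E : A →ₗ[ℂ] P) (hE : IsCondExpect ι E)
    (hfaithful : ∀ x : A, E (star x * x) = 0 → x = 0)
    (m : ℕ) (u v : Fin m → A) (hqb : IsQuasiBasis ι E u v)
    (hRok : CondExpectHasRokhlin ι E (∑ i, u i * v i))
    (hA : IsUnitalLocalAlg (drClass n) A) :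
    DecompositionRankLE n P := by
  exact DRank.final_dr hE hqb hRok hA

end
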